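/- Let 2 ≤ ℓ ≤ p−1 and r = p² − (p−1)ℓ + p. Let f(X) = X^{p²} + f_1X^{p²−1} + ⋯ + f_{p²} be an Eisenstein polynomial of degree p² over K satisfying: (1) v_p(f_p) = 1 and v_p(f_{pi}) ≥ 2 for all i ∈ 𝕀(2,p−1); (2) v_p(f_i) ≥ 2 for all i ∈ 𝕀(1,r−1), v_p(f_r) = 2, and v_p(f_i) ≥ 3 for all i ∈ 𝕀(r+1,p²−1); (3) −F_p/F_{p²} ∈ (κ_K^×)^{p−1}; (4) ℓ·G_r/(F_p·F_{p²}) ∈ (κ_K^×)^{p−1}. Let L = K(π) for a root π of f, F the unique degree-p subextension of L/K, L̃ the normal closure of L over K, G = Gal(F/K) with generator σ, and set U(X) = (−F_p/F_{p²})^ℓ·X^p − (ℓ·G_r/(F_p·F_{p²}))·X − 1 ∈ κ_K[X]. Then the extension 1 → Gal(L̃/F) → Gal(L̃/K) → G → 1 splits, Gal(L̃/F) is an indecomposable 𝔽_p[G]-module M under conjugation, and: if U has no root in κ_K then M ≅ 𝔽_p[G]/(σ−1)^{ℓ+1} (length ℓ+1) and the residue field of L̃ has degree p over κ_K (L̃/K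 contains an unramified part of degree p); if U has a root in κ_K then M ≅ 𝔽_p[G]/(σ−1)^ℓ (length ℓ) and L̃/K is totally ramified. -/

import Mathlib

open Polynomial IntermediateField

set_option synthInstance.maxHeartbeats 1000000
set_option maxHeartbeats 1000000
set_option linter.unusedSectionVars false

/-- The composite algebra structure `ℤ_[p] → ℚ_[p] → K`. -/
noncomputable instance zpAlgebra (p : ℕ) [Fact (Nat.Prime p)] (K : Type) [Field K]
    [Algebra ℚ_[p] K] : Algebra ℤ_[p] K :=
  ((algebraMap ℚ_[p] K).comp (algebraMap ℤ_[p] ℚ_[p])).toAlgebra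

/-- The composite algebra structure `ℚ_[p] → K → E` for an intermediate field `E` of `Ω/K`. -/
noncomputable instance intFieldQpAlgebra (p : ℕ) [Fact (Nat.Prime p)] (K : Type) [Field K]
    [Algebra ℚ_[p] K] (Ω : Type) [Field Ω] [Algebra K Ω] (E : IntermediateField K Ω) :
    Algebra ℚ_[p] E :=
  ((algebraMap K E).comp (algebraMap ℚ_[p] K)).toAlgebra

/-- The subgroup `Gal(E/F)` of `Gal(E/K)` fixing the image of `F ⊆ L` pointwise. -/
noncomputable def galFix {K L Ω : Type} [Field K] [Field L] [Field Ω] [Algebra K L]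
    [Algebra K Ω] [Algebra L Ω] [IsScalarTower K L Ω]
    (F : IntermediateField K L) (E : IntermediateField K Ω) : Subgroup (E ≃ₐ[K] E) where
  carrier := {τ | ∀ (x : F) (y : E), (y : Ω) = algebraMap L Ω (x : L) → τ y = y}
  one_mem' := fun _ _ _ => rfl
  mul_mem' := fun {τ₁ τ₂} h₁ h₂ x y hxy => by
    show τ₁ (τ₂ y) = y
    rw [h₂ x y hxy, h₁ x y hxy]
  inv_mem' := fun {τ} hτ x y hxy => by
    have h := hτ x y hxy
    show τ⁻¹ y = y
    conv_lhs => rw [← h]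
    exact τ.symm_apply_apply y

/-- `g ∈ Gal(E/K)` is a lift of `σ ∈ Gal(F/K)` (where `F ⊆ L ⊆ E ⊆ Ω`). -/
def IsLiftOf {K L Ω : Type} [Field K] [Field L] [Field Ω] [Algebra K L]
    [Algebra K Ω] [Algebra L Ω] [IsScalarTower K L Ω]
    (F : IntermediateField K L) (E : IntermediateField K Ω)
    (σ : F ≃ₐ[K] F) (g : E ≃ₐ[K] E) : Prop :=
  ∀ (x : F) (y : E), (y : Ω) = algebraMap L Ω (x : L) →
    (g y : Ω) = algebraMap L Ω ((σ x : F) : L)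

/-- A Galois-invariant nonarchimedean absolute value on an extension `Ω` of `K`, whose value group
on `K` is generated by the absolute value of `p`, and such that the residue field of `K` is
perfect. -/
structure LocalAbs (p : ℕ) (K Ω : Type*) [Field K] [Field Ω] [Algebra K Ω] where
  N : AbsoluteValue Ω ℝ
  nonarch : ∀ x y, N (x + y) ≤ max (N x) (N y)
  inv : ∀ (τ : Ω ≃ₐ[K] Ω) (x : Ω), N (τ x) = N x
  p_pos : 0 < N (p : Ω)
  p_lt : N (p : Ω) < 1
  discrete : ∀ x : K, x ≠ 0 → ∃ m : ℤ, N (algebraMap K Ω x) = N (p : Ω) ^ m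
  frob : ∀ x : K, N (algebraMap K Ω x) ≤ 1 →
    ∃ y : K, N (algebraMap K Ω y ^ p - algebraMap K Ω x) < 1

namespace LocalAbs

variable {p : ℕ} {K Ω : Type*} [Field K] [Field Ω] [Algebra K Ω] (v : LocalAbs p K Ω)

lemma N_sub_le (x y : Ω) : v.N (x - y) ≤ max (v.N x) (v.N y) := by
  rw [sub_eq_add_neg]
  exact (v.nonarch x (-y)).trans (by rw [v.N.map_neg])

lemma N_add_le {x y : Ω} {c : ℝ} (hx : v.N x ≤ c) (hy : v.N y ≤ c) : v.N (x + y) ≤ c :=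
  (v.nonarch x y).trans (max_le hx hy)

lemma N_sub_le' {x y : Ω} {c : ℝ} (hx : v.N x ≤ c) (hy : v.N y ≤ c) : v.N (x - y) ≤ c :=
  (v.N_sub_le x y).trans (max_le hx hy)

lemma N_add_lt {x y : Ω} {c : ℝ} (hx : v.N x < c) (hy : v.N y < c) : v.N (x + y) < c :=
  (v.nonarch x y).trans_lt (max_lt hx hy)

lemma N_sub_lt {x y : Ω} {c : ℝ} (hx : v.N x < c) (hy : v.N y < c) : v.N (x - y) < c :=
  (v.N_sub_le x y).trans_lt (max_lt hx hy)

lemma N_sum_le {ι : Type*} (s : Finset ι) (f : ι → Ω) {c : ℝ} (hc : 0 ≤ c)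
    (h : ∀ i ∈ s, v.N (f i) ≤ c) : v.N (∑ i ∈ s, f i) ≤ c := by
  classical
  induction s using Finset.induction_on with
  | empty => simpa using hc
  | insert a s ha ih =>
    rw [Finset.sum_insert ha]
    exact v.N_add_le (h a (by simp)) (ih fun i hi => h i (by simp [hi]))

lemma N_sum_lt {ι : Type*} (s : Finset ι) (f : ι → Ω) {c : ℝ} (hc : 0 < c)
    (h : ∀ i ∈ s, v.N (f i) < c) : v.N (∑ i ∈ s, f i) < c := by
  classical
  induction s using Finset.induction_on with
  | empty => simpa using hc
  | insert a s ha ih =>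
    rw [Finset.sum_insert ha]
    exact v.N_add_lt (h a (by simp)) (ih fun i hi => h i (by simp [hi]))

lemma N_eq_of_sub_lt {x y : Ω} (h : v.N (x - y) < v.N y) : v.N x = v.N y := by
  apply le_antisymm
  · have := v.nonarch (x - y) y
    rw [sub_add_cancel] at this
    exact this.trans (max_le h.le le_rfl)
  · by_contra! h2
    have := v.N_sub_lt (x := x) (y := x - y) h2 h
    simp at this

lemma N_eq_of_sub_lt' {x y : Ω} (h : v.N (x - y) < v.N x) : v.N x = v.N y :=
  (v.N_eq_of_sub_lt (x := y) (y := x) (by rwa [v.N.map_sub])).symm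

lemma N_nat_le (n : ℕ) : v.N (n : Ω) ≤ 1 := by
  induction n with
  | zero => simp
  | succ n ih => push_cast; exact v.N_add_le ih (by simp)

lemma N_int_le (n : ℤ) : v.N (n : Ω) ≤ 1 := by
  obtain ⟨m, rfl | rfl⟩ := n.eq_nat_or_neg
  · exact_mod_cast v.N_nat_le m
  · push_cast; rw [v.N.map_neg]; exact v.N_nat_le m

lemma N_p_mul_int_lt (n : ℤ) : v.N ((p : Ω) * n) < 1 := by
  rw [map_mul]
  have := v.N_int_le n
  have := v.p_lt
  have := v.p_pos
  nlinarith [v.N.nonneg (n : Ω)]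

lemma N_int_eq_one {n : ℤ} (h : IsCoprime n (p : ℤ)) : v.N (n : Ω) = 1 := by
  refine le_antisymm (v.N_int_le n) ?_
  obtain ⟨a, b, hab⟩ := h
  have h1 : v.N ((a : Ω) * n) = 1 := by
    have : ((a : Ω) * n) = 1 - (p : Ω) * (b : ℤ) := by
      have : (a : Ω) * n + b * (p : Ω) = 1 := by exact_mod_cast congrArg (Int.cast (R := Ω)) hab
      linear_combination this
    rw [this, v.N_eq_of_sub_lt (y := 1)]
    · simp
    · simpa [v.N.map_neg] using v.N_p_mul_int_lt b
  rw [map_mul] at h1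
  nlinarith [v.N_int_le a, v.N.nonneg (n : Ω), v.N.nonneg (a : Ω)]

lemma N_nat_eq_one {n : ℕ} (h : n.Coprime p) : v.N (n : Ω) = 1 := by
  have := v.N_int_eq_one (n := n) (by exact_mod_cast Nat.isCoprime_iff_coprime.2 h)
  exact_mod_cast this

/-- The additive subgroup of elements of absolute value less than one. -/
def m : AddSubgroup Ω where
  carrier := {x | v.N x < 1}
  add_mem' := fun hx hy => v.N_add_lt hx hy
  zero_mem' := by simp
  neg_mem' := fun {x} hx => by simpa [v.N.map_neg] using hx

/-- Reduction modulo the elements of absolute value less than one. -/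
def q : Ω →+ Ω ⧸ v.m := QuotientAddGroup.mk' v.m

lemma q_eq_iff {x y : Ω} : v.q x = v.q y ↔ v.N (x - y) < 1 := by
  rw [← sub_eq_zero, ← map_sub]
  exact QuotientAddGroup.eq_zero_iff (N := v.m) (x - y)

lemma q_eq_zero_iff {x : Ω} : v.q x = 0 ↔ v.N x < 1 := by
  rw [← map_zero v.q, q_eq_iff, sub_zero]

lemma q_map {x y : Ω} (τ : Ω ≃ₐ[K] Ω) (h : v.q x = v.q y) : v.q (τ x) = v.q (τ y) := by
  rw [q_eq_iff] at *
  rwa [← map_sub, v.inv]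

lemma q_intCast (n : ℤ) : v.q (n : Ω) = n • v.q 1 := by
  rw [← map_zsmul]; simp

lemma q_map_zsmul_one {x : Ω} {n : ℤ} (τ : Ω ≃ₐ[K] Ω) (h : v.q x = n • v.q 1) :
    v.q (τ x) = n • v.q 1 := by
  rw [← q_intCast] at *
  rw [v.q_map τ h]; simp

lemma zsmul_q_one_eq_zero_iff [Fact p.Prime] {n : ℤ} : n • v.q 1 = 0 ↔ (p : ℤ) ∣ n := by
  rw [← q_intCast, q_eq_zero_iff]
  constructor
  · intro h
    by_contra h2
    have := v.N_int_eq_one (n := n)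
      (((Nat.prime_iff_prime_int.1 Fact.out).coprime_iff_not_dvd.2 h2).symm)
    linarith
  · rintro ⟨k, rfl⟩
    exact_mod_cast v.N_p_mul_int_lt k

/-- Elements small enough that `x ↦ x ^ p - x` is additive modulo elements of absolute value less
than one. -/
def Sm (x : Ω) : Prop := v.N (p : Ω) * v.N x ^ p < 1

variable {v}

lemma Sm.of_le {x y : Ω} (hy : v.Sm y) (h : v.N x ≤ v.N y) : v.Sm x :=
  lt_of_le_of_lt (mul_le_mul_of_nonneg_left (pow_le_pow_left₀ (v.N.nonneg x) h p) v.p_pos.le) hy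

lemma Sm.of_le_one {x : Ω} (h : v.N x ≤ 1) : v.Sm x :=
  lt_of_le_of_lt (mul_le_of_le_one_right v.p_pos.le (pow_le_one₀ (v.N.nonneg x) h)) v.p_lt

lemma Sm.add {x y : Ω} (hx : v.Sm x) (hy : v.Sm y) : v.Sm (x + y) := by
  rcases le_total (v.N x) (v.N y) with h | h
  · exact hy.of_le (v.N_add_le h le_rfl)
  · exact hx.of_le (v.N_add_le le_rfl h)

lemma Sm.neg {x : Ω} (hx : v.Sm x) : v.Sm (-x) := hx.of_le (by rw [v.N.map_neg])

lemma Sm.sub {x y : Ω} (hx : v.Sm x) (hy : v.Sm y) : v.Sm (x - y) := by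
  rw [sub_eq_add_neg]; exact hx.add hy.neg

lemma Sm.map {x : Ω} (hx : v.Sm x) (τ : Ω ≃ₐ[K] Ω) : v.Sm (τ x) := hx.of_le (v.inv τ x).le

lemma Sm.int_mul {x : Ω} (hx : v.Sm x) (n : ℤ) : v.Sm (n * x) :=
  hx.of_le (by rw [map_mul]; exact mul_le_of_le_one_left (v.N.nonneg x) (v.N_int_le n))

lemma Sm.of_q_eq {x y : Ω} (hx : v.Sm x) (h : v.q x = v.q y) : v.Sm y := by
  rw [q_eq_iff] at h
  have : y = x - (x - y) := by ring
  rw [this]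
  exact hx.sub (Sm.of_le_one h.le)

lemma Sm.mul_lt [Fact p.Prime] {x y z : Ω} (hy : v.Sm y) (hx : v.N x ≤ v.N (p : Ω))
    (hz : v.N z ≤ max 1 (v.N y ^ p)) : v.N (x * z) < 1 := by
  rw [map_mul]
  refine lt_of_le_of_lt (mul_le_mul hx hz (v.N.nonneg z) v.p_pos.le) ?_
  rcases max_choice 1 (v.N y ^ p) with h | h <;> rw [h]
  · simpa using v.p_lt
  · exact hy

lemma Sm.p_mul_lt [Fact p.Prime] {x : Ω} (hx : v.Sm x) : v.N (p * x) < 1 := by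
  refine hx.mul_lt le_rfl ?_
  rcases le_total (v.N x) 1 with h | h
  · exact h.trans (le_max_left _ _)
  · exact (le_self_pow₀ h (Fact.out : p.Prime).ne_zero).trans (le_max_right _ _)

lemma N_add_pow_sub_lt [Fact p.Prime] {x y : Ω} (hx : v.Sm x) (hy : v.Sm y) :
    v.N ((x + y) ^ p - (x ^ p + y ^ p)) < 1 := by
  wlog h : v.N x ≤ v.N y generalizing x y
  · have := this hy hx (le_of_not_ge h)
    rwa [add_comm x y, add_comm (x ^ p)]
  have hp := (Fact.out : p.Prime).pos
  have h2 : (x + y) ^ p - (x ^ p + y ^ p)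
      = ∑ k ∈ Finset.range (p - 1), x ^ (k + 1) * y ^ (p - (k + 1)) * (p.choose (k + 1) : Ω) := by
    rw [add_pow, Finset.sum_range_succ]
    obtain ⟨p', rfl⟩ : ∃ p', p = p' + 1 := ⟨p - 1, by omega⟩
    rw [Finset.sum_range_succ']
    simp
    ring
  rw [h2]
  refine v.N_sum_lt _ _ one_pos fun k hk => ?_
  rw [mul_comm]
  rw [Finset.mem_range] at hk
  refine hy.mul_lt ?_ (le_trans ?_ (le_max_right _ _))
  · obtain ⟨c, hc⟩ := (Fact.out : p.Prime).dvd_choose_self (k := k + 1) (by omega) (by omega)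
    rw [hc]; push_cast; rw [map_mul]
    exact mul_le_of_le_one_right v.p_pos.le (v.N_nat_le c)
  · rw [map_mul, map_pow, map_pow]
    calc _ ≤ v.N y ^ (k + 1) * v.N y ^ (p - (k + 1)) := by gcongr
      _ = _ := by rw [← pow_add]; congr 1; omega

lemma q_wp_add [Fact p.Prime] {x y : Ω} (hx : v.Sm x) (hy : v.Sm y) :
    v.q ((x + y) ^ p - (x + y)) = v.q (x ^ p - x) + v.q (y ^ p - y) := by
  rw [← map_add, q_eq_iff]
  have := N_add_pow_sub_lt hx hy
  convert this using 2
  ring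

lemma q_wp_neg (hodd : Odd p) (x : Ω) :
    v.q ((-x) ^ p - (-x)) = - v.q (x ^ p - x) := by
  rw [← map_neg, hodd.neg_pow]; congr 1; ring

lemma q_wp_sub [Fact p.Prime] (hodd : Odd p) {x y : Ω} (hx : v.Sm x) (hy : v.Sm y) :
    v.q ((x - y) ^ p - (x - y)) = v.q (x ^ p - x) - v.q (y ^ p - y) := by
  rw [sub_eq_add_neg x y, q_wp_add hx hy.neg, q_wp_neg hodd]; abel

lemma q_wp_int_mul [Fact p.Prime] (hodd : Odd p) {x : Ω} (hx : v.Sm x) (n : ℤ) :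
    v.q ((n * x) ^ p - n * x) = n • v.q (x ^ p - x) := by
  induction n with
  | zero => simp [(Fact.out : p.Prime).ne_zero]
  | succ n ih =>
    have h : (((n : ℤ) + 1 : ℤ) : Ω) * x = ((n : ℤ) : Ω) * x + x := by push_cast; ring
    rw [h, q_wp_add (hx.int_mul n) hx, ih, add_zsmul, one_zsmul]
  | pred n ih =>
    have h : ((-(n : ℤ) - 1 : ℤ) : Ω) * x = ((-(n : ℤ) : ℤ) : Ω) * x - x := by push_cast; ring
    rw [h, q_wp_sub hodd (hx.int_mul _) hx, ih, sub_zsmul, one_zsmul, sub_eq_add_neg]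

lemma q_wp_of_lt [Fact p.Prime] {x : Ω} (hx : v.N x < 1) : v.q (x ^ p - x) = 0 := by
  rw [q_eq_zero_iff]
  refine v.N_sub_lt ?_ hx
  rw [map_pow]
  exact pow_lt_one₀ (v.N.nonneg x) hx (Fact.out : p.Prime).ne_zero

lemma q_wp_congr [Fact p.Prime] {x y : Ω} (hx : v.Sm x) (h : v.q x = v.q y) :
    v.q (x ^ p - x) = v.q (y ^ p - y) := by
  have hy := hx.of_q_eq h
  have h2 : v.N (x - y) < 1 := q_eq_iff v |>.1 h
  have : x = y + (x - y) := by ring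
  conv_lhs => rw [this]
  rw [q_wp_add hy (Sm.of_le_one h2.le), q_wp_of_lt h2, add_zero]

lemma N_wp_of_one_lt [Fact p.Prime] {x : Ω} (h : 1 < v.N x) : v.N (x ^ p - x) = v.N x ^ p := by
  rw [v.N_eq_of_sub_lt (y := x ^ p), map_pow]
  rw [sub_sub_cancel_left, v.N.map_neg, map_pow]
  exact lt_self_pow₀ h (Fact.out : p.Prime).one_lt

lemma N_le_one_of_wp [Fact p.Prime] {x : Ω} (h : v.N (x ^ p - x) ≤ 1) : v.N x ≤ 1 := by
  by_contra! h2
  rw [N_wp_of_one_lt h2] at h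
  exact absurd (one_lt_pow₀ h2 (Fact.out : p.Prime).ne_zero) (not_lt.2 h)

lemma N_pow_of_wp_sub [Fact p.Prime] {x a : Ω} (ha : 1 < v.N a) (h : v.N (x ^ p - x - a) < 1) :
    v.N x ^ p = v.N a := by
  have h1 : v.N (x ^ p - x) = v.N a := v.N_eq_of_sub_lt (h.trans ha)
  have h2 : 1 < v.N x := by
    by_contra! h2
    have : v.N (x ^ p - x) ≤ 1 := v.N_sub_le' (by
      rw [map_pow]; exact pow_le_one₀ (v.N.nonneg x) h2) h2
    linarith
  rw [← h1, N_wp_of_one_lt h2]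

lemma Sm.of_wp [Fact p.Prime] {x a : Ω} (ha : v.N (p : Ω) * v.N a < 1)
    (h : v.N (x ^ p - x - a) < 1) : v.Sm x := by
  rcases lt_or_ge 1 (v.N a) with h1 | h1
  · unfold Sm
    rwa [N_pow_of_wp_sub h1 h]
  · refine Sm.of_le_one (N_le_one_of_wp ?_)
    have : x ^ p - x = (x ^ p - x - a) + a := by ring
    rw [this]
    exact v.N_add_le h.le h1

end LocalAbs

namespace LocalAbs

lemma exists_prod_range_sub (p : ℕ) [Fact p.Prime] :
    ∃ Q : ℤ[X], ∏ j ∈ Finset.range p, (X - C (j : ℤ)) = X ^ p - X + C (p : ℤ) * Q := by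
  have hp := (Fact.out : p.Prime)
  have h : C (p : ℤ) ∣ (∏ j ∈ Finset.range p, (X - C (j : ℤ))) - (X ^ p - X) := by
    rw [C_dvd_iff_dvd_coeff]
    intro i
    rw [← ZMod.intCast_zmod_eq_zero_iff_dvd]
    have h2 : (((∏ j ∈ Finset.range p, (X - C (j : ℤ))) - (X ^ p - X)).map
        (Int.castRingHom (ZMod p))) = 0 := by
      rw [Polynomial.map_sub, Polynomial.map_prod]
      simp only [Polynomial.map_sub, map_X, Polynomial.map_pow, map_C]
      rw [sub_eq_zero]
      have h3 : (X ^ p - X : (ZMod p)[X]) = ∏ a : ZMod p, (X - C a) := by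
        have h4 := FiniteField.roots_X_pow_card_sub_X (ZMod p)
        rw [ZMod.card] at h4
        have h5 : (X ^ p - X : (ZMod p)[X]).natDegree = p :=
          FiniteField.X_pow_card_sub_X_natDegree_eq (ZMod p) hp.one_lt
        have h6 := Polynomial.prod_multiset_X_sub_C_of_monic_of_roots_card_eq
          (p := (X ^ p - X : (ZMod p)[X])) ?_ ?_
        · rw [← h6, h4]; rfl
        · refine monic_X_pow_sub ?_
          rw [degree_X]; exact_mod_cast hp.one_lt
        · rw [h4, h5]; simp [ZMod.card]
      rw [h3]
      symm
      refine Finset.prod_bij' (fun a _ => a.val) (fun j _ => (j : ZMod p)) ?_ ?_ ?_ ?_ ?_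
      · intro a _; simpa using ZMod.val_lt a
      · simp
      · intro a _; simp
      · intro j hj; exact ZMod.val_cast_of_lt (by simpa using hj)
      · intro a _; simp
    have := congrArg (fun P => P.coeff i) h2
    rw [coeff_map] at this
    simpa using this
  obtain ⟨Q, hQ⟩ := h
  exact ⟨Q, by rw [← hQ]; ring⟩

variable {p : ℕ} [Fact p.Prime] {K Ω : Type*} [Field K] [Field Ω] [Algebra K Ω] {v : LocalAbs p K Ω}

lemma N_eval_int_le {x : Ω} (h : v.N x ≤ 1) (Q : ℤ[X]) : v.N (aeval x Q) ≤ 1 := by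
  rw [aeval_eq_sum_range]
  refine v.N_sum_le _ _ zero_le_one fun i _ => ?_
  rw [zsmul_eq_mul, map_mul, map_pow]
  exact mul_le_one₀ (v.N_int_le _) (by positivity) (pow_le_one₀ (v.N.nonneg x) h)

lemma exists_q_eq_zsmul {x : Ω} (h : v.q (x ^ p - x) = 0) : ∃ j : ℤ, v.q x = j • v.q 1 := by
  rw [q_eq_zero_iff] at h
  have hx : v.N x ≤ 1 := N_le_one_of_wp h.le
  obtain ⟨Q, hQ⟩ := exists_prod_range_sub p
  have h1 := congrArg (aeval x) hQ
  simp only [map_prod, map_sub, aeval_X, map_add, map_pow, map_mul, aeval_C] at h1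
  have h2 : v.N (∏ j ∈ Finset.range p, (x - (j : Ω))) < 1 := by
    have : ∏ j ∈ Finset.range p, (x - (j : Ω)) = x ^ p - x + (p : Ω) * aeval x Q := by
      simpa using h1
    rw [this]
    refine v.N_add_lt h ?_
    rw [map_mul]
    exact lt_of_le_of_lt (mul_le_of_le_one_right v.p_pos.le (N_eval_int_le hx Q)) v.p_lt
  rw [map_prod] at h2
  by_contra! h3
  refine absurd h2 (not_lt.2 ?_)
  have : ∀ j ∈ Finset.range p, (1:ℝ) ≤ v.N (x - (j : Ω)) := fun j _ => by
    have := h3 j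
    rw [← q_intCast, ne_eq, q_eq_iff] at this
    simpa using this
  calc (1 : ℝ) = ∏ j ∈ Finset.range p, 1 := by simp
    _ ≤ _ := Finset.prod_le_prod (fun _ _ => zero_le_one) this

lemma exists_q_eq_add_zsmul (hodd : Odd p) {x y : Ω} (hx : v.Sm x) (hy : v.Sm y)
    (h : v.q (x ^ p - x) = v.q (y ^ p - y)) : ∃ j : ℤ, v.q x = v.q y + j • v.q 1 := by
  obtain ⟨j, hj⟩ := exists_q_eq_zsmul (v := v) (x := x - y) (by
    rw [q_wp_sub hodd hx hy, h, sub_self])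
  exact ⟨j, by rw [← hj, map_sub]; abel⟩

/-- Two exact roots of `X ^ p - X - a` that are close are equal. -/
lemma wp_inj {x y : Ω} (hx : v.Sm x) (h : x ^ p - x = y ^ p - y)
    (hxy : v.q x = v.q y) : x = y := by
  by_contra hne
  rw [q_eq_iff] at hxy
  set z := x - y with hz
  have hz0 : z ≠ 0 := sub_ne_zero.2 hne
  obtain ⟨r, hr⟩ := exists_add_pow_prime_eq (Fact.out : p.Prime) y z
  have hp := (Fact.out : p.Prime)
  have hy : v.Sm y := hx.of_q_eq (v.q_eq_iff.2 hxy)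
  have key : v.N ((y + z) ^ p - (y ^ p + z ^ p)) < v.N z := by
    have h2 : (y + z) ^ p - (y ^ p + z ^ p)
        = z * ∑ k ∈ Finset.range (p - 1),
          z ^ k * y ^ (p - (k + 1)) * (p.choose (k + 1) : Ω) := by
      rw [add_comm y z, add_pow, Finset.sum_range_succ]
      obtain ⟨p', rfl⟩ : ∃ p', p = p' + 1 := ⟨p - 1, by have := hp.pos; omega⟩
      rw [Finset.sum_range_succ', Finset.mul_sum]
      simp [pow_succ]
      exact Finset.sum_congr rfl fun k _ => by ring
    rw [h2, map_mul]
    refine mul_lt_of_lt_one_right (v.N.pos hz0) (v.N_sum_lt _ _ one_pos fun k hk => ?_)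
    rw [Finset.mem_range] at hk
    rw [mul_comm]
    refine hy.mul_lt ?_ ?_
    · obtain ⟨c, hc⟩ := hp.dvd_choose_self (k := k + 1) (by omega) (by omega)
      rw [hc]; push_cast; rw [map_mul]
      exact mul_le_of_le_one_right v.p_pos.le (v.N_nat_le c)
    · rw [map_mul, map_pow, map_pow]
      refine le_trans (mul_le_of_le_one_left (by positivity)
        (pow_le_one₀ (v.N.nonneg z) hxy.le)) ?_
      rcases le_total (v.N y) 1 with h | h
      · exact (pow_le_one₀ (v.N.nonneg y) h).trans (le_max_left _ _)
      · exact (pow_le_pow_right₀ h (by omega)).trans (le_max_right _ _)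
  have h3 : z = ((y + z) ^ p - (y ^ p + z ^ p)) + z ^ p := by
    have : y + z = x := by rw [hz]; ring
    rw [this]
    linear_combination -h
  have h4 : v.N (z ^ p) < v.N z := by
    rw [map_pow]
    exact pow_lt_self_of_lt_one₀ (v.N.pos hz0) hxy hp.one_lt
  have := v.N_add_lt key h4
  rw [← h3] at this
  exact lt_irrefl _ this

lemma mem_of_fixed [IsGalois K Ω] (E : IntermediateField K Ω) (x : Ω)
    (h : ∀ τ : Ω ≃ₐ[K] Ω, (∀ y ∈ E, τ y = y) → τ x = x) : x ∈ E := by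
  rw [← InfiniteGalois.fixedField_fixingSubgroup E]
  rw [IntermediateField.mem_fixedField_iff]
  intro τ hτ
  exact h τ fun y hy => (mem_fixingSubgroup_iff E τ).1 hτ y hy

/-- A version of Hensel's lemma for `X ^ p - X - a`. -/
lemma exists_wp_eq [IsGalois K Ω] [IsAlgClosed Ω] (E : IntermediateField K Ω) {x a : Ω}
    (hx : x ∈ E) (ha : a ∈ E) (hs : v.Sm x) (h : v.q (x ^ p - x) = v.q a) :
    ∃ y ∈ E, y ^ p - y = a ∧ v.q y = v.q x := by
  have hp := (Fact.out : p.Prime)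
  have hd : (X ^ p - X - C a : Polynomial Ω).natDegree = p := by
    have : (X ^ p - X - C a : Polynomial Ω) = X ^ p - (X + C a) := by ring
    rw [this, natDegree_sub_eq_left_of_natDegree_lt] <;> simp [hp.one_lt]
  have hm : (X ^ p - X - C a : Polynomial Ω).Monic := by
    have : (X ^ p - X - C a : Polynomial Ω) = X ^ p - (X + C a) := by ring
    rw [this]
    refine monic_X_pow_sub ?_
    rw [degree_X_add_C]; exact_mod_cast hp.one_lt
  have hsplit := (IsAlgClosed.splits (X ^ p - X - C a : Polynomial Ω))
  have hev : eval x (X ^ p - X - C a : Polynomial Ω) =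
      (((X ^ p - X - C a : Polynomial Ω).roots.map fun r => x - r)).prod := by
    conv_lhs => rw [hsplit.eq_prod_roots_of_monic hm]
    rw [eval_multiset_prod, Multiset.map_map]; simp
  have hex : ∃ r ∈ (X ^ p - X - C a : Polynomial Ω).roots, v.N (x - r) < 1 := by
    by_contra! h3
    have h4 : v.N (eval x (X ^ p - X - C a : Polynomial Ω)) < 1 := by
      rw [q_eq_iff] at h; simpa using h
    rw [hev, map_multiset_prod, Multiset.map_map] at h4
    refine absurd h4 (not_lt.2 ?_)
    refine Multiset.one_le_prod ?_
    intro c hc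
    obtain ⟨r, hr, rfl⟩ := Multiset.mem_map.1 hc
    exact h3 r hr
  obtain ⟨r, hr, hrx⟩ := hex
  have hr0 : r ^ p - r = a := by
    have := (mem_roots hm.ne_zero).1 hr
    simpa [sub_eq_zero] using this
  have hq : v.q r = v.q x := (v.q_eq_iff.2 hrx).symm
  refine ⟨r, mem_of_fixed E r fun τ hτ => ?_, hr0, hq⟩
  refine wp_inj (v := v) ((hs.of_q_eq hq.symm).map τ) ?_ ?_
  · rw [← map_pow, ← map_sub, hr0, hτ a ha]
  · rw [v.q_map τ hq, hτ x hx, hq]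

lemma mem_of_wp_eq [IsGalois K Ω] [IsAlgClosed Ω] (hodd : Odd p) (E : IntermediateField K Ω)
    {x y a : Ω} (hx : x ∈ E) (hs : v.Sm x) (ha : a ∈ E) (h : v.q (x ^ p - x) = v.q a)
    (hy : v.Sm y) (hya : y ^ p - y = a) : y ∈ E := by
  obtain ⟨j, hj⟩ := exists_q_eq_add_zsmul hodd hy hs (by rw [hya, h])
  have hxj : v.q (x + (j : Ω)) = v.q y := by rw [hj, map_add, q_intCast]
  have hs' : v.Sm (x + (j : Ω)) := hy.of_q_eq hxj.symm
  obtain ⟨z, hz, hza, hzq⟩ := exists_wp_eq E (x := x + (j : Ω)) (E.add_mem hx (intCast_mem E j)) ha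
    hs' (by rw [q_wp_congr hs' hxj, hya])
  rw [← wp_inj (v := v) (hs'.of_q_eq hzq.symm) (by rw [hza, hya]) (hzq.trans hxj)]
  exact hz

end LocalAbs

namespace LocalAbs

variable {p : ℕ} {K Ω : Type*} [Field K] [Field Ω] [Algebra K Ω] (v : LocalAbs p K Ω)

lemma N_sum_eq {ι : Type*} (s : Finset ι) (f : ι → Ω) {i : ι} (hi : i ∈ s)
    (hpos : f i ≠ 0) (h : ∀ j ∈ s, j ≠ i → v.N (f j) < v.N (f i)) :
    v.N (∑ j ∈ s, f j) = v.N (f i) := by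
  classical
  apply v.N_eq_of_sub_lt
  rw [← Finset.add_sum_erase s f hi, add_sub_cancel_left]
  refine v.N_sum_lt _ _ (v.N.pos hpos) fun j hj => ?_
  rw [Finset.mem_erase] at hj
  exact h j hj.2 hj.1

variable {v}

lemma pos_of_pow_eq {θ : Ω} {n : ℕ} (hn : 0 < n) (hθ : v.N θ ^ n = v.N (p : Ω)) :
    0 < v.N θ := by
  rcases (v.N.nonneg θ).eq_or_lt with h | h
  · rw [← h, zero_pow hn.ne'] at hθ
    have := v.p_pos; linarith
  · exact h

lemma lt_one_of_pow_eq {θ : Ω} {n : ℕ} (hθ : v.N θ ^ n = v.N (p : Ω)) :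
    v.N θ < 1 := by
  by_contra! h
  have := one_le_pow₀ h (n := n)
  have := v.p_lt
  linarith

lemma N_pow_mul_eq {θ w : Ω} {n : ℕ} {m : ℤ} (hn : 0 < n) (hθ : v.N θ ^ n = v.N (p : Ω))
    (hw : v.N w = v.N (p : Ω) ^ m) (i : ℕ) : v.N (θ ^ i * w) = v.N θ ^ (i + n * m : ℤ) := by
  have h0 := pos_of_pow_eq hn hθ
  rw [map_mul, map_pow, hw, ← hθ, zpow_add₀ h0.ne', zpow_mul, zpow_natCast, zpow_natCast]

lemma N_sum_pow_mul {θ : Ω} {n : ℕ} (hn : 0 < n) (hθ : v.N θ ^ n = v.N (p : Ω))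
    (w : Fin n → Ω) (hw : ∀ i, w i ≠ 0 → ∃ m : ℤ, v.N (w i) = v.N (p : Ω) ^ m) (hw0 : w ≠ 0) :
    ∃ i : Fin n, w i ≠ 0 ∧ v.N (∑ j : Fin n, θ ^ (j : ℕ) * w j) = v.N (θ ^ (i : ℕ) * w i) ∧
      ∀ j : Fin n, v.N (θ ^ (j : ℕ) * w j) ≤ v.N (θ ^ (i : ℕ) * w i) := by
  have : Nonempty (Fin n) := ⟨⟨0, hn⟩⟩
  have h0 := pos_of_pow_eq hn hθ
  have h0' : θ ≠ 0 := v.N.ne_zero_iff.1 h0.ne'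
  have h1 := lt_one_of_pow_eq hθ
  obtain ⟨i, -, hi⟩ := Finset.exists_max_image Finset.univ
    (fun j : Fin n => v.N (θ ^ (j : ℕ) * w j)) Finset.univ_nonempty
  have hwi : w i ≠ 0 := by
    intro h
    apply hw0
    funext j
    have := hi j (Finset.mem_univ j)
    rw [h, mul_zero, map_zero] at this
    have h2 := v.N.eq_zero.1 (le_antisymm this (v.N.nonneg _))
    simpa [h0'] using h2
  refine ⟨i, hwi, v.N_sum_eq _ (fun j : Fin n => θ ^ (j : ℕ) * w j) (Finset.mem_univ i) ?_ ?_,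
    fun j => hi j (Finset.mem_univ j)⟩
  · exact mul_ne_zero (pow_ne_zero _ h0') hwi
  · intro j _ hji
    refine lt_of_le_of_ne (hi j (Finset.mem_univ j)) ?_
    intro heq
    by_cases hwj : w j = 0
    · rw [hwj, mul_zero, map_zero] at heq
      exact mul_ne_zero (pow_ne_zero _ h0') hwi (v.N.eq_zero.1 heq.symm)
    obtain ⟨m, hm⟩ := hw i hwi
    obtain ⟨m', hm'⟩ := hw j hwj
    rw [N_pow_mul_eq hn hθ hm, N_pow_mul_eq hn hθ hm'] at heq
    have := zpow_right_injective₀ h0 h1.ne heq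
    apply hji
    have hmod : ((j : ℕ) : ℤ) % n = ((i : ℕ) : ℤ) % n := by
      have := congrArg (· % (n : ℤ)) this
      simpa using this
    rw [Int.emod_eq_of_lt (by positivity) (by exact_mod_cast j.2),
      Int.emod_eq_of_lt (by positivity) (by exact_mod_cast i.2)] at hmod
    exact Fin.ext (by exact_mod_cast hmod)

/-- All nonzero elements of `W` have the absolute value of a power of `p`. -/
def Unram (v : LocalAbs p K Ω) (W : IntermediateField K Ω) : Prop :=
  ∀ w ∈ W, w ≠ 0 → ∃ m : ℤ, v.N w = v.N (p : Ω) ^ m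

lemma unram_bot : v.Unram ⊥ := by
  intro w hw hw0
  obtain ⟨x, rfl⟩ := IntermediateField.mem_bot.1 hw
  exact v.discrete x (by rintro rfl; simp at hw0)

/-- The map `(w_i) ↦ ∑ θ ^ i * w_i` from `W ^ n` to `E`. -/
noncomputable def powMap {W E : IntermediateField K Ω} (hWE : W ≤ E) {θ : Ω} (hθ : θ ∈ E) (n : ℕ) :
    (Fin n → W) →ₗ[K] E where
  toFun w := ⟨∑ j : Fin n, θ ^ (j : ℕ) * (w j : Ω),
    sum_mem fun j _ => E.mul_mem (pow_mem hθ _) (hWE (w j).2)⟩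
  map_add' x y := by
    ext; simp [mul_add, Finset.sum_add_distrib]
  map_smul' c x := by
    ext; simp [Algebra.smul_def, Finset.mul_sum]
    exact Finset.sum_congr rfl fun _ _ => by ring

lemma powMap_injective {W E : IntermediateField K Ω} (hWE : W ≤ E) (hW : v.Unram W) {θ : Ω}
    (hθE : θ ∈ E) {n : ℕ} (hn : 0 < n) (hθ : v.N θ ^ n = v.N (p : Ω)) :
    Function.Injective (powMap hWE hθE n) := by
  rw [← LinearMap.ker_eq_bot, LinearMap.ker_eq_bot']
  intro w hw
  by_contra h
  have h2 : (fun i => (w i : Ω)) ≠ 0 := by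
    intro h3
    apply h
    funext i
    exact Subtype.ext (congrFun h3 i)
  obtain ⟨i, hi0, hi, -⟩ := N_sum_pow_mul hn hθ (fun i => (w i : Ω))
    (fun i h => hW _ (w i).2 h) h2
  have h3 : ∑ j : Fin n, θ ^ (j : ℕ) * (w j : Ω) = 0 := congrArg Subtype.val hw
  rw [h3, map_zero] at hi
  have := v.N.eq_zero.1 hi.symm
  have h0 : θ ≠ 0 := v.N.ne_zero_iff.1 (pos_of_pow_eq hn hθ).ne'
  exact mul_ne_zero (pow_ne_zero _ h0) hi0 this

lemma mul_finrank_le {W E : IntermediateField K Ω} [FiniteDimensional K E] [FiniteDimensional K W]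
    (hWE : W ≤ E) (hW : v.Unram W) {θ : Ω}
    (hθE : θ ∈ E) {n : ℕ} (hn : 0 < n) (hθ : v.N θ ^ n = v.N (p : Ω)) :
    n * Module.finrank K W ≤ Module.finrank K E := by
  have := LinearMap.finrank_le_finrank_of_injective (powMap_injective hWE hW hθE hn hθ)
  simpa [Module.finrank_pi_fintype] using this

/-- `E` contains an element `θ` with `N θ ^ n = N p`, and a subfield `W` with the values of `K`
with `[E : K] ≤ n * [W : K]`. -/
structure TR (v : LocalAbs p K Ω) (W E : IntermediateField K Ω) (n : ℕ) (θ : Ω) : Prop where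
  le : W ≤ E
  fd : FiniteDimensional K E
  fdW : FiniteDimensional K W
  unram : v.Unram W
  mem : θ ∈ E
  pos : 0 < n
  val : v.N θ ^ n = v.N (p : Ω)
  finrank_le : Module.finrank K E ≤ n * Module.finrank K W

namespace TR

variable {W E : IntermediateField K Ω} {n : ℕ} {θ : Ω}

lemma finrank_eq (h : v.TR W E n θ) : Module.finrank K E = n * Module.finrank K W := by
  have := h.fd; have := h.fdW
  exact le_antisymm h.finrank_le (mul_finrank_le h.le h.unram h.mem h.pos h.val)

lemma exists_sum (h : v.TR W E n θ) {x : Ω} (hx : x ∈ E) :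
    ∃ w : Fin n → Ω, (∀ i, w i ∈ W) ∧ x = ∑ j : Fin n, θ ^ (j : ℕ) * w j := by
  have := h.fd; have := h.fdW
  have h1 := powMap_injective h.le h.unram h.mem h.pos h.val
  rw [LinearMap.injective_iff_surjective_of_finrank_eq_finrank] at h1
  · obtain ⟨w, hw⟩ := h1 ⟨x, hx⟩
    exact ⟨fun i => w i, fun i => (w i).2, (congrArg Subtype.val hw).symm⟩
  · rw [h.finrank_eq]; simp [Module.finrank_pi_fintype]

lemma value (h : v.TR W E n θ) {x : Ω} (hx : x ∈ E) (hx0 : x ≠ 0) :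
    ∃ m : ℤ, v.N x = v.N θ ^ m := by
  obtain ⟨w, hw, rfl⟩ := h.exists_sum hx
  have hw0 : w ≠ 0 := by rintro rfl; simp at hx0
  obtain ⟨i, hi0, hi, -⟩ := N_sum_pow_mul h.pos h.val w (fun i hi => h.unram _ (hw i) hi) hw0
  obtain ⟨m, hm⟩ := h.unram _ (hw i) hi0
  exact ⟨_, hi.trans (N_pow_mul_eq h.pos h.val hm i)⟩

lemma residue (h : v.TR W E n θ) {x : Ω} (hx : x ∈ E) (hx1 : v.N x ≤ 1) :
    ∃ c ∈ W, v.N (x - c) < 1 := by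
  obtain ⟨w, hw, rfl⟩ := h.exists_sum hx
  by_cases hw0 : w = 0
  · subst hw0; exact ⟨0, zero_mem _, by simp⟩
  have hpos := h.pos
  have h0 := pos_of_pow_eq h.pos h.val
  have h1 := lt_one_of_pow_eq h.val
  obtain ⟨i, hi0, hi, hmax⟩ := N_sum_pow_mul h.pos h.val w (fun i hi => h.unram _ (hw i) hi) hw0
  refine ⟨w ⟨0, h.pos⟩, hw _, ?_⟩
  rw [← Finset.add_sum_erase Finset.univ _ (Finset.mem_univ (⟨0, h.pos⟩ : Fin n))]
  simp only [pow_zero, one_mul, add_sub_cancel_left]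
  refine v.N_sum_lt _ _ one_pos fun j hj => ?_
  have hj0 : (j : ℕ) ≠ 0 := by
    intro hj0
    rw [Finset.mem_erase] at hj
    exact hj.1 (Fin.ext hj0)
  by_cases hwj : w j = 0
  · simp [hwj]
  refine lt_of_le_of_ne ((hmax j).trans (hi ▸ hx1)) ?_
  obtain ⟨m, hm⟩ := h.unram _ (hw j) hwj
  rw [N_pow_mul_eq h.pos h.val hm, ← zpow_zero (v.N θ)]
  intro heq
  have := zpow_right_injective₀ h0 h1.ne heq
  have hmod : ((j : ℕ) : ℤ) % n = 0 := by
    have := congrArg (· % (n : ℤ)) this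
    simpa using this
  rw [Int.emod_eq_of_lt (by positivity) (by exact_mod_cast j.2)] at hmod
  exact hj0 (by exact_mod_cast hmod)

end TR

end LocalAbs

namespace LocalAbs

section
variable {K Ω : Type*} [Field K] [Field Ω] [Algebra K Ω]

lemma finrank_sup_adjoin_le (E : IntermediateField K Ω) [FiniteDimensional K E] {x : Ω}
    (P : Polynomial E) (hP : P.Monic) (hx : aeval x P = 0) :
    FiniteDimensional K (E ⊔ adjoin K {x} : IntermediateField K Ω) ∧
    Module.finrank K (E ⊔ adjoin K {x} : IntermediateField K Ω) ≤
      P.natDegree * Module.finrank K E := by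
  have hi : IsIntegral E x := ⟨P, hP, hx⟩
  have h1 := restrictScalars_adjoin_eq_sup K E ({x} : Set Ω)
  rw [← h1]
  have h2 : FiniteDimensional E (adjoin E ({x} : Set Ω)) := adjoin.finiteDimensional hi
  have h3 : FiniteDimensional K (adjoin E ({x} : Set Ω)) := FiniteDimensional.trans K E _
  refine ⟨h3, ?_⟩
  change Module.finrank K (adjoin E ({x} : Set Ω)) ≤ _
  rw [← Module.finrank_mul_finrank K E (adjoin E ({x} : Set Ω)), mul_comm]
  refine Nat.mul_le_mul_right _ ?_
  rw [adjoin.finrank hi]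
  exact natDegree_le_natDegree (minpoly.min E x hP hx)

lemma finrank_sup_adjoin_wp_le (E : IntermediateField K Ω) [FiniteDimensional K E] {x a : Ω}
    {p : ℕ} (hp : 1 < p) (ha : a ∈ E) (hx : x ^ p - x = a) :
    FiniteDimensional K (E ⊔ adjoin K {x} : IntermediateField K Ω) ∧
    Module.finrank K (E ⊔ adjoin K {x} : IntermediateField K Ω) ≤ p * Module.finrank K E := by
  have hd : (X ^ p - (X + C ⟨a, ha⟩) : Polynomial E).natDegree = p := by
    rw [natDegree_sub_eq_left_of_natDegree_lt] <;> simp [hp]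
  have := finrank_sup_adjoin_le E (x := x) (X ^ p - (X + C ⟨a, ha⟩)) (by
    refine monic_X_pow_sub ?_
    rw [degree_X_add_C]; exact_mod_cast hp) (by
      simp [IntermediateField.algebraMap_apply, ← hx])
  rwa [hd] at this

lemma eq_on_sup_adjoin {E : IntermediateField K Ω} {x : Ω} {g h : Ω ≃ₐ[K] Ω}
    (hE : ∀ y ∈ E, g y = h y) (hx : g x = h x) :
    ∀ y ∈ E ⊔ adjoin K {x}, g y = h y := by
  have : E ⊔ adjoin K {x} ≤ fixedField (Subgroup.zpowers (h⁻¹ * g)) := by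
    have key : ∀ y, g y = h y → y ∈ fixedField (Subgroup.zpowers (h⁻¹ * g)) := by
      intro y hy
      rw [mem_fixedField_iff]
      intro f hf
      have h1 : h⁻¹ * g ∈ MulAction.stabilizer (Ω ≃ₐ[K] Ω) y := by
        rw [MulAction.mem_stabilizer_iff]
        change h⁻¹ (g y) = y
        rw [hy]; exact h.symm_apply_apply y
      exact (Subgroup.zpowers_le.2 h1) hf
    refine sup_le (fun y hy => key y (hE y hy)) ?_
    rw [adjoin_le_iff, Set.singleton_subset_iff]
    exact key x hx
  intro y hy
  have h1 := (mem_fixedField_iff _ _).1 (this hy) _ (Subgroup.mem_zpowers _)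
  have h2 : h ((h⁻¹ * g) y) = g y := h.apply_symm_apply (g y)
  rw [← h2, h1]

end

variable {p : ℕ} [Fact p.Prime] {K Ω : Type*} [Field K] [Field Ω] [Algebra K Ω] {v : LocalAbs p K Ω}

lemma q_pow_map {x : Ω} {j : ℤ} {τ : Ω ≃ₐ[K] Ω} (h : v.q (τ x) = v.q x + j • v.q 1) (m : ℕ) :
    v.q ((τ ^ m) x) = v.q x + (m * j) • v.q 1 := by
  induction m with
  | zero => simp
  | succ m ih =>
    rw [pow_succ']
    change v.q (τ ((τ ^ m) x)) = _
    have h1 : v.q ((τ ^ m) x) = v.q (x + ((m * j : ℤ) : Ω)) := by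
      rw [ih, map_add, q_intCast]
    rw [v.q_map τ h1, map_add, map_intCast, map_add, q_intCast, h]
    push_cast
    rw [add_mul, one_mul, add_zsmul]; abel

lemma exists_mul_dvd_sub {p : ℕ} [Fact p.Prime] {j : ℤ} (hj : ¬ (p : ℤ) ∣ j) (j' : ℤ) :
    ∃ m : ℕ, (p : ℤ) ∣ m * j - j' := by
  have hp : 0 < p := (Fact.out : p.Prime).pos
  obtain ⟨a, b, hab⟩ :=
    ((Nat.prime_iff_prime_int.1 (Fact.out : p.Prime)).coprime_iff_not_dvd.2 hj).symm
  refine ⟨((a * j') % p).toNat, ?_⟩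
  rw [Int.toNat_of_nonneg (Int.emod_nonneg _ (by exact_mod_cast hp.ne'))]
  rw [Int.emod_def]
  exact ⟨-(b * j') - (a * j' / p) * j, by linear_combination j' * hab⟩

lemma zsmul_q_one_eq_iff {i j : ℤ} : i • v.q 1 = j • v.q 1 ↔ (p : ℤ) ∣ i - j := by
  rw [← zsmul_q_one_eq_zero_iff (v := v), sub_zsmul, ← sub_eq_add_neg, sub_eq_zero]

/-- Artin–Schreier extensions are cyclic. -/
lemma exists_pow_eq_on (hodd : Odd p) {E : IntermediateField K Ω} {x a : Ω} (hx : v.Sm x)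
    (hxa : x ^ p - x = a) (ha : a ∈ E) {h₀ : Ω ≃ₐ[K] Ω} (h₀E : ∀ y ∈ E, h₀ y = y)
    (h₀x : h₀ x ≠ x) (h : Ω ≃ₐ[K] Ω) (hE : ∀ y ∈ E, h y = y) :
    ∃ m : ℕ, ∀ y ∈ E ⊔ adjoin K {x}, h y = (h₀ ^ m) y := by
  have key : ∀ g : Ω ≃ₐ[K] Ω, (∀ y ∈ E, g y = y) → (g x) ^ p - g x = a := fun g hg => by
    rw [← map_pow, ← map_sub, hxa, hg a ha]
  have hE₀ : ∀ m : ℕ, ∀ y ∈ E, (h₀ ^ m) y = y := by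
    intro m
    have : h₀ ^ m ∈ fixingSubgroup E := pow_mem ((mem_fixingSubgroup_iff E h₀).2 h₀E) m
    exact (mem_fixingSubgroup_iff E _).1 this
  obtain ⟨j, hj⟩ := exists_q_eq_add_zsmul hodd (hx.map h₀) hx (by rw [key h₀ h₀E, hxa])
  obtain ⟨j', hj'⟩ := exists_q_eq_add_zsmul hodd (hx.map h) hx (by rw [key h hE, hxa])
  have hpj : ¬ (p : ℤ) ∣ j := by
    intro hpj
    rw [← zsmul_q_one_eq_zero_iff (v := v)] at hpj
    rw [hpj, add_zero] at hj
    exact h₀x (wp_inj (hx.map h₀) (by rw [key h₀ h₀E, hxa]) hj)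
  obtain ⟨m, hm⟩ := exists_mul_dvd_sub hpj j'
  refine ⟨m, eq_on_sup_adjoin (fun y hy => ?_) ?_⟩
  · rw [hE y hy, hE₀ m y hy]
  · refine wp_inj (v := v) (hx.map h) (by rw [key h hE, key _ (hE₀ m)]) ?_
    rw [hj', q_pow_map hj, add_right_inj, eq_comm, zsmul_q_one_eq_iff]
    exact hm

end LocalAbs

namespace LocalAbs

section
variable {K Ω : Type*} [Field K] [Field Ω] [Algebra K Ω]

/-- The difference operator `τ - 1`. -/
def D (τ : Ω ≃ₐ[K] Ω) : Module.End K Ω := τ.toLinearMap - 1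

lemma D_apply (τ : Ω ≃ₐ[K] Ω) (x : Ω) : D τ x = τ x - x := rfl

lemma D_pow_succ (τ : Ω ≃ₐ[K] Ω) (i : ℕ) (x : Ω) : (D τ ^ (i + 1)) x = D τ ((D τ ^ i) x) := by
  rw [pow_succ']; rfl

lemma pow_eq_D_add_one (τ : Ω ≃ₐ[K] Ω) (m : ℕ) (x : Ω) : (τ ^ m) x = ((D τ + 1) ^ m) x := by
  have h : D τ + 1 = τ.toLinearMap := by simp [D]
  rw [h]
  induction m with
  | zero => rfl
  | succ m ih => rw [pow_succ', pow_succ']; exact congrArg τ ih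

lemma pow_eq_sum (τ : Ω ≃ₐ[K] Ω) (m : ℕ) (x : Ω) :
    (τ ^ m) x = ∑ k ∈ Finset.range (m + 1), (m.choose k : Ω) * (D τ ^ k) x := by
  rw [pow_eq_D_add_one, (Commute.one_right (D τ)).add_pow, LinearMap.sum_apply]
  refine Finset.sum_congr rfl fun k _ => ?_
  rw [one_pow, mul_one, ← nsmul_eq_mul', LinearMap.smul_apply, nsmul_eq_mul]

lemma D_pow_mem {E : IntermediateField K Ω} {τ : Ω ≃ₐ[K] Ω} (hE : ∀ x ∈ E, τ x ∈ E) {x : Ω}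
    (hx : x ∈ E) (i : ℕ) : (D τ ^ i) x ∈ E := by
  induction i with
  | zero => exact hx
  | succ i ih => rw [D_pow_succ]; exact E.sub_mem (hE _ ih) ih

end

variable {p : ℕ} {K Ω : Type*} [Field K] [Field Ω] [Algebra K Ω] {v : LocalAbs p K Ω}

lemma q_D_congr (τ : Ω ≃ₐ[K] Ω) {x y : Ω} (h : v.q x = v.q y) : v.q (D τ x) = v.q (D τ y) := by
  rw [D_apply, D_apply, map_sub, map_sub, v.q_map τ h, h]

lemma q_D_zero (τ : Ω ≃ₐ[K] Ω) {x : Ω} {j : ℤ} (h : v.q x = j • v.q 1) : v.q (D τ x) = 0 := by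
  rw [← q_intCast] at h
  rw [q_D_congr τ h, D_apply]; simp

lemma Sm.D {x : Ω} (hx : v.Sm x) (τ : Ω ≃ₐ[K] Ω) : v.Sm (D τ x) := (hx.map τ).sub hx

lemma Sm.D_pow {x : Ω} (hx : v.Sm x) (τ : Ω ≃ₐ[K] Ω) (i : ℕ) : v.Sm ((LocalAbs.D τ ^ i) x) := by
  induction i with
  | zero => exact hx
  | succ i ih => rw [D_pow_succ]; exact ih.D τ

lemma q_wp_D [Fact p.Prime] (hodd : Odd p) {x a : Ω} (hx : v.Sm x) (h : v.q (x ^ p - x) = v.q a)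
    (τ : Ω ≃ₐ[K] Ω) : v.q ((D τ x) ^ p - D τ x) = v.q (D τ a) := by
  rw [D_apply, q_wp_sub hodd (hx.map τ) hx, ← map_pow, ← map_sub τ, v.q_map τ h, h,
    D_apply, map_sub]

lemma q_wp_D_pow [Fact p.Prime] (hodd : Odd p) {x a : Ω} (hx : v.Sm x)
    (h : v.q (x ^ p - x) = v.q a) (τ : Ω ≃ₐ[K] Ω) (i : ℕ) :
    v.q (((D τ ^ i) x) ^ p - (D τ ^ i) x) = v.q ((D τ ^ i) a) := by
  induction i with
  | zero => exact h
  | succ i ih => rw [D_pow_succ, D_pow_succ]; exact q_wp_D hodd (hx.D_pow τ i) ih τ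

/-- The field `F` is cyclic of degree `p`, totally ramified, `M` is the normal closure of
`F(lam)`, and `lam` is a root of `X ^ p - X - α` for some `α ∈ F` of valuation `-ℓ`. -/
structure Datum (v : LocalAbs p K Ω) (ℓ : ℕ) (F M : IntermediateField K Ω) (η α lam : Ω)
    (g : Ω ≃ₐ[K] Ω) : Prop where
  odd : Odd p
  one_le : 1 ≤ ℓ
  lt : ℓ < p
  tr : v.TR ⊥ F p η
  normal : ∀ τ : Ω ≃ₐ[K] Ω, ∀ x ∈ F, τ x ∈ F
  normal' : ∀ τ : Ω ≃ₐ[K] Ω, ∀ x ∈ M, τ x ∈ M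
  le : F ≤ M
  fd : FiniteDimensional K M
  lam_mem : lam ∈ M
  minimal : ∀ E : IntermediateField K Ω, F ≤ E → (∀ τ : Ω ≃ₐ[K] Ω, τ lam ∈ E) → M ≤ E
  gen : ∀ τ : Ω ≃ₐ[K] Ω, ∃ m : ℕ, ∀ x ∈ F, τ x = (g ^ m) x
  α_mem : α ∈ F
  wp : lam ^ p - lam = α
  val : ∀ i ≤ ℓ, v.N ((D g ^ i) α) = v.N η ^ (-(ℓ - i : ℤ))
  small : v.N ((D g ^ (ℓ + 1)) α) < 1

namespace Datum

variable [Fact p.Prime] [IsGalois K Ω] [IsAlgClosed Ω]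
variable {ℓ : ℕ} {F M : IntermediateField K Ω} {η α lam : Ω}
  {g : Ω ≃ₐ[K] Ω} (d : Datum v ℓ F M η α lam g)

include d

lemma η_pos : 0 < v.N η := pos_of_pow_eq d.tr.pos d.tr.val

lemma η_lt : v.N η < 1 := lt_one_of_pow_eq d.tr.val

lemma p_mul_val_lt {i : ℕ} (hi : i ≤ ℓ) : v.N (p : Ω) * v.N ((D g ^ i) α) < 1 := by
  rw [d.val i hi, ← d.tr.val, ← zpow_natCast, ← zpow_add₀ d.η_pos.ne']
  have := d.lt
  exact zpow_lt_one₀ d.η_pos d.η_lt (by omega)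

lemma sm_lam : v.Sm lam := Sm.of_wp (d.p_mul_val_lt (i := 0) (by omega)) (by simp [d.wp])

lemma sm (i : ℕ) : v.Sm ((D g ^ i) lam) := d.sm_lam.D_pow g i

lemma q_wp (i : ℕ) : v.q (((D g ^ i) lam) ^ p - (D g ^ i) lam) = v.q ((D g ^ i) α) :=
  q_wp_D_pow d.odd d.sm_lam (by rw [d.wp]) g i

lemma α_mem' (i : ℕ) : (D g ^ i) α ∈ F := D_pow_mem (d.normal g) d.α_mem i

lemma exists_root (i : ℕ) :
    ∃ y ∈ M, y ^ p - y = (D g ^ i) α ∧ v.q y = v.q ((D g ^ i) lam) :=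
  exists_wp_eq M (D_pow_mem (d.normal' g) d.lam_mem i) (d.le (d.α_mem' i)) (d.sm i) (d.q_wp i)

omit d in
lemma Sm.of_root {y a : Ω} (h : y ^ p - y = a) (ha : v.N (p : Ω) * v.N a < 1) : v.Sm y :=
  Sm.of_wp ha (by simp [h])

/-- An element of `F` whose Artin–Schreier image has the wrong valuation does not exist. -/
lemma no_root {k : ℕ} (hk : 0 < k) (hkℓ : k ≤ ℓ) {y b : Ω} (hy : y ∈ F)
    (hb : v.N b = v.N η ^ (-(k : ℤ))) (h : v.q (y ^ p - y) = v.q b) : False := by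
  have h1 : 1 < v.N b := by
    rw [hb]; exact one_lt_zpow_of_neg₀ d.η_pos d.η_lt (by omega)
  have h2 := N_pow_of_wp_sub h1 (by rwa [q_eq_iff] at h)
  have hy0 : y ≠ 0 := by
    rintro rfl
    rw [map_zero, zero_pow (Fact.out : p.Prime).ne_zero] at h2
    linarith
  obtain ⟨m, hm⟩ := d.tr.value hy hy0
  rw [hm, hb, ← zpow_natCast, ← zpow_mul] at h2
  have h3 := zpow_right_injective₀ d.η_pos d.η_lt.ne h2
  have h4 : (p : ℤ) ∣ (k : ℤ) := ⟨-m, by linear_combination h3⟩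
  have h5 := Nat.le_of_dvd hk (by exact_mod_cast h4)
  have := d.lt
  omega

end Datum
end LocalAbs

namespace LocalAbs

variable {p : ℕ} {K Ω : Type*} [Field K] [Field Ω] [Algebra K Ω] {v : LocalAbs p K Ω}

/-- An intermediate stage `F(lam_{ℓ-k}, …, lam_{ℓ-1})` of the tower between `F` and `M`. -/
structure Stage (v : LocalAbs p K Ω) (ℓ : ℕ) (F M : IntermediateField K Ω) (α lam : Ω)
    (g : Ω ≃ₐ[K] Ω) (k : ℕ) (E : IntermediateField K Ω) (θ : Ω) : Prop where
  le : F ≤ E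
  le' : E ≤ M
  tr : v.TR ⊥ E (p ^ (k + 1)) θ
  roots : ∀ i < ℓ, ℓ - k ≤ i → ∃ y ∈ E, y ^ p - y = (D g ^ i) α ∧ v.q y = v.q ((D g ^ i) lam)
  descend : ∀ β ∈ F, v.N (p : Ω) * v.N β < 1 → ∀ x ∈ E, v.q (x ^ p - x) = v.q β →
    ∃ n : ℕ → ℤ, ∃ y ∈ F, v.q (y ^ p - y) =
      v.q (β - ∑ j ∈ Finset.range k, (n j : Ω) * (D g ^ (ℓ - 1 - j)) α)

namespace Datum

variable [Fact p.Prime] [IsGalois K Ω] [IsAlgClosed Ω]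
variable {ℓ : ℕ} {F M : IntermediateField K Ω} {η α lam : Ω}
  {g : Ω ≃ₐ[K] Ω} (d : Datum v ℓ F M η α lam g)

include d

lemma stage_zero : Stage v ℓ F M α lam g 0 F η where
  le := le_rfl
  le' := d.le
  tr := by simpa using d.tr
  roots i hi hi' := by omega
  descend β hβ hβ' x hx h := ⟨0, x, hx, by simpa using h⟩

lemma val_lt {k j : ℕ} (hk : k < ℓ) (hj : j < k) :
    v.N ((D g ^ (ℓ - 1 - j)) α) < v.N ((D g ^ (ℓ - 1 - k)) α) := by
  rw [d.val _ (by omega), d.val _ (by omega)]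
  exact zpow_lt_zpow_right_of_lt_one₀ d.η_pos d.η_lt (by omega)

variable {k : ℕ} {E : IntermediateField K Ω} {θ : Ω}

lemma one_lt_val (hk : k < ℓ) : 1 < v.N ((D g ^ (ℓ - 1 - k)) α) := by
  rw [d.val _ (by omega)]
  exact one_lt_zpow_of_neg₀ d.η_pos d.η_lt (by omega)

lemma not_wp_close (s : Stage v ℓ F M α lam g k E θ) (hk : k < ℓ) {x : Ω} (hx : x ∈ E) :
    1 < v.N ((D g ^ (ℓ - 1 - k)) α - (x ^ p - x)) := by
  by_contra! hle
  set a := (D g ^ (ℓ - 1 - k)) α with ha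
  have haF : a ∈ F := d.α_mem' _
  have h1a := d.one_lt_val hk
  obtain ⟨c, hc, hc'⟩ := s.tr.residue (E.sub_mem (s.le haF) (E.sub_mem (pow_mem hx p) hx)) hle
  obtain ⟨c, rfl⟩ := IntermediateField.mem_bot.1 hc
  have hc1 : v.N (algebraMap K Ω c) ≤ 1 := by
    have := v.N_sub_le' hle hc'.le
    simpa using this
  have hac : v.N (a - algebraMap K Ω c - a) < v.N a := by
    rw [sub_sub_cancel_left, v.N.map_neg]; exact hc1.trans_lt h1a
  have hNac := v.N_eq_of_sub_lt hac
  obtain ⟨n, y, hy, hyq⟩ := s.descend (a - algebraMap K Ω c)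
    (F.sub_mem haF (F.algebraMap_mem c))
    (by rw [hNac]; exact d.p_mul_val_lt (by omega)) x hx (by
      rw [eq_comm, q_eq_iff]; convert hc' using 2; ring)
  refine d.no_root (k := k + 1) (by omega) (by omega) hy ?_ hyq
  have h2 := d.val (ℓ - 1 - k) (by omega)
  rw [show (ℓ - (ℓ - 1 - k : ℕ) : ℤ) = ((k + 1 : ℕ) : ℤ) by omega] at h2
  rw [← h2]
  apply v.N_eq_of_sub_lt
  have : a - algebraMap K Ω c - ∑ j ∈ Finset.range k, (n j : Ω) * (D g ^ (ℓ - 1 - j)) α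
      - (D g ^ (ℓ - 1 - k)) α
      = (a - algebraMap K Ω c - a) - ∑ j ∈ Finset.range k, (n j : Ω) * (D g ^ (ℓ - 1 - j)) α := by
    rw [← ha]; ring
  rw [this]
  refine v.N_sub_lt hac (v.N_sum_lt _ _ (by linarith) fun j hj => ?_)
  rw [map_mul]
  exact lt_of_le_of_lt (mul_le_of_le_one_left (v.N.nonneg _) (v.N_int_le _))
    (d.val_lt hk (Finset.mem_range.1 hj))

lemma exists_ramified (s : Stage v ℓ F M α lam g k E θ) (hk : k < ℓ) :
    ∃ x ∈ E, ∃ m : ℤ, ¬ (p : ℤ) ∣ m ∧ v.N ((D g ^ (ℓ - 1 - k)) α - (x ^ p - x)) = v.N θ ^ m := by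
  have hp := (Fact.out : p.Prime)
  have hθ0 := pos_of_pow_eq s.tr.pos s.tr.val
  have hθ1 := lt_one_of_pow_eq s.tr.val
  set a := (D g ^ (ℓ - 1 - k)) α with ha
  have haE : a ∈ E := s.le (d.α_mem' _)
  have h1a : 1 < v.N a := d.one_lt_val hk
  have main : ∀ n : ℕ, ∀ x ∈ E, v.N (a - (x ^ p - x)) ≤ v.N a →
      v.N (a - (x ^ p - x)) ≤ v.N θ ^ (-(n : ℤ)) →
      ∃ x ∈ E, ∃ m : ℤ, ¬ (p : ℤ) ∣ m ∧ v.N (a - (x ^ p - x)) = v.N θ ^ m := by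
    intro n
    induction n with
    | zero =>
      intro x hx _ h
      have := d.not_wp_close s hk hx
      simp only [Nat.cast_zero, neg_zero, zpow_zero] at h
      rw [← ha] at this
      linarith
    | succ n ih =>
      intro x hx hxa hn
      have h1 := d.not_wp_close s hk hx
      rw [← ha] at h1
      set b := a - (x ^ p - x) with hb
      have hbE : b ∈ E := E.sub_mem haE (E.sub_mem (pow_mem hx p) hx)
      have hb0 : b ≠ 0 := by
        intro h; rw [h, map_zero] at h1; linarith
      obtain ⟨m, hm⟩ := s.tr.value hbE hb0
      by_cases hpm : (p : ℤ) ∣ m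
      swap
      · exact ⟨x, hx, m, hpm, hm⟩
      obtain ⟨m', rfl⟩ := hpm
      have hθne : θ ≠ 0 := v.N.ne_zero_iff.1 hθ0.ne'
      have hu : v.N (b / θ ^ (p * m')) ≤ 1 := by
        rw [map_div₀, map_zpow₀, hm, div_self]
        exact (zpow_pos hθ0 _).ne'
      obtain ⟨c, hc, hc'⟩ := s.tr.residue (E.div_mem hbE (zpow_mem s.tr.mem _)) hu
      obtain ⟨c, rfl⟩ := IntermediateField.mem_bot.1 hc
      have hc1 : v.N (algebraMap K Ω c) ≤ 1 := by
        have := v.N_sub_le' hu hc'.le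
        simpa using this
      obtain ⟨e, he⟩ := v.frob c hc1
      have he1 : v.N (algebraMap K Ω e) ≤ 1 := by
        have h3 := v.N_add_le he.le hc1
        rw [sub_add_cancel, map_pow] at h3
        by_contra! h4
        exact absurd h3 (not_le.2 (one_lt_pow₀ h4 hp.ne_zero))
      set z := algebraMap K Ω e * θ ^ m' with hz
      have hzE : z ∈ E := E.mul_mem (E.algebraMap_mem e) (zpow_mem s.tr.mem _)
      have hzN : v.N z ≤ v.N θ ^ m' := by
        rw [hz, map_mul, map_zpow₀]
        exact mul_le_of_le_one_left (zpow_pos hθ0 _).le he1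
      have hθm' : 1 < v.N θ ^ m' := by
        by_contra! h4
        rw [hm, mul_comm, zpow_mul, zpow_natCast] at h1
        exact absurd (pow_le_one₀ (zpow_pos hθ0 _).le h4) (not_le.2 h1)
      have hbz : v.N (b - z ^ p) < v.N b := by
        have : b - z ^ p = (b / θ ^ (p * m') - algebraMap K Ω c
            - (algebraMap K Ω e ^ p - algebraMap K Ω c)) * θ ^ (p * m') := by
          have h5 : θ ^ (p * m') ≠ 0 := zpow_ne_zero _ hθne
          rw [hz, mul_pow, sub_sub_sub_cancel_right, sub_mul, div_mul_cancel₀ _ h5,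
            mul_comm (p : ℤ),
            zpow_mul, zpow_natCast]
        rw [this, map_mul, map_zpow₀, ← hm]
        exact mul_lt_of_lt_one_left (by linarith) (v.N_sub_lt hc' he)
      have hzb : v.N z < v.N b := by
        refine hzN.trans_lt ?_
        rw [hm, mul_comm, zpow_mul, zpow_natCast]
        exact lt_self_pow₀ hθm' hp.one_lt
      have hNpa : v.N (p : Ω) * v.N a < 1 := d.p_mul_val_lt (by omega)
      have hzsm : v.Sm z := by
        unfold Sm
        refine lt_of_le_of_lt ?_ hNpa
        refine mul_le_mul_of_nonneg_left ?_ v.p_pos.le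
        refine le_trans ?_ hxa
        rw [hm, mul_comm, zpow_mul, zpow_natCast]
        exact pow_le_pow_left₀ (v.N.nonneg z) hzN p
      have hxsm : v.Sm x := by
        refine Sm.of_wp (a := x ^ p - x) ?_ (by simp)
        refine lt_of_le_of_lt (mul_le_mul_of_nonneg_left ?_ v.p_pos.le) hNpa
        have h6 : x ^ p - x = a - b := by rw [hb]; ring
        rw [h6]
        exact v.N_sub_le' le_rfl hxa
      have hadd := q_wp_add hxsm hzsm
      rw [← map_add, q_eq_iff] at hadd
      have hnew : v.N (a - ((x + z) ^ p - (x + z))) < v.N b := by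
        have : a - ((x + z) ^ p - (x + z)) = (b - z ^ p) + z
          - ((x + z) ^ p - (x + z) - (x ^ p - x + (z ^ p - z))) := by rw [hb]; ring
        rw [this]
        exact v.N_sub_lt (v.N_add_lt hbz hzb) (hadd.trans h1)
      have hxzE : x + z ∈ E := E.add_mem hx hzE
      refine ih (x + z) hxzE (hnew.le.trans hxa) ?_
      have h7 := d.not_wp_close s hk hxzE
      rw [← ha] at h7
      have hne : a - ((x + z) ^ p - (x + z)) ≠ 0 := by
        intro h8; rw [h8, map_zero] at h7; linarith
      obtain ⟨m₁, hm₁⟩ := s.tr.value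
        (E.sub_mem haE (E.sub_mem (pow_mem hxzE p) hxzE)) hne
      rw [hm₁]
      have h9 := hnew.trans_le hn
      rw [hm₁, zpow_lt_zpow_iff_right_of_lt_one₀ hθ0 hθ1] at h9
      rw [zpow_le_zpow_iff_right_of_lt_one₀ hθ0 hθ1]
      push_cast at h9
      omega
  have ha0 : a ≠ 0 := by
    intro h; rw [h, map_zero] at h1a; linarith
  obtain ⟨m, hm⟩ := s.tr.value haE ha0
  refine main m.natAbs 0 E.zero_mem ?_ ?_
  · simp [hp.ne_zero]
  · simp only [zero_pow hp.ne_zero, sub_zero]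
    rw [hm, zpow_le_zpow_iff_right_of_lt_one₀ hθ0 hθ1]
    omega

end Datum
end LocalAbs

namespace LocalAbs

variable {p : ℕ} {K Ω : Type*} [Field K] [Field Ω] [Algebra K Ω] {v : LocalAbs p K Ω}

lemma mem_sup_adjoin (E : IntermediateField K Ω) (x : Ω) : x ∈ E ⊔ adjoin K {x} :=
  (le_sup_right : adjoin K {x} ≤ _) (mem_adjoin_simple_self K x)

lemma sup_adjoin_le {E E' : IntermediateField K Ω} {x : Ω} (h : E ≤ E') (hx : x ∈ E') :
    E ⊔ adjoin K {x} ≤ E' :=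
  sup_le h (by rw [adjoin_le_iff, Set.singleton_subset_iff]; exact hx)

lemma fix_pow {E : IntermediateField K Ω} {h₀ : Ω ≃ₐ[K] Ω} (h : ∀ y ∈ E, h₀ y = y) (m : ℕ) :
    ∀ y ∈ E, (h₀ ^ m) y = y := by
  have : h₀ ^ m ∈ fixingSubgroup E := pow_mem ((mem_fixingSubgroup_iff E h₀).2 h) m
  exact (mem_fixingSubgroup_iff E _).1 this

lemma fix_pow_elt {x : Ω} {h₀ : Ω ≃ₐ[K] Ω} (h : h₀ x = x) (m : ℕ) : (h₀ ^ m) x = x := by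
  have : h₀ ^ m ∈ MulAction.stabilizer (Ω ≃ₐ[K] Ω) x := pow_mem (by exact h) m
  exact this

/-- If `l` and `y` are both roots of Artin–Schreier equations over `E`, and `y ∈ E(l)`, then some
`y - n * l` is close to an exact root in `E`. -/
lemma exists_root_sub [Fact p.Prime] [IsGalois K Ω] [IsAlgClosed Ω] (hodd : Odd p)
    {E : IntermediateField K Ω} {l a y b : Ω}
    (hl : v.Sm l) (hla : l ^ p - l = a) (ha : a ∈ E) (hlE : l ∉ E) (hy : v.Sm y)
    (hyE : y ∈ E ⊔ adjoin K {l}) (hyb : v.q (y ^ p - y) = v.q b) (hb : b ∈ E) :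
    ∃ n : ℤ, ∃ z ∈ E, z ^ p - z = b - n * a ∧ v.q z = v.q (y - n * l) := by
  obtain ⟨h₀, h₀E, h₀l⟩ : ∃ h₀ : Ω ≃ₐ[K] Ω, (∀ x ∈ E, h₀ x = x) ∧ h₀ l ≠ l := by
    by_contra! h
    exact hlE (mem_of_fixed E l h)
  have hh₀l : (h₀ l) ^ p - h₀ l = a := by rw [← map_pow, ← map_sub, hla, h₀E a ha]
  obtain ⟨j, hj⟩ := exists_q_eq_add_zsmul hodd (hl.map h₀) hl (by rw [hh₀l, hla])
  have hpj : ¬ (p : ℤ) ∣ j := by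
    intro hpj
    rw [← zsmul_q_one_eq_zero_iff (v := v)] at hpj
    rw [hpj, add_zero] at hj
    exact h₀l (wp_inj (hl.map h₀) (by rw [hh₀l, hla]) hj)
  obtain ⟨j', hj'⟩ := exists_q_eq_add_zsmul hodd (hy.map h₀) hy (by
    rw [← map_pow, ← map_sub, v.q_map h₀ hyb, h₀E b hb, hyb])
  obtain ⟨n, hn⟩ := exists_mul_dvd_sub hpj j'
  have hnl : v.Sm ((n : ℤ) * l) := hl.int_mul n
  have hylE : y - (n : ℤ) * l ∈ E ⊔ adjoin K {l} :=
    sub_mem hyE (mul_mem (intCast_mem _ _) (mem_sup_adjoin E l))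
  have hE' : E ≤ E ⊔ adjoin K {l} := le_sup_left
  have hbE : b - (n : ℤ) * a ∈ E := E.sub_mem hb (E.mul_mem (intCast_mem E _) ha)
  obtain ⟨z, hz, hzb, hzq⟩ := exists_wp_eq (v := v) (E ⊔ adjoin K {l}) hylE
    (hE' hbE) (hy.sub hnl) (by
      rw [q_wp_sub hodd hy hnl, q_wp_int_mul hodd hl, hyb, hla, map_sub, ← map_zsmul, zsmul_eq_mul])
  have hzs : v.Sm z := (hy.sub hnl).of_q_eq hzq.symm
  refine ⟨n, z, ?_, hzb, hzq⟩
  have h₀z : h₀ z = z := by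
    refine wp_inj (v := v) (hzs.map h₀) ?_ ?_
    · rw [← map_pow, ← map_sub, hzb, h₀E _ hbE]
    · have h9 : (n : ℤ) • (v.q l + j • v.q 1) = (n : ℤ) • v.q l + j' • v.q 1 := by
        rw [zsmul_add, ← mul_zsmul, (zsmul_q_one_eq_iff (v := v)).2 hn]
      rw [v.q_map h₀ hzq, hzq, map_sub, map_mul, map_intCast, map_sub, map_sub, hj',
        ← zsmul_eq_mul, ← zsmul_eq_mul, map_zsmul, map_zsmul, hj, h9]
      abel
  refine mem_of_fixed E z fun h hE => ?_
  obtain ⟨m, hm⟩ := exists_pow_eq_on hodd hl hla ha h₀E h₀l h hE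
  rw [hm z hz, fix_pow_elt h₀z]

namespace Datum

variable [Fact p.Prime] [IsGalois K Ω] [IsAlgClosed Ω]
variable {ℓ : ℕ} {F M : IntermediateField K Ω} {η α lam : Ω}
  {g : Ω ≃ₐ[K] Ω} (d : Datum v ℓ F M η α lam g)

include d

variable {k : ℕ} {E : IntermediateField K Ω} {θ : Ω}

lemma stage_succ (s : Stage v ℓ F M α lam g k E θ) (hk : k < ℓ) :
    ∃ E' θ', Stage v ℓ F M α lam g (k + 1) E' θ' := by
  have hp := (Fact.out : p.Prime)
  obtain ⟨l, hlM, hla, hlq⟩ := d.exists_root (ℓ - 1 - k)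
  obtain ⟨x, hx, m, hm, hxm⟩ := d.exists_ramified s hk
  have h1b := d.not_wp_close s hk hx
  have hNpa : v.N (p : Ω) * v.N ((D g ^ (ℓ - 1 - k)) α) < 1 := d.p_mul_val_lt (by omega)
  have h1a := d.one_lt_val hk
  have haF := d.α_mem' (ℓ - 1 - k)
  set a := (D g ^ (ℓ - 1 - k)) α with ha
  have haE := s.le haF
  have hl : v.Sm l := Sm.of_root hla hNpa
  have hθ0 := pos_of_pow_eq s.tr.pos s.tr.val
  have hE' : E ≤ E ⊔ adjoin K {l} := le_sup_left
  have := s.tr.fd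
  obtain ⟨hfd, hrank⟩ := finrank_sup_adjoin_wp_le E hp.one_lt haE hla
  -- the uniformizer
  obtain ⟨θ', hθ'E, hθ'⟩ : ∃ θ' ∈ E ⊔ adjoin K {l}, v.N θ' ^ p = v.N θ := by
    have hyN : v.N (l - x) ^ p = v.N θ ^ m := by
      rw [← hxm]
      by_cases hxs : v.Sm x
      · refine N_pow_of_wp_sub h1b ?_
        have := q_wp_sub d.odd hl hxs
        rw [← map_sub, q_eq_iff, hla] at this
        exact this
      · have hlx : v.N l < v.N x := by
          by_contra! h
          exact hxs (hl.of_le h)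
        have h1x : 1 < v.N x := by
          by_contra! h
          exact hxs (Sm.of_le_one h)
        have h2 : v.N (x ^ p - x) = v.N x ^ p := N_wp_of_one_lt h1x
        have h3 : v.N a < v.N (x ^ p - x) := by
          rw [h2]
          by_contra! h
          exact hxs (lt_of_le_of_lt (mul_le_mul_of_nonneg_left h v.p_pos.le) hNpa)
        rw [v.N.map_sub l x, v.N_eq_of_sub_lt (x := x - l) (y := x)
          (by rw [sub_sub_cancel_left, v.N.map_neg]; exact hlx),
          v.N.map_sub a, v.N_eq_of_sub_lt (x := x ^ p - x - a) (y := x ^ p - x)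
          (by rw [sub_sub_cancel_left, v.N.map_neg]; exact h3), h2]
    obtain ⟨u, w, huw⟩ := ((Nat.prime_iff_prime_int.1 hp).coprime_iff_not_dvd.2 hm).symm
    refine ⟨(l - x) ^ u * θ ^ w, mul_mem (zpow_mem (sub_mem (mem_sup_adjoin E l) (hE' hx)) u)
      (zpow_mem (hE' s.tr.mem) w), ?_⟩
    have h4 : (v.N (l - x) ^ u) ^ p = v.N θ ^ (m * u) := by
      rw [zpow_mul, ← hyN, ← zpow_natCast, ← zpow_natCast, ← zpow_mul, ← zpow_mul, mul_comm]
    rw [map_mul, map_zpow₀, map_zpow₀, mul_pow, h4, ← zpow_natCast, ← zpow_mul,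
      ← zpow_add₀ hθ0.ne', mul_comm m, huw, zpow_one]
  have htr : v.TR ⊥ (E ⊔ adjoin K {l}) (p ^ (k + 1 + 1)) θ' :=
    { le := bot_le
      fd := hfd
      fdW := inferInstance
      unram := unram_bot
      mem := hθ'E
      pos := pow_pos hp.pos _
      val := by rw [pow_succ', pow_mul, hθ', s.tr.val]
      finrank_le := by
        refine hrank.trans ?_
        rw [s.tr.finrank_eq]; simp [pow_succ']  }
  have hlE : l ∉ E := by
    intro h
    have h5 : E ⊔ adjoin K {l} = E := le_antisymm (sup_adjoin_le le_rfl h) le_sup_left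
    have h6 := htr.finrank_eq
    rw [h5, s.tr.finrank_eq] at h6
    simp only [IntermediateField.finrank_bot, mul_one] at h6
    have := Nat.pow_lt_pow_right hp.one_lt (Nat.lt_succ_self (k + 1))
    rw [Nat.succ_eq_add_one] at this
    omega
  refine ⟨E ⊔ adjoin K {l}, θ', s.le.trans hE', sup_adjoin_le s.le' hlM, htr, ?_, ?_⟩
  · intro i hi hi'
    by_cases h : ℓ - k ≤ i
    · obtain ⟨y, hy, h⟩ := s.roots i hi h
      exact ⟨y, hE' hy, h⟩
    · obtain rfl : i = ℓ - 1 - k := by omega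
      exact ⟨l, mem_sup_adjoin E l, hla, hlq⟩
  · intro β hβ hβ' x hx hxβ
    have hxs : v.Sm x := Sm.of_wp hβ' (by rw [← q_eq_iff]; exact hxβ)
    obtain ⟨n, z, hz, hzb, -⟩ := exists_root_sub d.odd hl hla haE hlE hxs hx hxβ (s.le hβ)
    obtain ⟨n', y, hy, hyq⟩ := s.descend (β - n * a)
      (F.sub_mem hβ (F.mul_mem (intCast_mem F n) haF)) (by
        have h7 : v.N (β - n * a) ≤ max (v.N β) (v.N a) := by
          refine (v.N_sub_le _ _).trans (max_le_max le_rfl ?_)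
          rw [map_mul]
          exact mul_le_of_le_one_left (v.N.nonneg _) (v.N_int_le _)
        refine lt_of_le_of_lt (mul_le_mul_of_nonneg_left h7 v.p_pos.le) ?_
        rcases max_choice (v.N β) (v.N a) with h | h <;> rw [h] <;> assumption) z hz (by rw [hzb])
    refine ⟨Function.update n' k n, y, hy, ?_⟩
    rw [hyq, Finset.sum_range_succ, Function.update_self]
    congr 1
    have h8 : ∑ j ∈ Finset.range k, (Function.update n' k n j : Ω) * (D g ^ (ℓ - 1 - j)) α =
        ∑ j ∈ Finset.range k, (n' j : Ω) * (D g ^ (ℓ - 1 - j)) α :=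
      Finset.sum_congr rfl fun j hj => by rw [Function.update_of_ne (Finset.mem_range.1 hj).ne]
    rw [h8, ← ha]
    ring

lemma exists_stage (hk : k ≤ ℓ) : ∃ E θ, Stage v ℓ F M α lam g k E θ := by
  induction k with
  | zero => exact ⟨F, η, d.stage_zero⟩
  | succ k ih =>
    obtain ⟨E, θ, s⟩ := ih (by omega)
    exact d.stage_succ s (by omega)

end Datum
end LocalAbs

namespace LocalAbs

variable {p : ℕ} {K Ω : Type*} [Field K] [Field Ω] [Algebra K Ω] {v : LocalAbs p K Ω}

lemma sup_adjoin_stable {E : IntermediateField K Ω} {x : Ω} {τ : Ω ≃ₐ[K] Ω}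
    (hE : ∀ y ∈ E, τ y ∈ E) (hx : τ x ∈ E ⊔ adjoin K {x}) :
    ∀ y ∈ E ⊔ adjoin K {x}, τ y ∈ E ⊔ adjoin K {x} := by
  have : E ⊔ adjoin K {x} ≤ (E ⊔ adjoin K {x}).comap (τ : Ω →ₐ[K] Ω) :=
    sup_adjoin_le (fun y hy => (le_sup_left : E ≤ _) (hE y hy)) hx
  exact fun y hy => this hy

lemma pow_stable {E : IntermediateField K Ω} {τ : Ω ≃ₐ[K] Ω}
    (hE : ∀ y ∈ E, τ y ∈ E) (m : ℕ) : ∀ y ∈ E, (τ ^ m) y ∈ E := by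
  induction m with
  | zero => exact fun y hy => hy
  | succ m ih =>
    intro y hy
    rw [pow_succ']
    exact hE _ (ih y hy)

lemma q_natCast_mul (n : ℕ) (x : Ω) : v.q ((n : Ω) * x) = n • v.q x := by
  rw [← nsmul_eq_mul, map_nsmul]

/-- The unramified extension of degree `p` generated by a root of `X ^ p - X - s`. -/
lemma unram_sup_adjoin [Fact p.Prime] [IsGalois K Ω] [IsAlgClosed Ω] (hodd : Odd p) {s : K} {μ : Ω}
    (hs : v.N (algebraMap K Ω s) ≤ 1)
    (hμ : μ ^ p - μ = algebraMap K Ω s)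
    (hno : ¬ ∃ u : K, v.q (algebraMap K Ω u ^ p - algebraMap K Ω u) = v.q (algebraMap K Ω s)) :
    FiniteDimensional K (⊥ ⊔ adjoin K {μ} : IntermediateField K Ω) ∧
    Module.finrank K (⊥ ⊔ adjoin K {μ} : IntermediateField K Ω) = p ∧
      v.Unram (⊥ ⊔ adjoin K {μ}) := by
  have hp := (Fact.out : p.Prime)
  have hsbot : algebraMap K Ω s ∈ (⊥ : IntermediateField K Ω) :=
    IntermediateField.algebraMap_mem _ s
  have hμ1 : v.N μ ≤ 1 := N_le_one_of_wp (by rw [hμ]; exact hs)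
  have hμs : v.Sm μ := Sm.of_le_one hμ1
  obtain ⟨hfd, hrank⟩ := finrank_sup_adjoin_wp_le (⊥ : IntermediateField K Ω) hp.one_lt hsbot hμ
  rw [IntermediateField.finrank_bot, mul_one] at hrank
  obtain ⟨h₀, h₀μ⟩ : ∃ h₀ : Ω ≃ₐ[K] Ω, h₀ μ ≠ μ := by
    by_contra! h
    obtain ⟨u, hu⟩ := IntermediateField.mem_bot.1 (mem_of_fixed ⊥ μ fun τ _ => h τ)
    exact hno ⟨u, by rw [hu, hμ]⟩
  have hh₀ : (h₀ μ) ^ p - h₀ μ = algebraMap K Ω s := by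
    rw [← map_pow, ← map_sub, hμ, h₀.commutes]
  obtain ⟨j, hj⟩ := exists_q_eq_add_zsmul hodd (hμs.map h₀) hμs (by rw [hh₀, hμ])
  have hpj : ¬ (p : ℤ) ∣ j := by
    intro hpj
    rw [← zsmul_q_one_eq_zero_iff (v := v)] at hpj
    rw [hpj, add_zero] at hj
    exact h₀μ (wp_inj (hμs.map h₀) (by rw [hh₀, hμ]) hj)
  have hpow : ∀ m : ℕ, ((h₀ ^ m) μ) ^ p - (h₀ ^ m) μ = algebraMap K Ω s := fun m => by
    rw [← map_pow, ← map_sub, hμ, (h₀ ^ m).commutes]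
  have h₀p : (h₀ ^ p) μ = μ := by
    refine wp_inj (hμs.map _) (by rw [hpow, hμ]) ?_
    rw [q_pow_map hj, (zsmul_q_one_eq_zero_iff (v := v)).2 (Dvd.intro _ rfl), add_zero]
  set W : IntermediateField K Ω := ⊥ ⊔ adjoin K {μ} with hW
  have hμW : μ ∈ W := mem_sup_adjoin ⊥ μ
  have hbW : ⊥ ≤ W := le_sup_left
  have hstab : ∀ y ∈ W, h₀ y ∈ W := by
    refine sup_adjoin_stable (fun y hy => ?_) ?_
    · obtain ⟨u, rfl⟩ := IntermediateField.mem_bot.1 hy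
      rw [h₀.commutes]; exact IntermediateField.algebraMap_mem _ u
    · exact mem_of_wp_eq hodd W hμW hμs (hbW hsbot) (by rw [hμ]) (hμs.map h₀) hh₀
  have hfin : Module.finrank K W = p := by
    refine le_antisymm hrank ?_
    have hiff : IsIntegral K μ := Algebra.IsIntegral.isIntegral μ
    rw [hW, bot_sup_eq, adjoin.finrank hiff]
    have hinj : Set.InjOn (fun m : ℕ => (h₀ ^ m) μ) (Finset.range p) := by
      intro a ha b hb hab
      have hab' := congrArg v.q hab
      simp only at hab'
      rw [q_pow_map hj, q_pow_map hj, add_right_inj, zsmul_q_one_eq_iff, ← sub_mul] at hab'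
      have h1 := (Nat.prime_iff_prime_int.1 hp).dvd_or_dvd hab'
      have h2 := h1.resolve_right hpj
      simp only [Finset.coe_range, Set.mem_Iio] at ha hb
      have h3 := Int.eq_zero_of_abs_lt_dvd h2 (by rw [abs_lt]; omega)
      omega
    have hne : minpoly K μ ≠ 0 := minpoly.ne_zero hiff
    classical
    have hcard := Finset.card_image_of_injOn hinj
    rw [Finset.card_range] at hcard
    have hsub : (Finset.range p).image (fun m : ℕ => (h₀ ^ m) μ) ⊆
        ((minpoly K μ).aroots Ω).toFinset := by
      intro x hx
      obtain ⟨m, -, rfl⟩ := Finset.mem_image.1 hx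
      rw [Multiset.mem_toFinset, mem_aroots]
      refine ⟨hne, ?_⟩
      change aeval ((h₀ ^ m : Ω ≃ₐ[K] Ω) μ) _ = 0
      rw [aeval_algHom_apply (h₀ ^ m : Ω ≃ₐ[K] Ω), minpoly.aeval, map_zero]
    have h4 := Finset.card_le_card hsub
    have h5 := (Multiset.toFinset_card_le ((minpoly K μ).aroots Ω)).trans
      ((card_roots' _).trans (natDegree_map_le))
    omega
  refine ⟨hfd, hfin, fun w hw hw0 => ?_⟩
  have hy0 : ∏ i ∈ Finset.range p, (h₀ ^ i) w ≠ 0 :=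
    Finset.prod_ne_zero_iff.2 fun i _ => (_root_.map_ne_zero _).2 hw0
  have hyW : ∏ i ∈ Finset.range p, (h₀ ^ i) w ∈ W := prod_mem fun i _ => pow_stable hstab i w hw
  have hyN : v.N (∏ i ∈ Finset.range p, (h₀ ^ i) w) = v.N w ^ p := by
    rw [map_prod, Finset.prod_congr rfl fun i _ => v.inv (h₀ ^ i) w]
    simp
  set y := ∏ i ∈ Finset.range p, (h₀ ^ i) w with hy
  have hh₀y : h₀ y = y := by
    rw [hy, map_prod]
    have h1 : ∀ i, h₀ ((h₀ ^ i) w) = (h₀ ^ (i + 1)) w := fun i => by rw [pow_succ']; rfl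
    simp only [h1]
    have h2 := Finset.prod_range_succ (fun i => (h₀ ^ i) w) p
    rw [Finset.prod_range_succ', eq_on_sup_adjoin (E := ⊥) (g := h₀ ^ p) (h := 1) (x := μ) _ h₀p w hw]
      at h2
    · exact mul_right_cancel₀ hw0 h2
    · intro y hy
      obtain ⟨u, rfl⟩ := IntermediateField.mem_bot.1 hy
      rw [(h₀ ^ p).commutes]; rfl
  obtain ⟨c, hc⟩ := IntermediateField.mem_bot.1 (mem_of_fixed ⊥ y fun τ hτ => by
    obtain ⟨m, hm⟩ := exists_pow_eq_on hodd hμs hμ hsbot (h₀ := h₀) (fun y hy => by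
      obtain ⟨u, rfl⟩ := IntermediateField.mem_bot.1 hy
      rw [h₀.commutes]) h₀μ τ hτ
    rw [hm y hyW, fix_pow_elt hh₀y])
  have hc0 : c ≠ 0 := by rintro rfl; rw [map_zero] at hc; exact hy0 hc.symm
  obtain ⟨m, hm⟩ := v.discrete c hc0
  rw [hc, hyN] at hm
  by_cases hpm : (p : ℤ) ∣ m
  · obtain ⟨m', rfl⟩ := hpm
    refine ⟨m', ?_⟩
    rw [mul_comm, zpow_mul, zpow_natCast] at hm
    exact (pow_left_inj₀ (v.N.nonneg _) (zpow_pos v.p_pos _).le hp.ne_zero).1 hm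
  exfalso
  obtain ⟨a, b, hab⟩ := ((Nat.prime_iff_prime_int.1 hp).coprime_iff_not_dvd.2 hpm).symm
  have htr : v.TR ⊥ W p (w ^ a * (p : Ω) ^ b) :=
    { le := bot_le
      fd := hfd
      fdW := inferInstance
      unram := unram_bot
      mem := W.mul_mem (zpow_mem hw a) (zpow_mem (_root_.natCast_mem W p) b)
      pos := hp.pos
      val := by
        have h4 : (v.N w ^ a) ^ p = v.N (p : Ω) ^ (m * a) := by
          rw [zpow_mul, ← hm, ← zpow_natCast, ← zpow_natCast, ← zpow_mul, ← zpow_mul, mul_comm]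
        rw [map_mul, map_zpow₀, map_zpow₀, mul_pow, h4, ← zpow_natCast, ← zpow_mul,
          ← zpow_add₀ v.p_pos.ne', mul_comm m, hab, zpow_one]
      finrank_le := by rw [hfin]; simp }
  obtain ⟨e, he, he'⟩ := htr.residue hμW hμ1
  obtain ⟨u, rfl⟩ := IntermediateField.mem_bot.1 he
  refine hno ⟨u, ?_⟩
  rw [← q_wp_congr hμs (by rwa [q_eq_iff]), hμ]

namespace Datum

variable [Fact p.Prime] [IsGalois K Ω] [IsAlgClosed Ω]
variable {ℓ : ℕ} {F M : IntermediateField K Ω} {η α lam : Ω}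
  {g : Ω ≃ₐ[K] Ω} (d : Datum v ℓ F M η α lam g)

include d

lemma exists_q_D_succ : ∃ j : ℤ, v.q ((D g ^ (ℓ + 1)) lam) = j • v.q 1 :=
  exists_q_eq_zsmul (by rw [d.q_wp, q_eq_zero_iff]; exact d.small)

lemma q_D_high {k : ℕ} (hk : ℓ + 2 ≤ k) : v.q ((D g ^ k) lam) = 0 := by
  induction k, hk using Nat.le_induction with
  | base =>
    obtain ⟨j, hj⟩ := d.exists_q_D_succ
    rw [D_pow_succ, q_D_zero g hj]
  | succ k _ ih => rw [D_pow_succ, q_D_zero (j := 0) g (by rw [ih, zero_zsmul])]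

lemma le_of_exists {E : IntermediateField K Ω} (hF : F ≤ E)
    (hE : ∀ i ≤ ℓ, ∃ y ∈ E, v.q y = v.q ((D g ^ i) lam)) : M ≤ E := by
  have hall : ∀ i, ∃ y ∈ E, v.q y = v.q ((D g ^ i) lam) := by
    intro i
    rcases le_or_gt i ℓ with h | h
    · exact hE i h
    rcases eq_or_lt_of_le (Nat.succ_le_of_lt h) with rfl | h
    · obtain ⟨j, hj⟩ := d.exists_q_D_succ
      exact ⟨j, intCast_mem E j, by rw [q_intCast]; exact hj.symm⟩
    · exact ⟨0, zero_mem E, by rw [map_zero, d.q_D_high h]⟩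
  choose e he heq using hall
  refine d.minimal E hF fun τ => ?_
  obtain ⟨m, hm⟩ := d.gen τ
  have hq : v.q ((g ^ m) lam) = v.q (∑ k ∈ Finset.range (m + 1), (m.choose k : Ω) * e k) := by
    rw [pow_eq_sum, map_sum, map_sum]
    exact Finset.sum_congr rfl fun k _ => by rw [q_natCast_mul, q_natCast_mul, heq]
  have hs := d.sm_lam.map (g ^ m)
  have hwp : ∀ τ : Ω ≃ₐ[K] Ω, (τ lam) ^ p - τ lam = τ α := fun τ => by
    rw [← map_pow, ← map_sub, d.wp]
  refine mem_of_wp_eq d.odd E (sum_mem fun k _ => E.mul_mem (_root_.natCast_mem E _) (he k))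
    (hs.of_q_eq hq) (hF (d.normal τ _ d.α_mem)) ?_ (d.sm_lam.map τ) (hwp τ)
  rw [← q_wp_congr hs hq, hwp, hm α d.α_mem]

lemma N_top : v.N ((D g ^ ℓ) α) = 1 := by simp [d.val ℓ le_rfl]

/-- If the residue equation has a solution, `M` is totally ramified. -/
lemma exists_tr_bot (h : ∃ u : K, v.q (algebraMap K Ω u ^ p - algebraMap K Ω u) =
    v.q ((D g ^ ℓ) α)) : ∃ θ, v.TR ⊥ M (p ^ (ℓ + 1)) θ := by
  obtain ⟨u, hu⟩ := h
  obtain ⟨E, θ, s⟩ := d.exists_stage le_rfl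
  obtain ⟨l, -, hl, hlq⟩ := d.exists_root ℓ
  have hu1 : v.N (algebraMap K Ω u) ≤ 1 := by
    refine N_le_one_of_wp ?_
    have h1 := (q_eq_iff v).1 hu
    have h2 := v.N_add_le h1.le d.N_top.le
    simpa using h2
  have hlF : l ∈ F := mem_of_wp_eq d.odd F (F.algebraMap_mem u) (Sm.of_le_one hu1) (d.α_mem' ℓ) hu
    (Sm.of_root hl (d.p_mul_val_lt le_rfl)) hl
  have hM : M = E := by
    refine le_antisymm (d.le_of_exists s.le fun i hi => ?_) s.le'
    rcases hi.eq_or_lt with rfl | hi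
    · exact ⟨l, s.le hlF, hlq⟩
    · obtain ⟨y, hy, -, hq⟩ := s.roots i hi (by omega)
      exact ⟨y, hy, hq⟩
  exact ⟨θ, hM ▸ s.tr⟩

/-- If the residue equation has no solution, `M` has an unramified part of degree `p`. -/
lemma exists_tr_unram (h : ¬ ∃ u : K, v.q (algebraMap K Ω u ^ p - algebraMap K Ω u) =
    v.q ((D g ^ ℓ) α)) : ∃ W θ, v.TR W M (p ^ (ℓ + 1)) θ ∧ Module.finrank K W = p := by
  have hp := (Fact.out : p.Prime)
  obtain ⟨E, θ, s⟩ := d.exists_stage le_rfl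
  obtain ⟨l, hlM, hl, hlq⟩ := d.exists_root ℓ
  obtain ⟨c, hc, hcN⟩ := d.tr.residue (d.α_mem' ℓ) d.N_top.le
  obtain ⟨c, rfl⟩ := IntermediateField.mem_bot.1 hc
  rw [← q_eq_iff] at hcN
  have hls : v.Sm l := Sm.of_root hl (d.p_mul_val_lt le_rfl)
  obtain ⟨μ, hμM, hμ, hμq⟩ := exists_wp_eq M hlM (M.algebraMap_mem c) hls (by rw [hl, hcN])
  have hc1 : v.N (algebraMap K Ω c) ≤ 1 := by
    have := v.N_sub_le' d.N_top.le ((q_eq_iff v).1 hcN).le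
    simpa using this
  obtain ⟨hWfd, hWrank, hW⟩ := unram_sup_adjoin d.odd hc1 hμ (by rwa [← hcN])
  have := s.tr.fd
  obtain ⟨hfd, hrank⟩ := finrank_sup_adjoin_wp_le E hp.one_lt (E.algebraMap_mem c) hμ
  have hM : M = E ⊔ adjoin K {μ} := by
    refine le_antisymm (d.le_of_exists (s.le.trans le_sup_left) fun i hi => ?_)
      (sup_adjoin_le s.le' hμM)
    rcases hi.eq_or_lt with rfl | hi
    · exact ⟨μ, mem_sup_adjoin E μ, hμq.trans hlq⟩
    · obtain ⟨y, hy, -, hq⟩ := s.roots i hi (by omega)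
      exact ⟨y, (le_sup_left : E ≤ _) hy, hq⟩
  refine ⟨⊥ ⊔ adjoin K {μ}, θ, ?_, hWrank⟩
  exact
    { le := sup_adjoin_le bot_le hμM
      fd := d.fd
      fdW := hWfd
      unram := hW
      mem := s.le' s.tr.mem
      pos := pow_pos hp.pos _
      val := s.tr.val
      finrank_le := by
        rw [hWrank, hM]
        refine hrank.trans (le_of_eq ?_)
        rw [s.tr.finrank_eq, IntermediateField.finrank_bot, mul_one, mul_comm] }

end Datum
end LocalAbs

namespace LocalAbs

variable {p : ℕ} {K Ω : Type*} [Field K] [Field Ω] [Algebra K Ω] {v : LocalAbs p K Ω}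

/-- `y` is, up to elements of absolute value less than one, a root of an Artin–Schreier equation
over `F`. -/
structure AS (v : LocalAbs p K Ω) (F : IntermediateField K Ω) (y : Ω) : Prop where
  sm : v.Sm y
  wp : ∃ b ∈ F, v.q (y ^ p - y) = v.q b

/-- The cocycle `q (h y) - q y`. -/
def chi (v : LocalAbs p K Ω) (h : Ω ≃ₐ[K] Ω) (y : Ω) : Ω ⧸ v.m := v.q (h y) - v.q y

lemma chi_congr {h : Ω ≃ₐ[K] Ω} {x y : Ω} (hxy : v.q x = v.q y) : v.chi h x = v.chi h y := by
  rw [chi, chi, v.q_map h hxy, hxy]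

lemma chi_eq_zero_of_q {h : Ω ≃ₐ[K] Ω} {y : Ω} {j : ℤ} (hy : v.q y = j • v.q 1) :
    v.chi h y = 0 := by
  rw [chi, v.q_map_zsmul_one h hy, hy, sub_self]

section
variable [Fact p.Prime] {F : IntermediateField K Ω}

lemma AS.map {y : Ω} (hy : v.AS F y) {τ : Ω ≃ₐ[K] Ω} (hτ : ∀ x ∈ F, τ x ∈ F) :
    v.AS F (τ y) := by
  obtain ⟨b, hb, h⟩ := hy.wp
  exact ⟨hy.sm.map τ, τ b, hτ b hb, by rw [← map_pow, ← map_sub, v.q_map τ h]⟩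

lemma AS.chi (hodd : Odd p) {y : Ω} (hy : v.AS F y) {h : Ω ≃ₐ[K] Ω} (hF : ∀ x ∈ F, h x = x) :
    ∃ j : ℤ, v.chi h y = j • v.q 1 := by
  obtain ⟨b, hb, hyb⟩ := hy.wp
  obtain ⟨j, hj⟩ := exists_q_eq_add_zsmul hodd (hy.sm.map h) hy.sm (by
    rw [← map_pow, ← map_sub, v.q_map h hyb, hF b hb, hyb])
  exact ⟨j, by rw [LocalAbs.chi, hj, add_sub_cancel_left]⟩

lemma q_apply_eq {y z : Ω} {j : ℤ} (τ : Ω ≃ₐ[K] Ω) (h : v.q y = v.q z + j • v.q 1) :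
    v.q (τ y) = v.q (τ z) + j • v.q 1 := by
  rw [← q_intCast, ← map_add] at h ⊢
  rw [v.q_map τ h, map_add, map_intCast]

lemma AS.chi_mul (hodd : Odd p) {y : Ω} (hy : v.AS F y) {h₁ h₂ : Ω ≃ₐ[K] Ω}
    (h₂F : ∀ x ∈ F, h₂ x = x) : v.chi (h₁ * h₂) y = v.chi h₁ y + v.chi h₂ y := by
  obtain ⟨j, hj⟩ := hy.chi hodd h₂F
  have h1 : v.q (h₂ y) = v.q y + j • v.q 1 := by rw [← hj, LocalAbs.chi]; abel
  rw [hj, LocalAbs.chi, LocalAbs.chi]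
  change v.q (h₁ (h₂ y)) - _ = _
  rw [q_apply_eq h₁ h1]
  abel

lemma mul_fix {h₁ h₂ : Ω ≃ₐ[K] Ω} (h₁F : ∀ x ∈ F, h₁ x = x) (h₂F : ∀ x ∈ F, h₂ x = x) :
    ∀ x ∈ F, (h₁ * h₂) x = x := fun x hx => by
  change h₁ (h₂ x) = x
  rw [h₂F x hx, h₁F x hx]

lemma inv_fix {h : Ω ≃ₐ[K] Ω} (hF : ∀ x ∈ F, h x = x) : ∀ x ∈ F, h⁻¹ x = x := fun x hx => by
  conv_lhs => rw [← hF x hx]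
  exact h.symm_apply_apply x

lemma AS.chi_inv (hodd : Odd p) {y : Ω} (hy : v.AS F y) {h : Ω ≃ₐ[K] Ω}
    (hF : ∀ x ∈ F, h x = x) : v.chi h⁻¹ y = - v.chi h y := by
  have h1 := hy.chi_mul hodd (h₁ := h⁻¹) hF
  rw [inv_mul_cancel] at h1
  have h2 : v.chi (1 : Ω ≃ₐ[K] Ω) y = 0 := by simp [LocalAbs.chi]
  rw [h2] at h1
  exact (neg_eq_of_add_eq_zero_left h1.symm).symm

lemma AS.chi_pow (hodd : Odd p) {y : Ω} (hy : v.AS F y) {h : Ω ≃ₐ[K] Ω}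
    (hF : ∀ x ∈ F, h x = x) (n : ℕ) : v.chi (h ^ n) y = n • v.chi h y := by
  induction n with
  | zero => simp [LocalAbs.chi]
  | succ n ih => rw [pow_succ, hy.chi_mul hodd hF, ih, succ_nsmul]

lemma AS.chi_comm (hodd : Odd p) {y : Ω} (hy : v.AS F y) {h g : Ω ≃ₐ[K] Ω}
    (hF : ∀ x ∈ F, h x = x) (hg : ∀ x ∈ F, g x ∈ F) :
    v.chi (g⁻¹ * h * g * h⁻¹) y = v.chi h (D g y) := by
  rw [hy.chi_mul hodd (inv_fix hF), hy.chi_inv hodd hF]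
  obtain ⟨j, hj⟩ := (hy.map hg).chi hodd hF
  have h1 : v.q (h (g y)) = v.q (g y) + j • v.q 1 := by rw [← hj, LocalAbs.chi]; abel
  have h2 : v.chi (g⁻¹ * h * g) y = v.chi h (g y) := by
    rw [hj, LocalAbs.chi]
    change v.q (g⁻¹ (h (g y))) - _ = _
    rw [q_apply_eq g⁻¹ h1]
    have : g⁻¹ (g y) = y := g.symm_apply_apply y
    rw [this]; abel
  rw [h2, LocalAbs.chi, LocalAbs.chi, LocalAbs.chi, D_apply]
  simp only [map_sub]
  abel

lemma comm_fix {h g : Ω ≃ₐ[K] Ω} (hF : ∀ x ∈ F, h x = x) (hg : ∀ x ∈ F, g x ∈ F) :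
    ∀ x ∈ F, (g⁻¹ * h * g * h⁻¹) x = x := fun x hx => by
  change g⁻¹ (h (g (h⁻¹ x))) = x
  rw [inv_fix hF x hx, hF _ (hg x hx)]
  exact g.symm_apply_apply x

lemma AS.D_pow (hodd : Odd p) {y : Ω} (hy : v.AS F y) {g : Ω ≃ₐ[K] Ω}
    (hg : ∀ x ∈ F, g x ∈ F) (n : ℕ) : v.AS F ((LocalAbs.D g ^ n) y) := by
  obtain ⟨b, hb, h⟩ := hy.wp
  exact ⟨hy.sm.D_pow g n, _, D_pow_mem hg hb n, q_wp_D_pow hodd hy.sm h g n⟩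

lemma AS.chi_iterate (hodd : Odd p) {y : Ω} (hy : v.AS F y) {h g : Ω ≃ₐ[K] Ω}
    (hF : ∀ x ∈ F, h x = x) (hg : ∀ x ∈ F, g x ∈ F) (n : ℕ) :
    v.chi ((fun h => g⁻¹ * h * g * h⁻¹)^[n] h) y = v.chi h ((D g ^ n) y) := by
  induction n generalizing h with
  | zero => rfl
  | succ n ih =>
    rw [Function.iterate_succ_apply, ih (comm_fix hF hg), (hy.D_pow hodd hg n).chi_comm hodd hF hg,
      D_pow_succ]

lemma iterate_fix {h g : Ω ≃ₐ[K] Ω} (hF : ∀ x ∈ F, h x = x) (hg : ∀ x ∈ F, g x ∈ F) (n : ℕ) :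
    ∀ x ∈ F, ((fun h => g⁻¹ * h * g * h⁻¹)^[n] h) x = x := by
  induction n generalizing h with
  | zero => exact hF
  | succ n ih => rw [Function.iterate_succ_apply]; exact ih (comm_fix hF hg)

end

namespace Datum

variable [Fact p.Prime] [IsGalois K Ω] [IsAlgClosed Ω]
variable {ℓ : ℕ} {F M : IntermediateField K Ω} {η α lam : Ω}
  {g : Ω ≃ₐ[K] Ω} (d : Datum v ℓ F M η α lam g)

include d

lemma as (i : ℕ) : v.AS F ((D g ^ i) lam) := ⟨d.sm i, _, d.α_mem' i, d.q_wp i⟩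

lemma eq_of_chi {h : Ω ≃ₐ[K] Ω} (hF : ∀ x ∈ F, h x = x)
    (h0 : ∀ k, v.chi h ((D g ^ k) lam) = 0) : ∀ y ∈ M, h y = y := by
  have key : M ≤ fixedField (Subgroup.zpowers h) := by
    have hmem : ∀ y, h y = y → y ∈ fixedField (Subgroup.zpowers h) := by
      intro y hy
      rw [mem_fixedField_iff]
      have : Subgroup.zpowers h ≤ MulAction.stabilizer (Ω ≃ₐ[K] Ω) y := by
        rw [Subgroup.zpowers_le]; exact hy
      exact fun τ hτ => this hτ
    refine d.minimal _ (fun y hy => hmem y (hF y hy)) fun τ => hmem _ ?_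
    obtain ⟨m, hm⟩ := d.gen τ
    have hwp : ∀ τ : Ω ≃ₐ[K] Ω, (τ lam) ^ p - τ lam = τ α := fun τ => by
      rw [← map_pow, ← map_sub, d.wp]
    obtain ⟨j, hj⟩ := exists_q_eq_add_zsmul d.odd (d.sm_lam.map τ) (d.sm_lam.map (g ^ m))
      (by rw [hwp, hwp, hm α d.α_mem])
    have h1 : v.q (h ((g ^ m) lam)) = v.q ((g ^ m) lam) := by
      rw [pow_eq_sum, map_sum, map_sum, map_sum]
      refine Finset.sum_congr rfl fun k _ => ?_
      rw [map_mul, map_natCast, q_natCast_mul, q_natCast_mul]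
      have := h0 k
      rw [chi, sub_eq_zero] at this
      rw [this]
    refine wp_inj ((d.sm_lam.map τ).map h) ?_ ?_
    · rw [← map_pow, ← map_sub, hwp, hF _ (d.normal τ _ d.α_mem)]
    · rw [q_apply_eq h hj, h1, hj]
  intro y hy
  have := (mem_fixedField_iff _ _).1 (key hy) h (Subgroup.mem_zpowers h)
  exact this

lemma pow_p {h : Ω ≃ₐ[K] Ω} (hF : ∀ x ∈ F, h x = x) : ∀ y ∈ M, (h ^ p) y = y := by
  refine d.eq_of_chi (fix_pow hF p) fun k => ?_
  obtain ⟨j, hj⟩ := (d.as k).chi d.odd hF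
  rw [(d.as k).chi_pow d.odd hF, hj, ← natCast_zsmul, ← mul_zsmul, zsmul_q_one_eq_zero_iff]
  exact Dvd.intro _ rfl

lemma comm {h₁ h₂ : Ω ≃ₐ[K] Ω} (h₁F : ∀ x ∈ F, h₁ x = x) (h₂F : ∀ x ∈ F, h₂ x = x) :
    ∀ y ∈ M, h₁ (h₂ y) = h₂ (h₁ y) := by
  intro y hy
  have := d.eq_of_chi (h := (h₂ * h₁)⁻¹ * (h₁ * h₂))
    (mul_fix (inv_fix (mul_fix h₂F h₁F)) (mul_fix h₁F h₂F)) (fun k => by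
      have hk := d.as k
      rw [hk.chi_mul d.odd (mul_fix h₁F h₂F), hk.chi_inv d.odd (mul_fix h₂F h₁F),
        hk.chi_mul d.odd h₁F, hk.chi_mul d.odd h₂F]
      abel) y hy
  have h2 : (h₂ * h₁) (((h₂ * h₁)⁻¹ * (h₁ * h₂)) y) = (h₁ * h₂) y :=
    (h₂ * h₁).apply_symm_apply _
  rw [this] at h2
  exact h2.symm

lemma iterate_succ {h : Ω ≃ₐ[K] Ω} (hF : ∀ x ∈ F, h x = x) :
    ∀ y ∈ M, ((fun h => g⁻¹ * h * g * h⁻¹)^[ℓ + 1] h) y = y := by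
  refine d.eq_of_chi (iterate_fix hF (d.normal g) _) fun k => ?_
  rw [(d.as k).chi_iterate d.odd hF (d.normal g), ← Module.End.mul_apply, ← pow_add]
  rcases Nat.eq_zero_or_pos k with rfl | hk
  · obtain ⟨j, hj⟩ := d.exists_q_D_succ
    exact chi_eq_zero_of_q hj
  · exact chi_eq_zero_of_q (j := 0) (by rw [d.q_D_high (by omega), zero_zsmul])

lemma iterate {h : Ω ≃ₐ[K] Ω} (hF : ∀ x ∈ F, h x = x)
    (hu : ∃ u : K, v.q (algebraMap K Ω u ^ p - algebraMap K Ω u) = v.q ((D g ^ ℓ) α)) :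
    ∀ y ∈ M, ((fun h => g⁻¹ * h * g * h⁻¹)^[ℓ] h) y = y := by
  obtain ⟨u, hu⟩ := hu
  refine d.eq_of_chi (iterate_fix hF (d.normal g) _) fun k => ?_
  rw [(d.as k).chi_iterate d.odd hF (d.normal g), ← Module.End.mul_apply, ← pow_add]
  rcases Nat.eq_zero_or_pos k with rfl | hk
  · have hus : v.Sm (algebraMap K Ω u) := Sm.of_wp (a := (D g ^ ℓ) α)
      (d.p_mul_val_lt le_rfl) ((q_eq_iff v).1 hu)
    obtain ⟨j, hj⟩ := exists_q_eq_add_zsmul d.odd (d.sm ℓ) hus (by rw [d.q_wp, hu])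
    rw [add_zero, chi, q_apply_eq h hj, hj, h.commutes, sub_self]
  · rcases Nat.eq_or_lt_of_le hk with rfl | hk
    · obtain ⟨j, hj⟩ := d.exists_q_D_succ
      exact chi_eq_zero_of_q hj
    · exact chi_eq_zero_of_q (j := 0) (by rw [d.q_D_high (by omega), zero_zsmul])

lemma exists_mem_of_chi {n : ℕ} (hn : n ≤ ℓ)
    (h0 : ∀ h : Ω ≃ₐ[K] Ω, (∀ x ∈ F, h x = x) → v.chi h ((D g ^ n) lam) = 0) :
    ∃ y ∈ F, y ^ p - y = (D g ^ n) α ∧ v.q y = v.q ((D g ^ n) lam) := by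
  obtain ⟨l, -, hl, hlq⟩ := d.exists_root n
  refine ⟨l, mem_of_fixed F l fun h hF => ?_, hl, hlq⟩
  have hls : v.Sm l := Sm.of_root hl (d.p_mul_val_lt hn)
  refine wp_inj (hls.map h) (by rw [← map_pow, ← map_sub, hl, hF _ (d.α_mem' n)]) ?_
  have := h0 h hF
  rw [← chi_congr hlq, chi, sub_eq_zero] at this
  exact this

lemma exists_iterate_ne {n : ℕ} (hn : n ≤ ℓ)
    (hno : ¬ ∃ y ∈ F, y ^ p - y = (D g ^ n) α) :
    ∃ h : Ω ≃ₐ[K] Ω, (∀ x ∈ F, h x = x) ∧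
      ∃ y ∈ M, ((fun h => g⁻¹ * h * g * h⁻¹)^[n] h) y ≠ y := by
  by_contra! hcon
  obtain ⟨y, hy, h, -⟩ := d.exists_mem_of_chi hn fun h hF => by
    have h0 := (d.as 0).chi_iterate d.odd hF (d.normal g) n
    rw [pow_zero, Module.End.one_apply] at h0
    rw [← h0, chi,
      hcon h hF _ d.lam_mem, sub_self]
  exact hno ⟨y, hy, h⟩

lemma exists_iterate_pred_ne : ∃ h : Ω ≃ₐ[K] Ω, (∀ x ∈ F, h x = x) ∧
    ∃ y ∈ M, ((fun h => g⁻¹ * h * g * h⁻¹)^[ℓ - 1] h) y ≠ y := by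
  have := d.one_le
  refine d.exists_iterate_ne (by omega) ?_
  rintro ⟨y, hy, h⟩
  exact d.no_root one_pos d.one_le hy (b := (D g ^ (ℓ - 1)) α)
    (by rw [d.val _ (by omega)]; congr 1; omega) (by rw [h])

lemma exists_residue {y : Ω} (hy : y ∈ F) (h : y ^ p - y = (D g ^ ℓ) α) :
    ∃ u : K, v.q (algebraMap K Ω u) = v.q y := by
  obtain ⟨c, hc, hcN⟩ := d.tr.residue hy (N_le_one_of_wp (by rw [h, d.N_top]))
  obtain ⟨u, rfl⟩ := IntermediateField.mem_bot.1 hc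
  exact ⟨u, by rw [eq_comm, q_eq_iff]; exact hcN⟩

lemma exists_iterate_top_ne
    (hno : ¬ ∃ u : K, v.q (algebraMap K Ω u ^ p - algebraMap K Ω u) = v.q ((D g ^ ℓ) α)) :
    ∃ h : Ω ≃ₐ[K] Ω, (∀ x ∈ F, h x = x) ∧
      ∃ y ∈ M, ((fun h => g⁻¹ * h * g * h⁻¹)^[ℓ] h) y ≠ y := by
  refine d.exists_iterate_ne le_rfl ?_
  rintro ⟨y, hy, h⟩
  obtain ⟨u, hu⟩ := d.exists_residue hy h
  have hys : v.Sm y := Sm.of_root h (d.p_mul_val_lt le_rfl)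
  exact hno ⟨u, by rw [← q_wp_congr hys hu.symm, h]⟩

omit d in
lemma q_D_mul {h : Ω ≃ₐ[K] Ω} (hodd : Odd p) (hF : ∀ x ∈ F, h x = x) {y : Ω} (hy : v.AS F y)
    {j : ℤ} (hj : v.chi h y = j • v.q 1) (m : ℕ) :
    v.q (D (g * h ^ m) y) = v.q (D g y) + (m * j) • v.q 1 := by
  have h1 : v.q ((h ^ m) y) = v.q y + (m * j) • v.q 1 := by
    have := hy.chi_pow hodd hF m
    rw [hj, ← natCast_zsmul, ← mul_zsmul, chi, sub_eq_iff_eq_add] at this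
    rw [this, add_comm, mul_comm]
  rw [D_apply, D_apply, map_sub, map_sub]
  change v.q (g ((h ^ m) y)) - _ = _
  rw [q_apply_eq g h1]
  abel

/-- The generator of `Gal(F/K)` has a lift whose `p`-th power is trivial on `M`. -/
lemma exists_lift (hgp : ∀ x ∈ F, (g ^ p) x = x)
    (hd : ∀ g' : Ω ≃ₐ[K] Ω, (∀ x ∈ F, g' x = g x) → Datum v ℓ F M η α lam g') :
    ∃ g' : Ω ≃ₐ[K] Ω, (∀ x ∈ F, g' x = g x) ∧ ∀ y ∈ M, (g' ^ p) y = y := by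
  have hp := (Fact.out : p.Prime)
  obtain ⟨j₂, hj₂⟩ := d.exists_q_D_succ
  obtain ⟨g', hg', h0⟩ : ∃ g' : Ω ≃ₐ[K] Ω, (∀ x ∈ F, g' x = g x) ∧
      v.q ((D g' ^ (ℓ + 1)) lam) = 0 := by
    by_cases hcase : ∀ h : Ω ≃ₐ[K] Ω, (∀ x ∈ F, h x = x) → v.chi h ((D g ^ ℓ) lam) = 0
    · obtain ⟨y, hy, hya, hyq⟩ := d.exists_mem_of_chi le_rfl hcase
      obtain ⟨u, hu⟩ := d.exists_residue hy hya
      refine ⟨g, fun _ _ => rfl, ?_⟩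
      rw [D_pow_succ, ← q_D_congr g (hu.trans hyq), D_apply, g.commutes, sub_self, map_zero]
    · push Not at hcase
      obtain ⟨h, hF, hh⟩ := hcase
      obtain ⟨j₁, hj₁⟩ := (d.as ℓ).chi d.odd hF
      have hpj : ¬ (p : ℤ) ∣ j₁ := by
        rw [← zsmul_q_one_eq_zero_iff (v := v), ← hj₁]; exact hh
      obtain ⟨m, hm⟩ := exists_mul_dvd_sub hpj (-j₂)
      refine ⟨g * h ^ m, fun x hx => ?_, ?_⟩
      · change g ((h ^ m) x) = g x
        rw [fix_pow hF m x hx]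
      have key : ∀ k, ∃ j : ℤ, v.q ((D (g * h ^ m) ^ k) lam) = v.q ((D g ^ k) lam) + j • v.q 1 := by
        intro k
        induction k with
        | zero => exact ⟨0, by simp⟩
        | succ k ih =>
          obtain ⟨j, hj⟩ := ih
          obtain ⟨j', hj'⟩ := (d.as k).chi d.odd hF
          refine ⟨m * j', ?_⟩
          rw [D_pow_succ, D_pow_succ, ← q_D_mul d.odd hF (d.as k) hj' m]
          rw [D_apply, D_apply, map_sub, map_sub, q_apply_eq _ hj, hj]
          abel
      obtain ⟨j, hj⟩ := key ℓ
      rw [D_pow_succ, D_apply, map_sub, q_apply_eq _ hj, hj, add_sub_add_right_eq_sub, ← map_sub,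
        ← D_apply, q_D_mul d.odd hF (d.as ℓ) hj₁ m, ← D_pow_succ, hj₂, ← add_zsmul,
        zsmul_q_one_eq_zero_iff]
      rwa [sub_neg_eq_add, add_comm] at hm
  refine ⟨g', hg', ?_⟩
  have d' := hd g' hg'
  have hhigh : ∀ k, ℓ + 1 ≤ k → v.q ((D g' ^ k) lam) = 0 := by
    intro k hk
    rcases Nat.eq_or_lt_of_le hk with rfl | hk
    · exact h0
    · exact d'.q_D_high hk
  have hlam : v.q ((g' ^ p) lam) = v.q lam := by
    rw [pow_eq_sum, map_sum, Finset.sum_range_succ', Finset.sum_eq_zero]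
    · simp
    intro k hk
    rw [Finset.mem_range] at hk
    rcases Nat.eq_or_lt_of_le (Nat.succ_le_of_lt hk) with h | h
    · rw [q_natCast_mul, hhigh _ (by have := d.lt; omega), nsmul_zero]
    · obtain ⟨c, hc⟩ := hp.dvd_choose_self (k := k + 1) (by omega) h
      rw [hc, Nat.cast_mul, mul_assoc, q_eq_zero_iff]
      exact_mod_cast ((d'.sm (k + 1)).int_mul c).p_mul_lt
  have hg'p : ∀ x ∈ F, (g' ^ p) x = x := by
    have : ∀ n : ℕ, ∀ x ∈ F, (g' ^ n) x = (g ^ n) x := by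
      intro n
      induction n with
      | zero => exact fun _ _ => rfl
      | succ n ih =>
        intro x hx
        rw [pow_succ, pow_succ]
        change (g' ^ n) (g' x) = (g ^ n) (g x)
        rw [hg' x hx, ih _ (d.normal g x hx)]
    intro x hx
    rw [this p x hx, hgp x hx]
  refine d'.eq_of_chi hg'p fun k => ?_
  have hcomm : (g' ^ p) ((D g' ^ k) lam) = (D g' ^ k) ((g' ^ p) lam) := by
    induction k with
    | zero => rfl
    | succ k ih =>
      rw [D_pow_succ, D_pow_succ, ← ih, D_apply, D_apply, map_sub]
      congr 1
      change (g' ^ p * g') _ = (g' * g' ^ p) _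
      rw [pow_mul_comm']
  have hcongr : ∀ k, v.q ((D g' ^ k) ((g' ^ p) lam)) = v.q ((D g' ^ k) lam) := by
    intro k
    induction k with
    | zero => exact hlam
    | succ k ih => rw [D_pow_succ, D_pow_succ, q_D_congr g' ih]
  rw [chi, hcomm, hcongr, sub_self]

end Datum
end LocalAbs

namespace LocalAbs
variable {p : ℕ} {K Ω : Type*} [Field K] [Field Ω] [Algebra K Ω] {v : LocalAbs p K Ω}

lemma N_sum_sub_le (v : LocalAbs p K Ω) {ι : Type*} [DecidableEq ι] (s : Finset ι) (f : ι → Ω)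
    {i : ι} (hi : i ∈ s) {c : ℝ} (hc : 0 ≤ c) (h : ∀ j ∈ s, j ≠ i → v.N (f j) ≤ c) :
    v.N (∑ j ∈ s, f j - f i) ≤ c := by
  rw [← Finset.add_sum_erase s f hi, add_sub_cancel_left]
  refine v.N_sum_le _ _ hc fun j hj => ?_
  rw [Finset.mem_erase] at hj
  exact h j hj.2 hj.1

lemma N_sum_sub_lt (v : LocalAbs p K Ω) {ι : Type*} [DecidableEq ι] (s : Finset ι) (f : ι → Ω)
    {i : ι} (hi : i ∈ s) {c : ℝ} (hc : 0 < c) (h : ∀ j ∈ s, j ≠ i → v.N (f j) < c) :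
    v.N (∑ j ∈ s, f j - f i) < c := by
  rw [← Finset.add_sum_erase s f hi, add_sub_cancel_left]
  refine v.N_sum_lt _ _ hc fun j hj => ?_
  rw [Finset.mem_erase] at hj
  exact h j hj.2 hj.1

/-- `x` and `y` have the same leading term: `x / y` is a principal unit. -/
def Sim (v : LocalAbs p K Ω) (x y : Ω) : Prop := v.N (x - y) < v.N y

namespace Sim

variable {x y z x' y' : Ω}

lemma N_eq (h : v.Sim x y) : v.N x = v.N y := v.N_eq_of_sub_lt h

lemma ne_zero_right (h : v.Sim x y) : y ≠ 0 := by
  rintro rfl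
  have := v.N.nonneg (x - 0)
  simp [Sim] at h
  linarith [v.N.nonneg x]

lemma ne_zero_left (h : v.Sim x y) : x ≠ 0 := by
  have := h.ne_zero_right
  have h2 := h.N_eq
  rintro rfl
  rw [v.N.map_zero, eq_comm, v.N.eq_zero] at h2
  exact this h2

lemma refl (h : x ≠ 0) : v.Sim x x := by simp [Sim, v.N.pos h]

lemma symm (h : v.Sim x y) : v.Sim y x := by
  have := h.N_eq
  unfold Sim at *
  rw [v.N.map_sub, this]; exact h

lemma trans (h : v.Sim x y) (h' : v.Sim y z) : v.Sim x z := by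
  have h2 := h'.N_eq
  unfold Sim at *
  rw [← sub_add_sub_cancel x y z]
  exact v.N_add_lt (h2 ▸ h) h'

lemma iff_div (hy : y ≠ 0) : v.Sim x y ↔ v.N (x / y - 1) < 1 := by
  have : x - y = (x / y - 1) * y := by field_simp
  unfold Sim
  rw [this, map_mul, mul_lt_iff_lt_one_left (v.N.pos hy)]

lemma mul (h : v.Sim x y) (h' : v.Sim x' y') : v.Sim (x * x') (y * y') := by
  have h1 := h.N_eq
  have h2 := v.N.pos h.ne_zero_right
  have h3 := v.N.pos h'.ne_zero_right
  have h4 := h'.N_eq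
  unfold Sim at *
  have : x * x' - y * y' = (x - y) * x' + y * (x' - y') := by ring
  rw [this]
  refine v.N_add_lt ?_ ?_ <;> rw [map_mul, map_mul]
  · rw [h4]; exact mul_lt_mul_of_pos_right h h3
  · exact mul_lt_mul_of_pos_left h' h2

lemma inv (h : v.Sim x y) : v.Sim x⁻¹ y⁻¹ := by
  have hx := h.ne_zero_left
  have hy := h.ne_zero_right
  have := (h.symm.mul (refl (v := v) (inv_ne_zero hx))).mul (refl (v := v) (inv_ne_zero hy))
  convert this using 1 <;> field_simp

lemma div (h : v.Sim x y) (h' : v.Sim x' y') : v.Sim (x / x') (y / y') := by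
  rw [div_eq_mul_inv, div_eq_mul_inv]; exact h.mul h'.inv

lemma pow (h : v.Sim x y) (n : ℕ) : v.Sim (x ^ n) (y ^ n) := by
  induction n with
  | zero => simpa using refl one_ne_zero
  | succ n ih => rw [pow_succ, pow_succ]; exact ih.mul h

lemma zpow (h : v.Sim x y) (n : ℤ) : v.Sim (x ^ n) (y ^ n) := by
  obtain ⟨m, rfl | rfl⟩ := n.eq_nat_or_neg
  · simpa using h.pow m
  · simpa using (h.pow m).inv

lemma neg (h : v.Sim x y) : v.Sim (-x) (-y) := by
  unfold Sim at *
  rw [neg_sub_neg, v.N.map_sub, v.N.map_neg]; exact h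

lemma mul_left (h : v.Sim x y) (hz : z ≠ 0) : v.Sim (z * x) (z * y) := (refl hz).mul h

end Sim

section Binomial

variable {y : Ω}

lemma N_one_add_pow_le (n : ℕ) (hy : v.N y ≤ 1) : v.N ((1 + y) ^ n - 1 - n * y) ≤ v.N y ^ 2 := by
  have h0 := v.N.nonneg y
  have h1 : v.N (1 + y) ≤ 1 := v.N_add_le (by simp) hy
  induction n with
  | zero => simp
  | succ n ih =>
    have : (1 + y) ^ (n + 1) - 1 - (n + 1 : ℕ) * y
        = ((1 + y) ^ n - 1 - n * y) * (1 + y) + n * y ^ 2 := by push_cast; ring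
    rw [this]
    refine v.N_add_le ?_ ?_
    · rw [map_mul]; exact (mul_le_of_le_one_right (v.N.nonneg _) h1).trans ih
    · rw [map_mul, map_pow]; exact mul_le_of_le_one_left (by positivity) (v.N_nat_le n)

lemma N_one_add_pow_sub_one_le (n : ℕ) (hy : v.N y ≤ 1) : v.N ((1 + y) ^ n - 1) ≤ v.N y := by
  have h0 := v.N.nonneg y
  have : (1 + y) ^ n - 1 = ((1 + y) ^ n - 1 - n * y) + n * y := by ring
  rw [this]
  refine v.N_add_le ((N_one_add_pow_le n hy).trans ?_) ?_
  · rw [pow_two]; exact mul_le_of_le_one_left h0 hy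
  · rw [map_mul]; exact mul_le_of_le_one_left h0 (v.N_nat_le n)

lemma N_one_add_zpow_le (e : ℤ) (hy : v.N y < 1) : v.N ((1 + y) ^ e - 1 - e * y) ≤ v.N y ^ 2 := by
  obtain ⟨n, rfl | rfl⟩ := e.eq_nat_or_neg
  · simpa using N_one_add_pow_le n hy.le
  · have h1 : v.N (1 + y) = 1 := by
      rw [← v.N.map_one]; apply v.N_eq_of_sub_lt; simpa using hy
    have h2 : (1 + y) ≠ 0 := by rintro h; rw [h] at h1; simp at h1
    have h3 : v.N ((1 + y) ^ n) = 1 := by rw [map_pow, h1, one_pow]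
    have h4 : (1 + y) ^ n ≠ 0 := pow_ne_zero _ h2
    have : (1 + y) ^ (-(n : ℤ)) - 1 - ((-(n : ℤ) : ℤ) : Ω) * y
        = ((1 + y) ^ n)⁻¹ * (-((1 + y) ^ n - 1 - n * y) + (n * y) * ((1 + y) ^ n - 1)) := by
      rw [zpow_neg, zpow_natCast]; push_cast; field_simp; ring
    rw [this, map_mul, map_inv₀, h3, inv_one, one_mul]
    refine v.N_add_le ?_ ?_
    · rw [v.N.map_neg]; exact N_one_add_pow_le n hy.le
    · rw [map_mul, map_mul, pow_two]
      exact mul_le_mul (mul_le_of_le_one_left (v.N.nonneg y) (v.N_nat_le n))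
        (N_one_add_pow_sub_one_le n hy.le) (v.N.nonneg _) (v.N.nonneg y)

lemma N_one_add_pow_prime_le [Fact p.Prime] (hy : v.N y ≤ 1) :
    v.N ((1 + y) ^ p - 1 - y ^ p) ≤ v.N (p : Ω) * v.N y := by
  have hp := (Fact.out : p.Prime)
  have h0 := v.N.nonneg y
  have h : (1 + y) ^ p - 1 - y ^ p
      = ∑ k ∈ Finset.range (p - 1), y ^ (k + 1) * (p.choose (k + 1) : Ω) := by
    obtain ⟨q, rfl⟩ : ∃ q, p = q + 1 := ⟨p - 1, by have := hp.pos; omega⟩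
    rw [add_comm, add_pow, Finset.sum_range_succ, Finset.sum_range_succ', Nat.add_sub_cancel]
    simp
    ring
  rw [h]
  refine v.N_sum_le _ _ (mul_nonneg v.p_pos.le h0) fun k hk => ?_
  rw [Finset.mem_range] at hk
  obtain ⟨m, hm⟩ := hp.dvd_choose_self (k := k + 1) (by omega) (by omega)
  rw [hm, Nat.cast_mul, map_mul, map_mul, map_pow, pow_succ, mul_comm]
  have h2 := v.N_nat_le m
  have h3 := v.N.nonneg (m : Ω)
  have h4 := v.p_pos
  have h5 : v.N y ^ k ≤ 1 := pow_le_one₀ h0 hy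
  have h6 : 0 ≤ v.N y ^ k := by positivity
  refine mul_le_mul ?_ ?_ (by positivity) h4.le
  · exact mul_le_of_le_one_right h4.le h2
  · exact mul_le_of_le_one_left h0 h5

end Binomial

lemma N_pow_of_eisenstein {n : ℕ} (hn : 0 < n) (x : Ω) (c : ℕ → Ω)
    (h : x ^ n + ∑ i ∈ Finset.range n, c (i + 1) * x ^ (n - (i + 1)) = 0)
    (hc : ∀ i < n, v.N (c (i + 1)) ≤ v.N (p : Ω)) (hcn : v.N (c n) = v.N (p : Ω)) :
    v.N x ^ n = v.N (p : Ω) := by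
  have h0 := v.N.nonneg x
  have hp0 := v.p_pos
  have hx : v.N x < 1 := by
    by_contra! h1
    have h2 : v.N (∑ i ∈ Finset.range n, c (i + 1) * x ^ (n - (i + 1))) < v.N x ^ n := by
      refine v.N_sum_lt _ _ (by positivity) fun i hi => ?_
      rw [Finset.mem_range] at hi
      rw [map_mul, map_pow]
      have h3 : v.N x ^ (n - (i + 1)) ≤ v.N x ^ n := pow_le_pow_right₀ h1 (by omega)
      have h4 : 0 < v.N x ^ n := by positivity
      calc _ ≤ v.N (p : Ω) * v.N x ^ n := mul_le_mul (hc i hi) h3 (by positivity) hp0.le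
        _ < _ := mul_lt_of_lt_one_left h4 v.p_lt
    have h3 : x ^ n = -∑ i ∈ Finset.range n, c (i + 1) * x ^ (n - (i + 1)) := by
      linear_combination h
    rw [← map_pow, h3, v.N.map_neg, ← v.N.map_neg, ← h3] at h2
    rw [h3, v.N.map_neg] at h2
    exact lt_irrefl _ h2
  obtain ⟨m, rfl⟩ : ∃ m, n = m + 1 := ⟨n - 1, by omega⟩
  rw [Finset.sum_range_succ] at h
  simp only [Nat.sub_self, pow_zero, mul_one] at h
  rw [← map_pow, ← hcn, ← v.N.map_neg (c (m + 1))]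
  apply v.N_eq_of_sub_lt
  rw [v.N.map_neg, hcn]
  have h1 : x ^ (m + 1) - -c (m + 1)
      = -∑ i ∈ Finset.range m, c (i + 1) * x ^ (m + 1 - (i + 1)) := by linear_combination h
  rw [h1, v.N.map_neg]
  refine v.N_sum_lt _ _ hp0 fun i hi => ?_
  rw [Finset.mem_range] at hi
  rw [map_mul, map_pow]
  have h3 : v.N x ^ (m + 1 - (i + 1)) < 1 := pow_lt_one₀ h0 hx (by omega)
  calc _ ≤ v.N (p : Ω) * v.N x ^ (m + 1 - (i + 1)) :=
        mul_le_mul_of_nonneg_right (hc i (by omega)) (by positivity)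
    _ < _ := mul_lt_of_lt_one_right hp0 h3

end LocalAbs

namespace LocalAbs
variable {p : ℕ} {K Ω : Type*} [Field K] [Field Ω] [Algebra K Ω] {v : LocalAbs p K Ω}

/-- The polynomial function `Y ^ p + ∑ c (p i) Y ^ (p - i)`. -/
def sub (p : ℕ) {Ω : Type*} [Field Ω] (c : ℕ → Ω) (Y : Ω) : Ω :=
  Y ^ p + ∑ i ∈ Finset.range p, c (p * (i + 1)) * Y ^ (p - (i + 1))

/-- The conditions on the coefficients `c i` of an Eisenstein polynomial of degree `p ^ 2` with
root `π`. -/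
structure Eis (v : LocalAbs p K Ω) (ℓ r : ℕ) (c : ℕ → Ω) (π : Ω) : Prop where
  odd : Odd p
  two_le : 2 ≤ ℓ
  lt : ℓ < p
  hr : r + (p - 1) * ℓ = p ^ 2 + p
  mem : ∀ i, c i ∈ (⊥ : IntermediateField K Ω)
  le : ∀ i, 1 ≤ i → i ≤ p ^ 2 → v.N (c i) ≤ v.N (p : Ω)
  last : v.N (c (p ^ 2)) = v.N (p : Ω)
  first : v.N (c p) = v.N (p : Ω)
  mult : ∀ i, 2 ≤ i → i < p → v.N (c (p * i)) ≤ v.N (p : Ω) ^ 2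
  low : ∀ i, 1 ≤ i → i < r → i.Coprime p → v.N (c i) ≤ v.N (p : Ω) ^ 2
  mid : v.N (c r) = v.N (p : Ω) ^ 2
  high : ∀ i, r < i → i < p ^ 2 → i.Coprime p → v.N (c i) ≤ v.N (p : Ω) ^ 3
  root : π ^ p ^ 2 + ∑ i ∈ Finset.range (p ^ 2), c (i + 1) * π ^ (p ^ 2 - (i + 1)) = 0

namespace Eis

variable [Fact p.Prime] {ℓ r : ℕ} {c : ℕ → Ω} {π : Ω} (d : v.Eis ℓ r c π)
include d

lemma prime : p.Prime := Fact.out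

lemma three_le : 3 ≤ p := by have := d.two_le; have := d.lt; omega

lemma N_pow : v.N π ^ p ^ 2 = v.N (p : Ω) := by
  have := d.prime.pos
  exact N_pow_of_eisenstein (by positivity) π c d.root (fun i hi => d.le _ (by omega) (by omega))
    d.last

lemma pos : 0 < v.N π := pos_of_pow_eq (by have := d.prime.pos; positivity) d.N_pow

lemma lt_one : v.N π < 1 := lt_one_of_pow_eq d.N_pow

lemma N_sub_sub_le {η y : Ω} (hη : v.N η ^ p = v.N (p : Ω)) (hy : v.N y ≤ 1) :
    v.N (sub p c (η * (1 + y)) - sub p c η - (η ^ p * y ^ p - c p * η ^ (p - 1) * y))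
      ≤ v.N η ^ (2 * p - 1) * v.N y * max (v.N η) (v.N y) := by
  have hp := d.prime.pos
  have hη0 := pos_of_pow_eq hp hη
  have hη1 := lt_one_of_pow_eq hη
  have hy0 := v.N.nonneg y
  set f : ℕ → Ω := fun i => c (p * (i + 1)) * (η ^ (p - (i + 1)) * ((1 + y) ^ (p - (i + 1)) - 1))
    with hf
  have hid : sub p c (η * (1 + y)) - sub p c η - (η ^ p * y ^ p - c p * η ^ (p - 1) * y)
      = η ^ p * ((1 + y) ^ p - 1 - y ^ p) + (∑ i ∈ Finset.range p, f i - f 0)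
        + (c p * η ^ (p - 1) * ((1 + y) ^ (p - 1) - 1 - (p - 1 : ℕ) * y)
          + c p * η ^ (p - 1) * (p * y)) := by
    have h1 : ∑ i ∈ Finset.range p, f i
        = ∑ i ∈ Finset.range p, c (p * (i + 1)) * (η * (1 + y)) ^ (p - (i + 1))
          - ∑ i ∈ Finset.range p, c (p * (i + 1)) * η ^ (p - (i + 1)) := by
      rw [← Finset.sum_sub_distrib]
      refine Finset.sum_congr rfl fun i _ => ?_
      rw [mul_pow]; simp only [hf]; ring
    have h2 : f 0 = c p * (η ^ (p - 1) * ((1 + y) ^ (p - 1) - 1)) := by simp [hf]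
    rw [h1, h2]
    have h3 : ((p - 1 : ℕ) : Ω) = p - 1 := by rw [Nat.cast_sub hp]; simp
    rw [h3]
    simp only [sub, mul_pow]
    ring
  set h := v.N η with hh
  have hm1 : h ≤ max h (v.N y) := le_max_left _ _
  have hm2 : v.N y ≤ max h (v.N y) := le_max_right _ _
  have hs : h ^ (2 * p - 1) = h ^ p * h ^ (p - 1) := by rw [← pow_add]; congr 1; omega
  have hs2 : h ^ (2 * p - 1) * h = h ^ p * h ^ p := by
    rw [← pow_succ, ← pow_add]; congr 1; omega
  have hle1 : h ^ (2 * p - 1) * v.N y * h ≤ h ^ (2 * p - 1) * v.N y * max h (v.N y) := by gcongr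
  have hle2 : h ^ (2 * p - 1) * v.N y * v.N y ≤ h ^ (2 * p - 1) * v.N y * max h (v.N y) := by
    gcongr
  have hle3 : h ^ p * h ^ p * v.N y ≤ h ^ (2 * p - 1) * v.N y * max h (v.N y) := by
    rw [← hs2]; convert hle1 using 1; ring
  rw [hid]
  refine v.N_add_le (v.N_add_le ?_ ?_) (v.N_add_le ?_ ?_)
  · refine le_trans ?_ hle3
    rw [map_mul, map_pow, mul_assoc]
    have := N_one_add_pow_prime_le (v := v) hy
    rw [← hη] at this
    gcongr
  · refine le_trans ?_ hle3
    refine v.N_sum_sub_le _ _ (by simpa using hp) (by positivity) fun j hj hj0 => ?_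
    rw [Finset.mem_range] at hj
    simp only [hf]
    rcases eq_or_ne (j + 1) p with hjp | hjp
    · rw [hjp]; simp; positivity
    · have h1 := d.mult (j + 1) (by omega) (by omega)
      rw [← hη] at h1
      have h2 := N_one_add_pow_sub_one_le (v := v) (p - (j + 1)) hy
      rw [map_mul, map_mul, map_pow, ← pow_two]
      have h3 : h ^ (p - (j + 1)) ≤ 1 := pow_le_one₀ hη0.le hη1.le
      refine mul_le_mul h1 ?_ (by positivity) (by positivity)
      exact (mul_le_of_le_one_left (v.N.nonneg _) h3).trans h2
  · refine le_trans ?_ hle2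
    rw [map_mul, map_mul, map_pow, d.first, ← hη, hs, mul_assoc, mul_assoc _ (v.N y), ← mul_assoc,
      ← pow_two]
    gcongr
    exact N_one_add_pow_le _ hy
  · refine le_trans ?_ hle3
    rw [map_mul, map_mul, map_mul, map_pow, d.first, ← hη, ← hh]
    have h3 : h ^ (p - 1) ≤ 1 := pow_le_one₀ hη0.le hη1.le
    calc h ^ p * h ^ (p - 1) * (h ^ p * v.N y) ≤ h ^ p * 1 * (h ^ p * v.N y) := by gcongr
      _ = _ := by ring

/-- The relation between two distinct roots of `sub p c`. -/
lemma N_eq_of_roots {η y : Ω} (hη : v.N η ^ p = v.N (p : Ω)) (hy : v.N y ≤ 1) (hy0 : y ≠ 0)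
    (h1 : sub p c η = 0) (h2 : sub p c (η * (1 + y)) = 0) :
    v.N y = v.N η ∧ v.N ((y / η) ^ (p - 1) - c p / η ^ p) < 1 := by
  have hp3 := d.three_le
  have hη0 := pos_of_pow_eq (by omega) hη
  have hη1 := lt_one_of_pow_eq hη
  have hyp := v.N.pos hy0
  have hE := d.N_sub_sub_le hη hy
  rw [h1, h2, sub_self, zero_sub, v.N.map_neg] at hE
  have hA : v.N (η ^ p * y ^ p) = v.N η ^ p * v.N y ^ p := by simp
  have hB : v.N (c p * η ^ (p - 1) * y) = v.N η ^ (2 * p - 1) * v.N y := by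
    rw [map_mul, map_mul, map_pow, d.first, ← hη, ← pow_add]; congr 2; omega
  have heq : v.N y = v.N η := by
    rcases lt_trichotomy (v.N y) (v.N η) with h | h | h
    · exfalso
      have h3 : v.N (η ^ p * y ^ p) < v.N (c p * η ^ (p - 1) * y) := by
        rw [hA, hB, show v.N y ^ p = v.N y ^ (p - 1) * v.N y by
          rw [← pow_succ]; congr 1; omega, ← mul_assoc]
        have : v.N η ^ (2 * p - 1) = v.N η ^ p * v.N η ^ (p - 1) := by
          rw [← pow_add]; congr 1; omega
        rw [this]
        gcongr
        omega
      have h4 : v.N (η ^ p * y ^ p - c p * η ^ (p - 1) * y) = v.N (c p * η ^ (p - 1) * y) := by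
        rw [← v.N.map_neg (c p * _ * _)]
        apply v.N_eq_of_sub_lt
        rw [v.N.map_neg, sub_neg_eq_add, sub_add_cancel]; exact h3
      rw [h4, hB, max_eq_left h.le] at hE
      have : 0 < v.N η ^ (2 * p - 1) * v.N y := by positivity
      nlinarith
    · exact h
    · exfalso
      have h5 : v.N η ^ (p - 1) * v.N y < v.N y ^ p := by
        rw [show v.N y ^ p = v.N y ^ (p - 1) * v.N y by rw [← pow_succ]; congr 1; omega]
        gcongr; omega
      have h3 : v.N (c p * η ^ (p - 1) * y) < v.N (η ^ p * y ^ p) := by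
        rw [hA, hB, show 2 * p - 1 = p + (p - 1) by omega, pow_add, mul_assoc]
        gcongr
      have h4 : v.N (η ^ p * y ^ p - c p * η ^ (p - 1) * y) = v.N (η ^ p * y ^ p) := by
        apply v.N_eq_of_sub_lt
        rw [sub_sub_cancel_left, v.N.map_neg]; exact h3
      rw [h4, max_eq_right h.le, hA, show 2 * p - 1 = p + (p - 1) by omega, pow_add, mul_assoc,
        mul_assoc] at hE
      have h6 := le_of_mul_le_mul_left hE (by positivity)
      have h7 : v.N η ^ (p - 1) * (v.N y * v.N y) ≤ v.N η ^ (p - 1) * v.N y := by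
        rw [← mul_assoc]; exact mul_le_of_le_one_right (by positivity) hy
      linarith
  refine ⟨heq, ?_⟩
  have hη' : η ≠ 0 := (v.N.ne_zero_iff).1 hη0.ne'
  have hid : (y / η) ^ (p - 1) - c p / η ^ p
      = (η ^ p * y ^ p - c p * η ^ (p - 1) * y) / (η ^ (2 * p - 1) * y) := by
    rw [show 2 * p - 1 = p + (p - 1) by omega, pow_add,
      show y ^ p = y ^ (p - 1) * y by rw [← pow_succ]; congr 1; omega, div_pow]
    field_simp
  rw [hid, map_div₀, div_lt_one (by rw [map_mul, map_pow]; positivity)]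
  refine hE.trans_lt ?_
  rw [heq, max_self, map_mul, map_pow, heq]
  exact mul_lt_of_lt_one_right (by positivity) hη1

lemma sub_eq_zero_sim {η : Ω} (hη : v.N η ^ p = v.N (p : Ω)) (h1 : sub p c η = 0) :
    v.Sim (η ^ p) (-c (p ^ 2)) := by
  have hp3 := d.three_le
  have hη0 := pos_of_pow_eq (by omega) hη
  have hη1 := lt_one_of_pow_eq hη
  unfold Sim
  rw [v.N.map_neg, d.last]
  have hid : η ^ p - -c (p ^ 2) = -(∑ i ∈ Finset.range p, c (p * (i + 1)) * η ^ (p - (i + 1))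
      - c (p * (p - 1 + 1)) * η ^ (p - (p - 1 + 1))) := by
    rw [Nat.sub_add_cancel (by omega : 1 ≤ p)]
    simp only [sub] at h1
    simp only [Nat.sub_self, pow_zero, mul_one, ← pow_two]
    linear_combination h1
  rw [hid, v.N.map_neg]
  refine v.N_sum_sub_lt _ _ (by simp; omega) v.p_pos fun j hj hj' => ?_
  rw [Finset.mem_range] at hj
  have h2 := d.le (p * (j + 1)) (by nlinarith) (by nlinarith)
  rw [map_mul, map_pow]
  calc _ ≤ v.N (p : Ω) * v.N η ^ (p - (j + 1)) := by gcongr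
    _ < v.N (p : Ω) := mul_lt_of_lt_one_right v.p_pos (pow_lt_one₀ hη0.le hη1 (by omega))

lemma N_of_sub_eq_zero {η : Ω} (h1 : sub p c η = 0) : v.N η ^ p = v.N (p : Ω) := by
  have hp := d.prime.pos
  refine N_pow_of_eisenstein hp η (fun i => c (p * i)) h1
    (fun i hi => d.le _ (by nlinarith) (by nlinarith)) ?_
  rw [← pow_two]; exact d.last

end Eis

end LocalAbs

namespace LocalAbs
variable {p : ℕ} {K Ω : Type*} [Field K] [Field Ω] [Algebra K Ω] {v : LocalAbs p K Ω}

lemma exists_root_near [IsAlgClosed Ω] (v : LocalAbs p K Ω) {P : Polynomial Ω} (hP : P.Monic)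
    {x : Ω} {a : ℝ} (ha : 0 ≤ a) (h : v.N (eval x P) < a ^ P.natDegree) :
    ∃ r, eval r P = 0 ∧ v.N (x - r) < a := by
  have hsplit := (IsAlgClosed.splits P)
  have hev : eval x P = ((P.roots.map fun r => x - r)).prod := by
    conv_lhs => rw [hsplit.eq_prod_roots_of_monic hP]
    rw [eval_multiset_prod, Multiset.map_map]; simp
  by_contra! h3
  rw [hev, map_multiset_prod, Multiset.map_map, hsplit.natDegree_eq_card_roots] at h
  refine absurd h (not_lt.2 ?_)
  have h4 : ∀ s : Multiset Ω, (∀ r ∈ s, a ≤ v.N (x - r)) →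
      a ^ s.card ≤ (s.map (v.N ∘ fun r => x - r)).prod := by
    intro s
    induction s using Multiset.induction_on with
    | empty => simp
    | cons r s ih =>
      intro hs
      rw [Multiset.card_cons, pow_succ', Multiset.map_cons, Multiset.prod_cons]
      exact mul_le_mul (hs r (by simp)) (ih fun r hr => hs r (by simp [hr])) (by positivity)
        (v.N.nonneg _)
  exact h4 _ fun r hr => h3 r ((mem_roots hP.ne_zero).1 hr)

/-- The polynomial underlying `sub`. -/
noncomputable def subPoly (p : ℕ) {R : Type*} [CommRing R] (c : ℕ → R) : Polynomial R :=
  X ^ p + ∑ i ∈ Finset.range p, C (c (p * (i + 1))) * X ^ (p - (i + 1))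

lemma degree_subPoly_lt {R : Type*} [CommRing R] [Nontrivial R] (c : ℕ → R) :
    (∑ i ∈ Finset.range p, C (c (p * (i + 1))) * X ^ (p - (i + 1))).degree < (p : WithBot ℕ) := by
  refine (degree_sum_le _ _).trans_lt ?_
  rw [Finset.sup_lt_iff (by exact WithBot.bot_lt_coe p)]
  intro i hi
  rw [Finset.mem_range] at hi
  refine (degree_C_mul_X_pow_le _ _).trans_lt ?_
  exact_mod_cast (by omega : p - (i + 1) < p)

lemma subPoly_monic {R : Type*} [CommRing R] [Nontrivial R] (c : ℕ → R) : (subPoly p c).Monic :=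
  monic_X_pow_add (degree_subPoly_lt c)

lemma natDegree_subPoly {R : Type*} [CommRing R] [Nontrivial R] (c : ℕ → R) :
    (subPoly p c).natDegree = p := by
  have h := degree_subPoly_lt (p := p) c
  have h2 : (subPoly p c).degree = (p : WithBot ℕ) := by
    rw [subPoly, degree_add_eq_left_of_degree_lt, degree_X_pow]
    rwa [degree_X_pow]
  exact natDegree_eq_of_degree_eq_some h2

lemma eval_subPoly (c : ℕ → Ω) (x : Ω) : eval x (subPoly p c) = sub p c x := by
  simp [subPoly, sub, eval_finsetSum]

namespace Eis

variable [Fact p.Prime] {ℓ r : ℕ} {c : ℕ → Ω} {π : Ω} (d : v.Eis ℓ r c π)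
include d

lemma r_facts : 1 ≤ r ∧ r < p ^ 2 ∧ r.Coprime p ∧ p ^ 2 - r + p = (p - 1) * ℓ ∧
    p < (p - 1) * ℓ := by
  have h3 := d.three_le
  have h1 := d.hr
  have h2 := d.two_le
  have h4 := d.lt
  obtain ⟨q, rfl⟩ : ∃ q, p = q + 1 := ⟨p - 1, by omega⟩
  rw [Nat.add_sub_cancel] at *
  have h5 : q * 2 ≤ q * ℓ := by gcongr
  have h6 : q * ℓ ≤ q * q := by gcongr; omega
  have h7 : (q + 1) ^ 2 = q * q + 2 * q + 1 := by ring
  have h8 : q + 1 < q * ℓ := by omega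
  refine ⟨by omega, by omega, ?_, by omega, h8⟩
  rw [Nat.coprime_comm, (Fact.out : (q + 1).Prime).coprime_iff_not_dvd]
  intro hr
  have h9 : (q + 1) ∣ ℓ := by
    have e1 : r + (q + 1) * ℓ = (q + 1) * (q + 1 + 1) + ℓ := by nlinarith
    rw [← Nat.dvd_add_right (b := (q + 1) * (q + 1 + 1)) (Dvd.intro _ rfl), ← e1]
    exact dvd_add hr (Dvd.intro _ rfl)
  have := Nat.le_of_dvd (by omega) h9
  omega

lemma π_ne : π ≠ 0 := (v.N.ne_zero_iff).1 d.pos.ne'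

lemma sub_pow_sim : v.Sim (sub p c (π ^ p)) (-(c r * π ^ (p ^ 2 - r))) := by
  obtain ⟨hr1, hr2, hr3, -, -⟩ := d.r_facts
  have hp := d.prime
  have h0 := d.pos
  have h1 := d.lt_one
  have hp0 := v.p_pos
  set f : ℕ → Ω := fun i => c (i + 1) * π ^ (p ^ 2 - (i + 1)) with hf
  have hN : v.N (c r * π ^ (p ^ 2 - r)) = v.N (p : Ω) ^ 2 * v.N π ^ (p ^ 2 - r) := by
    rw [map_mul, map_pow, d.mid]
  have hsplit := Finset.sum_filter_add_sum_filter_not (Finset.range (p ^ 2)) (fun i => p ∣ i + 1) f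
  have hmul : ∑ i ∈ Finset.range (p ^ 2) with p ∣ i + 1, f i
      = ∑ j ∈ Finset.range p, c (p * (j + 1)) * (π ^ p) ^ (p - (j + 1)) := by
    symm
    refine Finset.sum_nbij (fun j => p * (j + 1) - 1) ?_ ?_ ?_ ?_
    · intro j hj
      rw [Finset.mem_range] at hj
      have e1 : 0 < p * (j + 1) := by have := hp.pos; positivity
      have e2 : p * (j + 1) ≤ p ^ 2 := by rw [pow_two]; gcongr; omega
      simp only [Finset.mem_filter, Finset.mem_range]
      exact ⟨by omega, by rw [Nat.sub_add_cancel e1]; exact Dvd.intro _ rfl⟩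
    · intro i _ j _ hij
      have e1 : 0 < p * (j + 1) := by have := hp.pos; positivity
      have e2 : 0 < p * (i + 1) := by have := hp.pos; positivity
      have e3 : p * (i + 1) = p * (j + 1) := by simp only at hij; omega
      have := Nat.eq_of_mul_eq_mul_left hp.pos e3
      omega
    · intro i hi
      simp only [Finset.coe_filter, Finset.mem_range, Set.mem_ofPred_eq] at hi
      obtain ⟨hi1, k, hk⟩ := hi
      have e1 : 0 < k := by rcases Nat.eq_zero_or_pos k with rfl | h <;> omega
      refine ⟨k - 1, ?_, ?_⟩
      · have : p * k ≤ p * p := by rw [← hk, ← pow_two]; omega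
        have := Nat.le_of_mul_le_mul_left this hp.pos
        simp; omega
      · simp only [Nat.sub_add_cancel e1]; omega
    · intro j hj
      rw [Finset.mem_range] at hj
      have e1 : 0 < p * (j + 1) := by have := hp.pos; positivity
      simp only [hf]
      rw [Nat.sub_add_cancel e1, ← pow_mul, Nat.mul_sub, pow_two]
  have hid : sub p c (π ^ p) - -(c r * π ^ (p ^ 2 - r))
      = -(∑ i ∈ Finset.range (p ^ 2) with ¬ p ∣ i + 1, f i - f (r - 1)) := by
    have e1 := d.root
    rw [← hsplit, hmul] at e1
    have e2 : f (r - 1) = c r * π ^ (p ^ 2 - r) := by simp only [hf]; rw [Nat.sub_add_cancel hr1]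
    rw [e2, sub]
    have e3 : (π ^ p) ^ p = π ^ p ^ 2 := by rw [← pow_mul, pow_two]
    rw [e3]
    linear_combination e1
  unfold Sim
  rw [hid, v.N.map_neg, v.N.map_neg, hN]
  refine v.N_sum_sub_lt _ _ ?_ (by positivity) fun j hj hj' => ?_
  · simp only [Finset.mem_filter, Finset.mem_range]
    rw [Nat.sub_add_cancel hr1]
    refine ⟨by omega, fun h => ?_⟩
    rw [Nat.coprime_comm, hp.coprime_iff_not_dvd] at hr3
    exact hr3 h
  · simp only [Finset.mem_filter, Finset.mem_range] at hj
    have hc : (j + 1).Coprime p := by rw [Nat.coprime_comm, hp.coprime_iff_not_dvd]; exact hj.2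
    simp only [hf]
    rw [map_mul, map_pow]
    rcases lt_or_gt_of_ne (show j + 1 ≠ r by omega) with h | h
    · have e1 := d.low (j + 1) (by omega) h hc
      have e2 : v.N π ^ (p ^ 2 - (j + 1)) < v.N π ^ (p ^ 2 - r) :=
        pow_lt_pow_right_of_lt_one₀ h0 h1 (by omega)
      calc _ ≤ v.N (p : Ω) ^ 2 * v.N π ^ (p ^ 2 - (j + 1)) := by gcongr
        _ < _ := by gcongr
    · have hlt : j + 1 < p ^ 2 := by
        rcases (Nat.succ_le_of_lt hj.1).lt_or_eq with h | h
        · exact h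
        · refine absurd ?_ hj.2
          rw [← Nat.succ_eq_add_one, h, pow_two]
          exact Dvd.intro _ rfl
      have e1 := d.high (j + 1) h hlt hc
      have e2 : v.N (p : Ω) < v.N π ^ (p ^ 2 - r) := by
        rw [← d.N_pow]; exact pow_lt_pow_right_of_lt_one₀ h0 h1 (by omega)
      have e3 : v.N π ^ (p ^ 2 - (j + 1)) ≤ 1 := pow_le_one₀ h0.le h1.le
      calc _ ≤ v.N (p : Ω) ^ 3 * 1 := by gcongr
        _ = v.N (p : Ω) ^ 2 * v.N (p : Ω) := by ring
        _ < _ := by gcongr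

lemma exists_close_root [IsAlgClosed Ω] :
    ∃ η, sub p c η = 0 ∧ v.N (π ^ p - η) < v.N π ^ (2 * p) := by
  obtain ⟨hr1, hr2, hr3, hr4, hr5⟩ := d.r_facts
  have h := v.exists_root_near (P := subPoly p c) (subPoly_monic c) (x := π ^ p)
    (a := v.N π ^ (2 * p)) (pow_nonneg d.pos.le _) (by
      rw [eval_subPoly, natDegree_subPoly, d.sub_pow_sim.N_eq, v.N.map_neg, map_mul, map_pow,
        d.mid, ← d.N_pow, ← pow_mul, ← pow_mul, ← pow_add]
      refine pow_lt_pow_right_of_lt_one₀ d.pos d.lt_one ?_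
      have : 2 * p * p = p ^ 2 * 2 := by ring
      rw [this]; omega)
  simpa only [eval_subPoly] using h

variable {η : Ω}

lemma close_y (h2 : v.N (π ^ p - η) < v.N π ^ (2 * p)) :
    v.N η = v.N π ^ p ∧ η ≠ 0 ∧ v.N (π ^ p / η - 1) < v.N η := by
  have h3 : v.N η = v.N π ^ p := by
    rw [← map_pow, eq_comm]
    apply v.N_eq_of_sub_lt'
    refine h2.trans ?_
    rw [map_pow]
    exact pow_lt_pow_right_of_lt_one₀ d.pos d.lt_one (by have := d.prime.pos; omega)
  have h4 : 0 < v.N η := by rw [h3]; exact pow_pos d.pos _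
  have h5 : η ≠ 0 := (v.N.ne_zero_iff).1 h4.ne'
  refine ⟨h3, h5, ?_⟩
  have : π ^ p / η - 1 = (π ^ p - η) / η := by field_simp
  rw [this, map_div₀, div_lt_iff₀ h4]
  refine h2.trans_le (le_of_eq ?_)
  rw [h3]; ring

lemma close_mem [IsGalois K Ω] (h2 : v.N (π ^ p - η) < v.N π ^ (2 * p)) (h1 : sub p c η = 0)
    {L : IntermediateField K Ω} (hL : π ∈ L) : η ∈ L := by
  obtain ⟨h3, h4, h5⟩ := d.close_y h2
  refine mem_of_fixed L η fun τ hτ => ?_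
  by_contra hne
  have hsub : sub p c (τ η) = 0 := by
    have : τ (sub p c η) = sub p c (τ η) := by
      simp only [sub, map_add, map_sum, map_mul, map_pow]
      congr 1
      refine Finset.sum_congr rfl fun i _ => ?_
      obtain ⟨k, hk⟩ := IntermediateField.mem_bot.1 (d.mem (p * (i + 1)))
      rw [← hk, AlgEquiv.commutes]
    rw [← this, h1, map_zero]
  set y := τ η / η - 1 with hy
  have hyη : η * (1 + y) = τ η := by rw [hy]; field_simp; ring
  have hy0 : y ≠ 0 := by
    intro h; rw [h] at hyη; apply hne; rw [← hyη]; ring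
  have hb : v.N (τ η - η) < v.N π ^ (2 * p) := by
    have : τ η - η = -(τ (π ^ p - η)) + (π ^ p - η) := by
      rw [map_sub, hτ _ (pow_mem hL p)]; ring
    rw [this]
    refine v.N_add_lt ?_ h2
    rw [v.N.map_neg, v.inv]; exact h2
  have h6 : v.N (τ η - η) = v.N η * v.N y := by
    rw [← map_mul, ← hyη]; congr 1; ring
  have hy1 : v.N y ≤ 1 := by
    have e1 : v.N (τ η - η) ≤ v.N η := v.N_sub_le' (v.inv τ η).le le_rfl
    rw [h6] at e1
    exact le_of_mul_le_mul_left (by simpa using e1) (v.N.pos h4)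
  have h7 := (d.N_eq_of_roots (d.N_of_sub_eq_zero h1) hy1 hy0 h1 (by rw [hyη, hsub])).1
  rw [h6, h7, h3, ← pow_add, ← two_mul] at hb
  exact lt_irrefl _ hb

lemma close_tr (h1 : sub p c η = 0) : v.TR ⊥ (adjoin K {η}) p η := by
  choose k hk using fun i => IntermediateField.mem_bot.1 (d.mem i)
  have h := finrank_sup_adjoin_le (K := K) (Ω := Ω) ⊥ (x := η)
    (subPoly p (fun i => (algebraMap K (⊥ : IntermediateField K Ω) (k i)))) (subPoly_monic _) (by
      have : aeval η (subPoly p (fun i => (algebraMap K (⊥ : IntermediateField K Ω) (k i))))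
          = sub p c η := by
        simp only [subPoly, sub, map_add, map_pow, aeval_X, map_sum, map_mul, aeval_C,
          ← IsScalarTower.algebraMap_apply, hk]
      rw [this, h1])
  rw [natDegree_subPoly, bot_sup_eq] at h
  exact ⟨bot_le, h.1, inferInstance, unram_bot, mem_adjoin_simple_self K η, d.prime.pos,
    d.N_of_sub_eq_zero h1, h.2⟩

/-- The leading term of `π ^ p / η - 1`. -/
lemma close_sim (h2 : v.N (π ^ p - η) < v.N π ^ (2 * p)) (h1 : sub p c η = 0) :
    v.Sim ((π ^ p / η - 1) * (c p * η ^ (p - 1))) (c r * π ^ (p ^ 2 - r)) := by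
  obtain ⟨h3, h4, h5⟩ := d.close_y h2
  have hp3 := d.three_le
  have hN := d.N_of_sub_eq_zero h1
  have hη0 := v.N.pos h4
  have hη1 := lt_one_of_pow_eq hN
  set y := π ^ p / η - 1 with hy
  have hyη : η * (1 + y) = π ^ p := by rw [hy]; field_simp; ring
  have hE := d.N_sub_sub_le hN (h5.le.trans hη1.le)
  rw [h1, sub_zero, hyη, max_eq_left h5.le] at hE
  have hS := d.sub_pow_sim
  have hy0 : y ≠ 0 := by
    intro h
    apply hS.ne_zero_left
    rw [← hyη, h, add_zero, mul_one, h1]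
  have hyp := v.N.pos hy0
  have hB : v.N (c p * η ^ (p - 1) * y) = v.N η ^ (2 * p - 1) * v.N y := by
    rw [map_mul, map_mul, map_pow, d.first, ← hN, ← pow_add]; congr 2; omega
  have hA : v.N (η ^ p * y ^ p) < v.N η ^ (2 * p - 1) * v.N y := by
    rw [map_mul, map_pow, map_pow, show 2 * p - 1 = p + (p - 1) by omega, pow_add, mul_assoc,
      show v.N y ^ p = v.N y ^ (p - 1) * v.N y by rw [← pow_succ]; congr 1; omega]
    gcongr
    omega
  have hS2 : v.Sim (sub p c (π ^ p)) (-(c p * η ^ (p - 1) * y)) := by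
    unfold Sim
    rw [v.N.map_neg, hB]
    have : sub p c (π ^ p) - -(c p * η ^ (p - 1) * y)
        = (sub p c (π ^ p) - (η ^ p * y ^ p - c p * η ^ (p - 1) * y)) + η ^ p * y ^ p := by ring
    rw [this]
    refine v.N_add_lt (hE.trans_lt ?_) hA
    exact mul_lt_of_lt_one_right (by positivity) hη1
  have := (hS2.symm.trans hS).neg
  rw [neg_neg, neg_neg] at this
  rwa [mul_comm]

end Eis

end LocalAbs

namespace LocalAbs
variable {p : ℕ} {K Ω : Type*} [Field K] [Field Ω] [Algebra K Ω] {v : LocalAbs p K Ω}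

namespace Eis

variable [Fact p.Prime] {ℓ r : ℕ} {c : ℕ → Ω} {π : Ω} (d : v.Eis ℓ r c π) {η B : Ω}
include d

lemma N_ℓ : v.N (ℓ : Ω) = 1 := by
  apply v.N_nat_eq_one
  rw [Nat.coprime_comm, d.prime.coprime_iff_not_dvd]
  intro h
  have := Nat.le_of_dvd (by have := d.two_le; omega) h
  have := d.lt
  omega

lemma ne_zero_of_N {x : Ω} (h : v.N x = v.N (p : Ω)) : x ≠ 0 :=
  (v.N.ne_zero_iff).1 (by rw [h]; exact v.p_pos.ne')

lemma N_y (h2 : v.N (π ^ p - η) < v.N π ^ (2 * p)) (h1 : sub p c η = 0) :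
    v.N (π ^ p / η - 1) = v.N π ^ ((p - 1) * ℓ) := by
  obtain ⟨hr1, hr2, hr3, hr4, hr5⟩ := d.r_facts
  have h := (d.close_sim h2 h1).N_eq
  have h3 := (d.close_y h2).1
  have hp := d.prime.pos
  have hr0 := d.pos
  rw [map_mul, map_mul, map_mul, map_pow, map_pow, h3, d.first, d.mid, ← d.N_pow, ← pow_mul,
    ← pow_mul, ← pow_add, ← pow_add] at h
  have e1 : v.N π ^ (p ^ 2 * 2 + (p ^ 2 - r))
      = v.N π ^ ((p - 1) * ℓ) * v.N π ^ (p ^ 2 + p * (p - 1)) := by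
    rw [← pow_add]; congr 1
    have : p * (p - 1) + p = p ^ 2 := by
      rw [pow_two, ← Nat.mul_succ]; congr 1; omega
    omega
  rw [e1] at h
  exact mul_right_cancel₀ (pow_ne_zero _ hr0.ne') h

lemma approx_zero (h2 : v.N (π ^ p - η) < v.N π ^ (2 * p)) (h1 : sub p c η = 0)
    (hB1 : v.N B = 1) (hB : v.Sim (B ^ (p - 1) * ℓ * c r) (c p * c (p ^ 2))) :
    v.N ((B * π ^ (-(ℓ : ℤ))) ^ p - B * π ^ (-(ℓ : ℤ)) - B ^ p * η ^ (-(ℓ : ℤ)))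
      < v.N π ^ (-(ℓ : ℤ)) := by
  obtain ⟨hr1, hr2, hr3, hr4, hr5⟩ := d.r_facts
  obtain ⟨hη, hη0, hy⟩ := d.close_y h2
  have hN := d.N_of_sub_eq_zero h1
  have hη1 := lt_one_of_pow_eq hN
  have hp := d.prime.pos
  have hcp := ne_zero_of_N d d.first
  have hcl := ne_zero_of_N d d.last
  have hB0 : B ≠ 0 := (v.N.ne_zero_iff).1 (by rw [hB1]; exact one_ne_zero)
  have hπ0 := d.π_ne
  have hℓ0 : (ℓ : Ω) ≠ 0 := (v.N.ne_zero_iff).1 (by rw [d.N_ℓ]; exact one_ne_zero)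
  have S2 := d.close_sim h2 h1
  set y := π ^ p / η - 1 with hyd
  have hyη : π ^ p = η * (1 + y) := by rw [hyd]; field_simp; ring
  have hy0 : y ≠ 0 := left_ne_zero_of_mul S2.ne_zero_left
  have S1 : v.Sim ((1 + y) ^ (-(ℓ : ℤ)) - 1) (-(ℓ * y)) := by
    unfold Sim
    have := N_one_add_zpow_le (v := v) (-(ℓ : ℤ)) (hy.trans hη1)
    push_cast at this
    rw [neg_mul] at this
    refine this.trans_lt ?_
    rw [v.N.map_neg, map_mul, d.N_ℓ, one_mul, pow_two]
    exact mul_lt_of_lt_one_left (v.N.pos hy0) (hy.trans hη1)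
  have S4 := d.sub_eq_zero_sim hN h1
  have S5 : v.Sim (π ^ p) η := (Sim.iff_div hη0).2 (hy.trans hη1)
  have T1 : v.Sim (B ^ p * η ^ (-(ℓ : ℤ)) * ((1 + y) ^ (-(ℓ : ℤ)) - 1))
      (B ^ p * η ^ (-(ℓ : ℤ)) * -(ℓ * y)) :=
    S1.mul_left (mul_ne_zero (pow_ne_zero _ hB0) (zpow_ne_zero _ hη0))
  have T2 : v.Sim (B ^ p * η ^ (-(ℓ : ℤ)) * -(ℓ * y))
      (B * η ^ (-(ℓ : ℤ)) * π ^ (p ^ 2 - r) / η ^ (p - 1) / c p * -(B ^ (p - 1) * ℓ * c r)) := by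
    have := S2.mul_left (z := -(B ^ p * η ^ (-(ℓ : ℤ)) * ℓ / (c p * η ^ (p - 1))))
      (neg_ne_zero.2 (div_ne_zero (mul_ne_zero (mul_ne_zero (pow_ne_zero _ hB0)
        (zpow_ne_zero _ hη0)) hℓ0) (mul_ne_zero hcp (pow_ne_zero _ hη0))))
    have hBp : B ^ p = B ^ (p - 1) * B := by rw [← pow_succ]; congr 1; omega
    convert this using 1
    · field_simp
    · rw [hBp]; field_simp
  have T3 : v.Sim (B * η ^ (-(ℓ : ℤ)) * π ^ (p ^ 2 - r) / η ^ (p - 1) / c p *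
      -(B ^ (p - 1) * ℓ * c r))
      (B * η ^ (-(ℓ : ℤ)) * π ^ (p ^ 2 - r) / η ^ (p - 1) * -c (p ^ 2)) := by
    have := hB.neg.mul_left (z := B * η ^ (-(ℓ : ℤ)) * π ^ (p ^ 2 - r) / η ^ (p - 1) / c p)
      (div_ne_zero (div_ne_zero (mul_ne_zero (mul_ne_zero hB0 (zpow_ne_zero _ hη0))
        (pow_ne_zero _ hπ0)) (pow_ne_zero _ hη0)) hcp)
    convert this using 1
    field_simp
  have T4 : v.Sim (B * η ^ (-(ℓ : ℤ)) * π ^ (p ^ 2 - r) / η ^ (p - 1) * -c (p ^ 2))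
      (B * π ^ (p ^ 2 - r) * η ^ (1 - (ℓ : ℤ))) := by
    have := S4.symm.mul_left (z := B * η ^ (-(ℓ : ℤ)) * π ^ (p ^ 2 - r) / η ^ (p - 1))
      (div_ne_zero (mul_ne_zero (mul_ne_zero hB0 (zpow_ne_zero _ hη0))
        (pow_ne_zero _ hπ0)) (pow_ne_zero _ hη0))
    convert this using 1
    have hηp : η ^ p = η ^ (p - 1) * η := by rw [← pow_succ]; congr 1; omega
    rw [hηp, sub_eq_neg_add, zpow_add₀ hη0, zpow_one]
    field_simp
  have T5 : v.Sim (B * π ^ (p ^ 2 - r) * η ^ (1 - (ℓ : ℤ))) (B * π ^ (-(ℓ : ℤ))) := by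
    have := (S5.symm.zpow (1 - (ℓ : ℤ))).mul_left (z := B * π ^ (p ^ 2 - r))
      (mul_ne_zero hB0 (pow_ne_zero _ hπ0))
    convert this using 1
    rw [mul_assoc]
    congr 1
    rw [← zpow_natCast π p, ← zpow_mul, ← zpow_natCast, ← zpow_add₀ hπ0]
    congr 1
    have e1 : (((p ^ 2 - r : ℕ) : ℤ)) + p = (p - 1) * ℓ := by
      have : ((p ^ 2 - r + p : ℕ) : ℤ) = (((p - 1) * ℓ : ℕ) : ℤ) := by rw [hr4]
      rw [Nat.cast_add, Nat.cast_mul, Nat.cast_sub hp] at this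
      simpa using this
    linear_combination -e1
  have T := T1.trans (T2.trans (T3.trans (T4.trans T5)))
  unfold Sim at T
  rw [map_mul, hB1, one_mul, map_zpow₀] at T
  convert T using 2
  rw [mul_pow, ← zpow_natCast (π ^ _), ← zpow_mul, mul_comm (-(ℓ : ℤ)), zpow_mul, zpow_natCast,
    hyη, mul_zpow]
  ring

variable {L : IntermediateField K Ω}

lemma le_of_lt_zpow (hL : v.TR ⊥ L (p ^ 2) π) {x : Ω} (hx : x ∈ L) {k : ℤ}
    (h : v.N x < v.N π ^ k) : v.N x ≤ v.N π ^ (k + 1) := by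
  by_cases hx0 : x = 0
  · rw [hx0, map_zero]; exact zpow_nonneg d.pos.le _
  obtain ⟨m, hm⟩ := hL.value hx hx0
  rw [hm] at h ⊢
  have := (zpow_lt_zpow_iff_right_of_lt_one₀ d.pos d.lt_one).1 h
  exact (zpow_le_zpow_iff_right_of_lt_one₀ d.pos d.lt_one).2 this

lemma sm_of_le {x : Ω} {k : ℕ} (hk : k < p) (h : v.N x ≤ v.N π ^ (-(k : ℤ))) : v.Sm x := by
  have h0 := d.pos
  refine lt_of_le_of_lt (mul_le_mul_of_nonneg_left (pow_le_pow_left₀ (v.N.nonneg x) h p)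
    v.p_pos.le) ?_
  rw [← d.N_pow, ← zpow_natCast, ← zpow_natCast, ← zpow_mul, ← zpow_add₀ h0.ne']
  refine zpow_lt_one₀ h0 d.lt_one ?_
  push_cast
  have : (k : ℤ) < p := by exact_mod_cast hk
  have h2 : (0 : ℤ) < p := by exact_mod_cast d.prime.pos
  nlinarith

lemma exists_reduce (h2 : v.N (π ^ p - η) < v.N π ^ (2 * p)) (h1 : sub p c η = 0)
    (hL : v.TR ⊥ L (p ^ 2) π) (hηL : η ∈ L) (k : ℕ) (hk : k < ℓ) :
    ∀ ρ ∈ L, v.N ρ ≤ v.N π ^ (-(k : ℤ)) → ∃ μ ∈ L, ∃ y ∈ adjoin K {η},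
      v.N μ ≤ v.N π ^ (-(k : ℤ)) ∧ v.N y ≤ v.N π ^ (-(p * k : ℤ)) ∧
      v.N (μ ^ p - μ - y + ρ) < 1 := by
  obtain ⟨hη, hη0, hy⟩ := d.close_y h2
  have hN := d.N_of_sub_eq_zero h1
  have hη1 := lt_one_of_pow_eq hN
  have h0 := d.pos
  have hlt := d.lt_one
  have hp := d.prime.pos
  induction k with
  | zero =>
    intro ρ hρ hρ1
    obtain ⟨e, he, hρe⟩ := hL.residue hρ (by simpa using hρ1)
    refine ⟨0, zero_mem _, e, (bot_le : ⊥ ≤ adjoin K {η}) he, by simp, ?_, ?_⟩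
    · simp only [CharP.cast_eq_zero, mul_zero, neg_zero, zpow_zero]
      have : e = ρ - (ρ - e) := by ring
      rw [this]
      exact v.N_sub_le' (by simpa using hρ1) hρe.le
    · have : (0 : Ω) ^ p - 0 - e + ρ = ρ - e := by rw [zero_pow hp.ne']; ring
      rwa [this]
  | succ k ih =>
    intro ρ hρ hρ1
    have hkp : k + 1 < p := hk.trans d.lt
    have hπL := hL.mem
    have hπ0 := d.π_ne
    obtain ⟨e, he, hρe⟩ := hL.residue (x := ρ * π ^ (k + 1)) (L.mul_mem hρ (pow_mem hπL _)) (by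
      rw [map_mul, map_pow]
      calc _ ≤ v.N π ^ (-((k + 1 : ℕ) : ℤ)) * v.N π ^ (k + 1) := by gcongr
        _ = 1 := by rw [zpow_neg, zpow_natCast]; exact inv_mul_cancel₀ (by positivity))
    have heL : e ∈ L := (bot_le : ⊥ ≤ L) he
    have heF : e ∈ adjoin K {η} := (bot_le : ⊥ ≤ adjoin K {η}) he
    have hηF := mem_adjoin_simple_self K η
    have he1 : v.N e ≤ 1 := by
      have : e = ρ * π ^ (k + 1) - (ρ * π ^ (k + 1) - e) := by ring
      rw [this]
      refine v.N_sub_le' ?_ hρe.le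
      rw [map_mul, map_pow]
      calc _ ≤ v.N π ^ (-((k + 1 : ℕ) : ℤ)) * v.N π ^ (k + 1) := by gcongr
        _ = 1 := by rw [zpow_neg, zpow_natCast]; exact inv_mul_cancel₀ (by positivity)
    set n : ℤ := -((k + 1 : ℕ) : ℤ) with hn
    set μ₁ := e * π ^ n with hμ₁
    set y₁ := e ^ p * η ^ n with hy₁
    have hμ₁L : μ₁ ∈ L := L.mul_mem heL (zpow_mem hπL n)
    have hy₁F : y₁ ∈ adjoin K {η} := mul_mem (pow_mem heF p) (zpow_mem hηF n)
    have hμ₁N : v.N μ₁ ≤ v.N π ^ n := by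
      rw [hμ₁, map_mul, map_zpow₀]
      exact mul_le_of_le_one_left (by positivity) he1
    have hy₁N : v.N y₁ ≤ v.N π ^ (-(p * (k + 1 : ℕ) : ℤ)) := by
      rw [hy₁, map_mul, map_zpow₀, map_pow, hη, ← zpow_natCast (v.N π) p, ← zpow_mul,
        ← mul_neg]
      exact mul_le_of_le_one_left (by positivity) (pow_le_one₀ (v.N.nonneg _) he1)
    have hNy := d.N_y h2 h1
    set z := π ^ p / η - 1 with hz
    have hzη : π ^ p = η * (1 + z) := by rw [hz]; field_simp; ring
    have hz1 : v.N z < 1 := hy.trans hη1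
    have hstep : v.N (μ₁ ^ p - μ₁ - y₁ + ρ) < v.N π ^ n := by
      have hid : μ₁ ^ p - μ₁ - y₁ + ρ
          = e ^ p * η ^ n * ((1 + z) ^ n - 1) + (ρ * π ^ (k + 1) - e) * π ^ n := by
        have e1 : π ^ (k + 1) * π ^ n = 1 := by
          rw [hn, zpow_neg, zpow_natCast]; exact mul_inv_cancel₀ (pow_ne_zero _ hπ0)
        rw [hμ₁, hy₁, mul_pow, ← zpow_natCast (π ^ n), ← zpow_mul, mul_comm n, zpow_mul,
          zpow_natCast, hzη, mul_zpow]
        linear_combination (-ρ) * e1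
      rw [hid]
      refine v.N_add_lt ?_ ?_
      · have e2 : v.N ((1 + z) ^ n - 1) ≤ v.N z := by
          have : (1 + z) ^ n - 1 = ((1 + z) ^ n - 1 - n * z) + n * z := by ring
          rw [this]
          refine v.N_add_le ((N_one_add_zpow_le n hz1).trans ?_) ?_
          · rw [pow_two]; exact mul_le_of_le_one_left (v.N.nonneg z) hz1.le
          · rw [map_mul]; exact mul_le_of_le_one_left (v.N.nonneg z) (v.N_int_le n)
        rw [map_mul]
        have e3 : v.N (e ^ p * η ^ n) ≤ v.N π ^ (p * n : ℤ) := by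
          rw [map_mul, map_zpow₀, map_pow, hη, ← zpow_natCast (v.N π) p, ← zpow_mul]
          exact mul_le_of_le_one_left (by positivity) (pow_le_one₀ (v.N.nonneg _) he1)
        calc _ ≤ v.N π ^ (p * n : ℤ) * v.N π ^ (((p - 1) * ℓ : ℕ) : ℤ) := by
              rw [zpow_natCast, ← hNy]; gcongr
          _ = v.N π ^ (p * n + ((p - 1) * ℓ : ℕ) : ℤ) := by rw [zpow_add₀ h0.ne']
          _ < _ := by
            refine zpow_lt_zpow_right_of_lt_one₀ h0 hlt ?_
            rw [hn]
            rw [Nat.cast_mul, Nat.cast_sub hp]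
            push_cast
            have e4 : (k : ℤ) + 1 < ℓ := by exact_mod_cast hk
            have e5 : (1 : ℤ) < p := by exact_mod_cast d.prime.one_lt
            nlinarith
      · rw [map_mul, map_zpow₀]
        exact mul_lt_of_lt_one_left (by positivity) hρe
    have hρ'L : μ₁ ^ p - μ₁ - y₁ + ρ ∈ L := by
      refine L.add_mem (L.sub_mem (L.sub_mem (pow_mem hμ₁L p) hμ₁L) ?_) hρ
      exact L.mul_mem (pow_mem heL p) (zpow_mem hηL n)
    have hstep' := d.le_of_lt_zpow hL hρ'L hstep
    have hn1 : n + 1 = -(k : ℤ) := by rw [hn]; push_cast; ring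
    rw [hn1] at hstep'
    obtain ⟨μ₂, hμ₂L, y₂, hy₂F, hμ₂N, hy₂N, h₂⟩ := ih (by omega) _ hρ'L hstep'
    refine ⟨μ₁ + μ₂, L.add_mem hμ₁L hμ₂L, y₁ + y₂, add_mem hy₁F hy₂F, ?_, ?_, ?_⟩
    · refine v.N_add_le hμ₁N (hμ₂N.trans ?_)
      exact (zpow_le_zpow_iff_right_of_lt_one₀ h0 hlt).2 (by omega)
    · refine v.N_add_le hy₁N (hy₂N.trans ?_)
      refine (zpow_le_zpow_iff_right_of_lt_one₀ h0 hlt).2 ?_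
      push_cast
      nlinarith
    · have e1 : (μ₁ + μ₂) ^ p - (μ₁ + μ₂) - (y₁ + y₂) + ρ
          = ((μ₁ + μ₂) ^ p - (μ₁ ^ p + μ₂ ^ p))
            + (μ₂ ^ p - μ₂ - y₂ + (μ₁ ^ p - μ₁ - y₁ + ρ)) := by ring
      rw [e1]
      exact v.N_add_lt (N_add_pow_sub_lt (d.sm_of_le hkp hμ₁N)
        (d.sm_of_le (by omega) hμ₂N)) h₂

lemma exists_lam [IsGalois K Ω] [IsAlgClosed Ω] (h2 : v.N (π ^ p - η) < v.N π ^ (2 * p))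
    (h1 : sub p c η = 0) (hL : v.TR ⊥ L (p ^ 2) π) (hBK : B ∈ (⊥ : IntermediateField K Ω))
    (hB1 : v.N B = 1) (hB : v.Sim (B ^ (p - 1) * ℓ * c r) (c p * c (p ^ 2))) :
    ∃ α ∈ adjoin K {η}, ∃ lam ∈ L, lam ^ p - lam = α ∧ v.N lam = v.N π ^ (-(ℓ : ℤ)) ∧
      v.N (α - B ^ p * η ^ (-(ℓ : ℤ))) ≤ v.N η ^ (-(ℓ - 1 : ℤ)) := by
  have h0 := d.pos
  have hlt := d.lt_one
  have hη := (d.close_y h2).1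
  have hηL := d.close_mem h2 h1 hL.mem
  have hηF := mem_adjoin_simple_self K η
  have hBL : B ∈ L := (bot_le : ⊥ ≤ L) hBK
  have hBF : B ∈ adjoin K {η} := (bot_le : ⊥ ≤ adjoin K {η}) hBK
  have hℓ1 : ((ℓ - 1 : ℕ) : ℤ) = ℓ - 1 := by rw [Nat.cast_sub (by have := d.two_le; omega)]; simp
  have hA := d.approx_zero h2 h1 hB1 hB
  set lam₀ := B * π ^ (-(ℓ : ℤ)) with hlam₀
  have hlam₀L : lam₀ ∈ L := L.mul_mem hBL (zpow_mem hL.mem _)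
  have hlam₀N : v.N lam₀ = v.N π ^ (-(ℓ : ℤ)) := by rw [hlam₀, map_mul, hB1, one_mul, map_zpow₀]
  have hρL : lam₀ ^ p - lam₀ - B ^ p * η ^ (-(ℓ : ℤ)) ∈ L :=
    L.sub_mem (L.sub_mem (pow_mem hlam₀L p) hlam₀L) (L.mul_mem (pow_mem hBL p) (zpow_mem hηL _))
  have hA' := d.le_of_lt_zpow hL hρL hA
  rw [show -(ℓ : ℤ) + 1 = -((ℓ - 1 : ℕ) : ℤ) by rw [hℓ1]; ring] at hA'
  obtain ⟨μ, hμL, y, hyF, hμN, hyN, hμy⟩ := d.exists_reduce h2 h1 hL hηL (ℓ - 1)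
    (by have := d.two_le; omega) _ hρL hA'
  have hμlt : v.N μ < v.N π ^ (-(ℓ : ℤ)) :=
    hμN.trans_lt (zpow_lt_zpow_right_of_lt_one₀ h0 hlt (by omega))
  have hNs : v.N (lam₀ + μ) = v.N π ^ (-(ℓ : ℤ)) := by
    rw [← hlam₀N]; apply v.N_eq_of_sub_lt; rw [add_sub_cancel_left, hlam₀N]; exact hμlt
  have hαL : B ^ p * η ^ (-(ℓ : ℤ)) + y ∈ adjoin K {η} :=
    add_mem (mul_mem (pow_mem hBF p) (zpow_mem hηF _)) hyF
  have hFL : adjoin K {η} ≤ L := by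
    rw [adjoin_le_iff]; simpa using hηL
  obtain ⟨lam, hlamL, hwp, hq⟩ := exists_wp_eq L (L.add_mem hlam₀L hμL) (hFL hαL)
    (d.sm_of_le d.lt hNs.le) (by
      rw [q_eq_iff]
      have e1 : (lam₀ + μ) ^ p - (lam₀ + μ) - (B ^ p * η ^ (-(ℓ : ℤ)) + y)
          = ((lam₀ + μ) ^ p - (lam₀ ^ p + μ ^ p))
            + (μ ^ p - μ - y + (lam₀ ^ p - lam₀ - B ^ p * η ^ (-(ℓ : ℤ)))) := by ring
      rw [e1]
      refine v.N_add_lt (N_add_pow_sub_lt (d.sm_of_le d.lt hlam₀N.le) ?_) hμy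
      exact d.sm_of_le d.lt hμlt.le)
  refine ⟨_, hαL, lam, hlamL, hwp, ?_, ?_⟩
  · rw [← hNs]
    apply v.N_eq_of_sub_lt
    rw [q_eq_iff] at hq
    refine hq.trans ?_
    rw [hNs]
    exact one_lt_zpow_of_neg₀ h0 hlt (by have := d.two_le; omega)
  · rw [add_sub_cancel_left]
    refine hyN.trans (le_of_eq ?_)
    rw [hη, ← zpow_natCast, ← zpow_mul, hℓ1]
    congr 1; ring

lemma le_of_lam_mem (hη : v.N η = v.N π ^ p) (hL : v.TR ⊥ L (p ^ 2) π) (hηL : η ∈ L)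
    {lam : Ω} (hlam : lam ∈ L) (hN : v.N lam = v.N π ^ (-(ℓ : ℤ))) {E : IntermediateField K Ω}
    (hE : η ∈ E) (hE' : lam ∈ E) : L ≤ E := by
  have h0 := d.pos
  have := hL.fd
  have hcop : IsCoprime (p : ℤ) (ℓ : ℤ) := by
    rw [Nat.isCoprime_iff_coprime, d.prime.coprime_iff_not_dvd]
    intro h
    have := Nat.le_of_dvd (by have := d.two_le; omega) h
    have := d.lt
    omega
  obtain ⟨a, b, hab⟩ := hcop
  have hfin : FiniteDimensional K (E ⊓ L : IntermediateField K Ω) :=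
    FiniteDimensional.of_injective
      (IntermediateField.inclusion (inf_le_right : E ⊓ L ≤ L)).toLinearMap
      (IntermediateField.inclusion_injective (inf_le_right : E ⊓ L ≤ L))
  have h := mul_finrank_le (v := v) (W := ⊥) (E := E ⊓ L) bot_le unram_bot
    (θ := η ^ a * lam ^ (-b))
    (mul_mem (zpow_mem (show η ∈ E ⊓ L from ⟨hE, hηL⟩) a)
      (zpow_mem (show lam ∈ E ⊓ L from ⟨hE', hlam⟩) (-b)))
    (n := p ^ 2) hL.pos (by
      rw [← d.N_pow, map_mul, map_zpow₀, map_zpow₀, hη, hN, ← zpow_natCast (v.N π) p, ← zpow_mul,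
        ← zpow_mul, ← zpow_add₀ h0.ne']
      have : (p : ℤ) * a + -(ℓ : ℤ) * -b = 1 := by linear_combination hab
      rw [this, zpow_one])
  rw [← hL.finrank_eq] at h
  have := IntermediateField.eq_of_le_of_finrank_le (inf_le_right : E ⊓ L ≤ L) h
  exact inf_eq_right.1 this

end Eis

end LocalAbs

namespace LocalAbs
variable {p : ℕ} {K Ω : Type*} [Field K] [Field Ω] [Algebra K Ω] {v : LocalAbs p K Ω}

lemma map_bot_eq (τ : Ω ≃ₐ[K] Ω) {x : Ω} (hx : x ∈ (⊥ : IntermediateField K Ω)) : τ x = x := by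
  obtain ⟨k, rfl⟩ := IntermediateField.mem_bot.1 hx
  exact τ.commutes k

section Ramified

variable {F : IntermediateField K Ω} {η : Ω} {n : ℕ} {g : Ω ≃ₐ[K] Ω}

lemma TR.le_of_lt_zpow (h : v.TR ⊥ F n η) {x : Ω} (hx : x ∈ F) {k : ℤ}
    (hk : v.N x < v.N η ^ k) : v.N x ≤ v.N η ^ (k + 1) := by
  have h0 := pos_of_pow_eq h.pos h.val
  have h1 := lt_one_of_pow_eq h.val
  by_cases hx0 : x = 0
  · rw [hx0, map_zero]; exact zpow_nonneg h0.le _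
  obtain ⟨m, hm⟩ := h.value hx hx0
  rw [hm] at hk ⊢
  have := (zpow_lt_zpow_iff_right_of_lt_one₀ h0 h1).1 hk
  exact (zpow_le_zpow_iff_right_of_lt_one₀ h0 h1).2 this

lemma TR.N_D_le (h : v.TR ⊥ F n η) (hz : v.N (g η / η - 1) ≤ v.N η) {x : Ω} (hx : x ∈ F) :
    v.N (D g x) ≤ v.N η * v.N x := by
  have h0 := pos_of_pow_eq h.pos h.val
  have h1 := lt_one_of_pow_eq h.val
  have hη0 : η ≠ 0 := (v.N.ne_zero_iff).1 h0.ne'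
  obtain ⟨w, hw, rfl⟩ := h.exists_sum hx
  by_cases hw0 : w = 0
  · subst hw0; simp
  obtain ⟨i, -, hi1, hi2⟩ := N_sum_pow_mul h.pos h.val w (fun i hi => h.unram _ (hw i) hi) hw0
  rw [hi1, map_sum]
  refine v.N_sum_le _ _ (by have := v.N.nonneg (η ^ (i : ℕ) * w i); positivity) fun j _ => ?_
  have hgη : g η = η * (1 + (g η / η - 1)) := by field_simp; ring
  have e1 : D g (η ^ (j : ℕ) * w j)
      = ((1 + (g η / η - 1)) ^ (j : ℕ) - 1) * (η ^ (j : ℕ) * w j) := by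
    rw [D_apply, map_mul, map_pow, map_bot_eq g (hw j)]
    conv_lhs => rw [hgη]
    rw [mul_pow]; ring
  rw [e1, map_mul]
  exact mul_le_mul ((N_one_add_pow_sub_one_le _ (hz.trans h1.le)).trans hz) (hi2 j)
    (v.N.nonneg _) h0.le

lemma N_D_zpow_sub_le (h0 : 0 < v.N η) (h1 : v.N η < 1) (hz : v.N (g η / η - 1) ≤ v.N η)
    {γ b : Ω} (hγ : v.N ((g η / η - 1) / η - γ) ≤ v.N η)
    (hb : b ∈ (⊥ : IntermediateField K Ω)) (hb1 : v.N b ≤ 1) (e : ℤ) :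
    v.N (D g (b * η ^ e) - e * b * γ * η ^ (e + 1)) ≤ v.N η ^ (e + 2) := by
  have hη0 : η ≠ 0 := (v.N.ne_zero_iff).1 h0.ne'
  set z := g η / η - 1 with hzd
  have hgη : g η = η * (1 + z) := by rw [hzd]; field_simp; ring
  have hid : D g (b * η ^ e) - e * b * γ * η ^ (e + 1)
      = b * η ^ e * ((1 + z) ^ e - 1 - e * z) + b * e * η ^ (e + 1) * (z / η - γ) := by
    rw [D_apply, map_mul, map_zpow₀, map_bot_eq g hb, hgη, mul_zpow, zpow_add₀ hη0, zpow_one]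
    field_simp
    ring
  rw [hid]
  refine v.N_add_le ?_ ?_
  · rw [map_mul, map_mul, map_zpow₀, zpow_add₀ h0.ne']
    have e1 := N_one_add_zpow_le (v := v) e (hz.trans_lt h1)
    have e2 : v.N z ^ 2 ≤ v.N η ^ 2 := pow_le_pow_left₀ (v.N.nonneg _) hz 2
    have e3 : v.N η ^ (2 : ℤ) = v.N η ^ 2 := by norm_cast
    rw [e3]
    refine mul_le_mul ?_ (e1.trans e2) (v.N.nonneg _) (by positivity)
    exact mul_le_of_le_one_left (by positivity) hb1
  · rw [map_mul, map_mul, map_mul, map_zpow₀, show e + 2 = e + 1 + 1 by ring,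
      zpow_add₀ h0.ne' (e + 1), zpow_one]
    refine mul_le_mul ?_ hγ (v.N.nonneg _) (by positivity)
    refine mul_le_of_le_one_left (by positivity) ?_
    exact mul_le_one₀ hb1 (v.N.nonneg _) (v.N_int_le e)

lemma TR.N_D_pow_sub_le (h : v.TR ⊥ F n η) (hF : ∀ x ∈ F, g x ∈ F)
    (hz : v.N (g η / η - 1) ≤ v.N η)
    {γ b α : Ω} (hγ : v.N ((g η / η - 1) / η - γ) ≤ v.N η)
    (hγ0 : γ ∈ (⊥ : IntermediateField K Ω)) (hγ1 : v.N γ ≤ 1)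
    (hb : b ∈ (⊥ : IntermediateField K Ω)) (hb1 : v.N b ≤ 1) (hα : α ∈ F) {ℓ : ℕ}
    (hαb : v.N (α - b * η ^ (-(ℓ : ℤ))) ≤ v.N η ^ (-(ℓ - 1 : ℤ))) (i : ℕ) :
    v.N ((D g ^ i) α - b * γ ^ i * (∏ j ∈ Finset.range i, ((j : ℤ) - ℓ) : ℤ) * η ^ (i - ℓ : ℤ))
      ≤ v.N η ^ (i - ℓ + 1 : ℤ) := by
  have h0 := pos_of_pow_eq h.pos h.val
  have h1 := lt_one_of_pow_eq h.val
  induction i with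
  | zero =>
    simp only [pow_zero, mul_one, Finset.range_zero, Finset.prod_empty, Int.cast_one,
      CharP.cast_eq_zero, zero_sub, Module.End.one_apply]
    convert hαb using 2
    ring
  | succ i ih =>
    set s : Ω := b * γ ^ i * (∏ j ∈ Finset.range i, ((j : ℤ) - ℓ) : ℤ) with hs
    have hsb : s ∈ (⊥ : IntermediateField K Ω) :=
      mul_mem (mul_mem hb (pow_mem hγ0 i)) (intCast_mem _ _)
    have hs1 : v.N s ≤ 1 := by
      rw [hs, map_mul, map_mul, map_pow]
      exact mul_le_one₀ (mul_le_one₀ hb1 (by have := v.N.nonneg γ; positivity)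
        (pow_le_one₀ (v.N.nonneg _) hγ1)) (v.N.nonneg _) (v.N_int_le _)
    have e1 : (D g ^ (i + 1)) α - b * γ ^ (i + 1) *
        (∏ j ∈ Finset.range (i + 1), ((j : ℤ) - ℓ) : ℤ) * η ^ ((i + 1 : ℕ) - ℓ : ℤ)
        = D g ((D g ^ i) α - s * η ^ (i - ℓ : ℤ))
          + (D g (s * η ^ (i - ℓ : ℤ)) - (i - ℓ : ℤ) * s * γ * η ^ ((i - ℓ : ℤ) + 1)) := by
      rw [D_pow_succ, map_sub, Finset.prod_range_succ, hs]
      have : (((i + 1 : ℕ) : ℤ) - ℓ) = (i - ℓ : ℤ) + 1 := by push_cast; ring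
      rw [this]
      push_cast
      ring
    have e2 : (((i + 1 : ℕ) : ℤ) - ℓ + 1) = (i - ℓ : ℤ) + 2 := by push_cast; ring
    rw [e1, e2]
    refine v.N_add_le ?_ (N_D_zpow_sub_le h0 h1 hz hγ hsb hs1 _)
    refine (h.N_D_le hz (F.sub_mem (D_pow_mem hF hα i)
      (F.mul_mem ((bot_le : ⊥ ≤ F) hsb) (zpow_mem h.mem _)))).trans ?_
    refine (mul_le_mul_of_nonneg_left ih h0.le).trans (le_of_eq ?_)
    rw [← zpow_one_add₀ h0.ne']
    congr 1; ring

end Ramified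

lemma prod_sub_coprime {ℓ : ℕ} [Fact p.Prime] (hℓ : ℓ < p) {i : ℕ} (hi : i ≤ ℓ) :
    IsCoprime (∏ j ∈ Finset.range i, ((j : ℤ) - ℓ)) (p : ℤ) := by
  refine IsCoprime.prod_left fun j hj => ?_
  rw [Finset.mem_range] at hj
  have e1 : (j : ℤ) - ℓ = -((ℓ - j : ℕ) : ℤ) := by rw [Nat.cast_sub (by omega)]; ring
  rw [e1, IsCoprime.neg_left_iff, Nat.isCoprime_iff_coprime, Nat.coprime_comm,
    (Fact.out : p.Prime).coprime_iff_not_dvd]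
  intro h
  have := Nat.le_of_dvd (by omega) h
  omega

lemma prod_sub_eq_zero {ℓ : ℕ} : (∏ j ∈ Finset.range (ℓ + 1), ((j : ℤ) - ℓ)) = 0 :=
  Finset.prod_eq_zero (i := ℓ) (by simp) (by simp)

namespace Eis

variable [Fact p.Prime] {ℓ r : ℕ} {c : ℕ → Ω} {π : Ω} (d : v.Eis ℓ r c π) {η B : Ω}
include d

lemma sub_map_eq_zero (h1 : sub p c η = 0) (τ : Ω ≃ₐ[K] Ω) : sub p c (τ η) = 0 := by
  have : τ (sub p c η) = sub p c (τ η) := by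
    simp only [sub, map_add, map_sum, map_mul, map_pow]
    congr 1
    exact Finset.sum_congr rfl fun i _ => by rw [map_bot_eq τ (d.mem (p * (i + 1)))]
  rw [← this, h1, map_zero]

lemma map_root (h1 : sub p c η = 0) {g : Ω ≃ₐ[K] Ω} (hg : g η ≠ η) :
    v.N (g η / η - 1) = v.N η ∧ v.N (((g η / η - 1) / η) ^ (p - 1) - c p / η ^ p) < 1 := by
  have hN := d.N_of_sub_eq_zero h1
  have h0 := pos_of_pow_eq d.prime.pos hN
  have hη0 : η ≠ 0 := (v.N.ne_zero_iff).1 h0.ne'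
  have hyη : η * (1 + (g η / η - 1)) = g η := by field_simp; ring
  refine d.N_eq_of_roots hN ?_ ?_ h1 (by rw [hyη]; exact d.sub_map_eq_zero h1 g)
  · refine v.N_sub_le' ?_ (by simp)
    rw [map_div₀, v.inv, div_self h0.ne']
  · rw [sub_ne_zero]
    intro h
    exact hg ((div_eq_one_iff_eq hη0).1 h)

theorem exists_datum [IsGalois K Ω] [IsAlgClosed Ω] {F L M : IntermediateField K Ω}
    (hL : v.TR ⊥ L (p ^ 2) π) (hBK : B ∈ (⊥ : IntermediateField K Ω))
    (hB1 : v.N B = 1) (hB : v.Sim (B ^ (p - 1) * ℓ * c r) (c p * c (p ^ 2)))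
    (hF : ∀ E ≤ L, Module.finrank K E = p → E = F)
    (hFn : ∀ τ : Ω ≃ₐ[K] Ω, ∀ x ∈ F, τ x ∈ F)
    (hMn : ∀ τ : Ω ≃ₐ[K] Ω, ∀ x ∈ M, τ x ∈ M) (hMfd : FiniteDimensional K M) (hLM : L ≤ M)
    (hMmin : ∀ E : IntermediateField K Ω, (∀ τ : Ω ≃ₐ[K] Ω, ∀ x ∈ L, τ x ∈ E) → M ≤ E) :
    ∃ η α lam, v.TR ⊥ F p η ∧ ∀ g : Ω ≃ₐ[K] Ω, (¬ ∀ x ∈ F, g x = x) →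
      (∀ τ : Ω ≃ₐ[K] Ω, ∃ m : ℕ, ∀ x ∈ F, τ x = (g ^ m) x) →
      Datum v ℓ F M η α lam g ∧ ∃ γ ∈ (⊥ : IntermediateField K Ω), ∃ e : ℤ, IsCoprime e (p : ℤ) ∧
        v.N γ = 1 ∧ v.N (γ ^ (p - 1) + c p / c (p ^ 2)) < 1 ∧
        v.N ((D g ^ ℓ) α - B ^ p * γ ^ ℓ * e) < 1 := by
  obtain ⟨η, h1, h2⟩ := d.exists_close_root
  have htr := d.close_tr h1
  have hηL := d.close_mem h2 h1 hL.mem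
  have hFL : adjoin K {η} ≤ L := by
    rw [adjoin_le_iff]; simpa using hηL
  have hFeq : adjoin K {η} = F := hF _ hFL (by rw [htr.finrank_eq]; simp)
  obtain ⟨α, hαF, lam, hlamL, hwp, hlamN, hαN⟩ := d.exists_lam h2 h1 hL hBK hB1 hB
  rw [hFeq] at htr hFL hαF
  refine ⟨η, α, lam, htr, fun g hg hgen => ?_⟩
  have h0 := pos_of_pow_eq htr.pos htr.val
  have hlt := lt_one_of_pow_eq htr.val
  have hη0 : η ≠ 0 := (v.N.ne_zero_iff).1 h0.ne'
  have hηF := htr.mem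
  have hgη : g η ≠ η := by
    intro h
    apply hg
    rw [← hFeq]
    intro x hx
    have h3 : adjoin K {η} ≤ fixedField (Subgroup.zpowers g) := by
      rw [adjoin_le_iff, Set.singleton_subset_iff, SetLike.mem_coe, mem_fixedField_iff]
      intro f hf
      obtain ⟨m, rfl⟩ := Subgroup.mem_zpowers_iff.1 hf
      have : g ∈ MulAction.stabilizer (Ω ≃ₐ[K] Ω) η := h
      exact (MulAction.stabilizer (Ω ≃ₐ[K] Ω) η).zpow_mem this m
    exact (mem_fixedField_iff _ _).1 (h3 hx) g (Subgroup.mem_zpowers g)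
  obtain ⟨hz, hδ⟩ := d.map_root h1 hgη
  set z := g η / η - 1 with hzd
  have hzF : z ∈ F := F.sub_mem (F.div_mem (hFn g η hηF) hηF) F.one_mem
  have hδF : z / η ∈ F := F.div_mem hzF hηF
  have hδN : v.N (z / η) = 1 := by rw [map_div₀, hz, div_self h0.ne']
  obtain ⟨γ, hγ, hγδ⟩ := htr.residue hδF hδN.le
  have hγδ' : v.N (z / η - γ) ≤ v.N η := by
    have := htr.le_of_lt_zpow (F.sub_mem hδF ((bot_le : ⊥ ≤ F) hγ)) (k := 0) (by simpa using hγδ)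
    simpa using this
  have hγN : v.N γ = 1 := by
    rw [← hδN]; exact (v.N_eq_of_sub_lt' (by rwa [hδN])).symm
  have hBp : B ^ p ∈ (⊥ : IntermediateField K Ω) := pow_mem hBK p
  have hBpN : v.N (B ^ p) = 1 := by rw [map_pow, hB1, one_pow]
  have hmain := htr.N_D_pow_sub_le (hFn g) hz.le hγδ' hγ hγN.le hBp hBpN.le hαF hαN
  have hs : ∀ i ≤ ℓ, v.N (B ^ p * γ ^ i * (∏ j ∈ Finset.range i, ((j : ℤ) - ℓ) : ℤ)) = 1 := by
    intro i hi
    rw [map_mul, map_mul, hBpN, map_pow, hγN, v.N_int_eq_one (prod_sub_coprime d.lt hi)]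
    simp
  refine ⟨⟨d.odd, by have := d.two_le; omega, d.lt, htr, hFn, hMn, hFL.trans hLM, hMfd,
    hLM hlamL, ?_, hgen, hαF, hwp, ?_, ?_⟩, γ, hγ, ∏ j ∈ Finset.range ℓ, ((j : ℤ) - ℓ),
    prod_sub_coprime d.lt le_rfl, hγN, ?_, ?_⟩
  · intro E hFE hE
    refine hMmin E fun τ x hx => ?_
    have := d.le_of_lam_mem (d.close_y h2).1 hL hηL hlamL hlamN (E := E.comap τ.toAlgHom)
      (hFE (hFn τ η hηF)) (hE τ)
    exact this hx
  · intro i hi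
    have h3 := hmain i
    have h4 : v.N (B ^ p * γ ^ i * (∏ j ∈ Finset.range i, ((j : ℤ) - ℓ) : ℤ) * η ^ (i - ℓ : ℤ))
        = v.N η ^ (i - ℓ : ℤ) := by rw [map_mul, hs i hi, one_mul, map_zpow₀]
    rw [neg_sub, ← h4]
    apply v.N_eq_of_sub_lt
    rw [h4]
    exact h3.trans_lt (zpow_lt_zpow_right_of_lt_one₀ h0 hlt (by omega))
  · have h3 := hmain (ℓ + 1)
    rw [prod_sub_eq_zero] at h3
    simp only [Int.cast_zero, mul_zero, zero_mul, sub_zero] at h3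
    exact h3.trans_lt (zpow_lt_one₀ h0 hlt (by push_cast; omega))
  · have h3 := d.sub_eq_zero_sim htr.val h1
    have hcp0 := ne_zero_of_N d d.first
    have hc0 := ne_zero_of_N d d.last
    have h4 : v.Sim (c p / η ^ p) (c p / -c (p ^ 2)) := (Sim.refl hcp0).div h3
    have h5 : v.N (c p / -c (p ^ 2)) = 1 := by
      rw [map_div₀, v.N.map_neg, d.first, d.last, div_self v.p_pos.ne']
    unfold Sim at h4
    rw [h5] at h4
    have h6 : v.N (γ ^ (p - 1) - (z / η) ^ (p - 1)) < 1 := by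
      have : v.Sim γ (z / η) := by
        unfold Sim; rw [v.N.map_sub, hδN]; exact hγδ
      have := this.pow (p - 1)
      unfold Sim at this
      rwa [map_pow v.N (z / η), hδN, one_pow] at this
    have h7 : γ ^ (p - 1) + c p / c (p ^ 2) = (γ ^ (p - 1) - (z / η) ^ (p - 1))
        + ((z / η) ^ (p - 1) - c p / η ^ p) + (c p / η ^ p - c p / -c (p ^ 2)) := by
      rw [div_neg]; ring
    rw [h7]
    exact v.N_add_lt (v.N_add_lt h6 hδ) h4
  · have h3 := hmain ℓ
    simp only [sub_self, zpow_zero, mul_one, zero_add, zpow_one] at h3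
    exact h3.trans_lt hlt

end Eis

end LocalAbs

namespace LocalAbs

variable {p : ℕ} {K Ω : Type*} [Field K] [Field Ω] [Algebra K Ω] {v : LocalAbs p K Ω}

/-- Every element of a Galois group of prime order is a power of any nontrivial element. -/
lemma exists_pow_eq_of_prime [Fact p.Prime] {F : IntermediateField K Ω} [IsGalois K F]
    (hF : Module.finrank K F = p) {g : Ω ≃ₐ[K] Ω} (hg : ¬ ∀ x ∈ F, g x = x) (τ : Ω ≃ₐ[K] Ω) :
    ∃ m : ℕ, ∀ x ∈ F, τ x = (g ^ m) x := by
  have hfd : FiniteDimensional K F :=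
    FiniteDimensional.of_finrank_pos (by rw [hF]; exact (Fact.out : p.Prime).pos)
  have hcard : Nat.card (F ≃ₐ[K] F) = p := by rw [IsGalois.card_aut_eq_finrank, hF]
  have hne : AlgEquiv.restrictNormalHom F g ≠ 1 := by
    intro h
    apply hg
    intro x hx
    rw [← AlgEquiv.restrictNormalHom_apply F g ⟨x, hx⟩, h]
    rfl
  obtain ⟨m, hm⟩ := mem_powers_of_prime_card hcard (g' := AlgEquiv.restrictNormalHom F τ) hne
  refine ⟨m, fun x hx => ?_⟩
  rw [← AlgEquiv.restrictNormalHom_apply F τ ⟨x, hx⟩, ← hm,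
    ← AlgEquiv.restrictNormalHom_apply F (g ^ m) ⟨x, hx⟩, map_pow]

lemma pow_fix_of_prime [Fact p.Prime] {F : IntermediateField K Ω} [IsGalois K F]
    (hF : Module.finrank K F = p) (g : Ω ≃ₐ[K] Ω) : ∀ x ∈ F, (g ^ p) x = x := by
  have hfd : FiniteDimensional K F :=
    FiniteDimensional.of_finrank_pos (by rw [hF]; exact (Fact.out : p.Prime).pos)
  have hcard : Nat.card (F ≃ₐ[K] F) = p := by rw [IsGalois.card_aut_eq_finrank, hF]
  intro x hx
  rw [← AlgEquiv.restrictNormalHom_apply F (g ^ p) ⟨x, hx⟩, map_pow]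
  conv_lhs => rw [← hcard]
  rw [pow_card_eq_one']
  rfl

section Restrict

variable {M : IntermediateField K Ω} [Normal K M]

lemma restrict_eq_iff {s t : Ω ≃ₐ[K] Ω} :
    AlgEquiv.restrictNormalHom M s = AlgEquiv.restrictNormalHom M t ↔ ∀ y ∈ M, s y = t y := by
  constructor
  · intro h y hy
    rw [← AlgEquiv.restrictNormalHom_apply M s ⟨y, hy⟩, h, AlgEquiv.restrictNormalHom_apply]
  · intro h
    ext y
    rw [AlgEquiv.restrictNormalHom_apply, AlgEquiv.restrictNormalHom_apply]
    exact h y y.2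

lemma restrict_eq_one_iff {t : Ω ≃ₐ[K] Ω} :
    AlgEquiv.restrictNormalHom M t = 1 ↔ ∀ y ∈ M, t y = y := by
  rw [← map_one (AlgEquiv.restrictNormalHom (F := K) (K₁ := Ω) M), restrict_eq_iff]
  rfl

lemma restrict_iterate (g h : Ω ≃ₐ[K] Ω) (n : ℕ) :
    AlgEquiv.restrictNormalHom M ((fun h => g⁻¹ * h * g * h⁻¹)^[n] h) =
      (fun h => (AlgEquiv.restrictNormalHom M g)⁻¹ * h * AlgEquiv.restrictNormalHom M g * h⁻¹)^[n]
        (AlgEquiv.restrictNormalHom M h) := by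
  refine Function.Semiconj.iterate_right (f := AlgEquiv.restrictNormalHom M) (fun h => ?_) n h
  simp only [map_mul, map_inv]

variable [IsGalois K Ω] {F : IntermediateField K Ω} (hFM : F ≤ M)
  {H : Subgroup (M ≃ₐ[K] M)} (hH : ∀ τ, τ ∈ H ↔ ∀ y : M, (y : Ω) ∈ F → τ y = y)

include hFM hH

lemma restrict_mem_iff {t : Ω ≃ₐ[K] Ω} :
    AlgEquiv.restrictNormalHom M t ∈ H ↔ ∀ x ∈ F, t x = x := by
  rw [hH]
  constructor
  · intro h x hx
    have := congrArg (Subtype.val) (h ⟨x, hFM hx⟩ hx)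
    rwa [AlgEquiv.restrictNormalHom_apply] at this
  · intro h y hy
    apply Subtype.ext
    rw [AlgEquiv.restrictNormalHom_apply]
    exact h y hy

variable [Fact p.Prime] [IsAlgClosed Ω] [IsGalois K F] {ℓ : ℕ} {η α lam : Ω}
  (hF : Module.finrank K F = p)
  (hd : ∀ g : Ω ≃ₐ[K] Ω, (¬ ∀ x ∈ F, g x = x) → Datum v ℓ F M η α lam g)

include hF hd

lemma exists_isComplement {g : Ω ≃ₐ[K] Ω} (hg : ¬ ∀ x ∈ F, g x = x) :
    ∃ C : Subgroup (M ≃ₐ[K] M), H.IsComplement' C ∧ Nat.card C = p := by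
  obtain ⟨g', hg', hp⟩ := (hd g hg).exists_lift (pow_fix_of_prime hF g) fun g' h => hd g'
    fun h' => hg fun x hx => by rw [← h x hx, h' x hx]
  have hg'F : ¬ ∀ x ∈ F, g' x = x := fun h' => hg fun x hx => by rw [← hg' x hx, h' x hx]
  set c := AlgEquiv.restrictNormalHom M g' with hc
  have hcp : c ^ p = 1 := by rw [hc, ← map_pow, restrict_eq_one_iff]; exact hp
  have hcH : c ∉ H := by rwa [hc, restrict_mem_iff hFM hH]
  have hc1 : c ≠ 1 := fun h => hcH (h ▸ H.one_mem)
  have hcard : Nat.card (Subgroup.zpowers c) = p := by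
    rw [Nat.card_zpowers, orderOf_eq_prime hcp hc1]
  refine ⟨Subgroup.zpowers c, Subgroup.isComplement'_of_disjoint_and_mul_eq_univ ?_ ?_, hcard⟩
  · rw [Subgroup.disjoint_def]
    intro x hx hxc
    by_contra hx1
    obtain ⟨m, hm⟩ := mem_powers_of_prime_card hcard (g := ⟨x, hxc⟩)
      (g' := ⟨c, Subgroup.mem_zpowers c⟩) (fun h => hx1 (congrArg Subtype.val h))
    have : x ^ m = c := congrArg Subtype.val hm
    exact hcH (this ▸ H.pow_mem hx m)
  · rw [Set.eq_univ_iff_forall]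
    intro τ
    obtain ⟨t, rfl⟩ := AlgEquiv.restrictNormalHom_surjective (F := K) (K₁ := M) Ω τ
    obtain ⟨m, hm⟩ := exists_pow_eq_of_prime hF hg'F t
    refine Set.mem_mul.2 ⟨AlgEquiv.restrictNormalHom M (t * (g' ^ m)⁻¹), ?_, c ^ m,
      (Subgroup.zpowers c).pow_mem (Subgroup.mem_zpowers c) m, ?_⟩
    · rw [SetLike.mem_coe, restrict_mem_iff hFM hH]
      intro x hx
      have h1 := (hd g hg).normal (g' ^ m)⁻¹ x hx
      rw [AlgEquiv.mul_apply, hm _ h1]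
      exact (g' ^ m).apply_symm_apply x
    · rw [hc, ← map_pow, ← map_mul, inv_mul_cancel_right]

lemma pow_eq_one {g : Ω ≃ₐ[K] Ω} (hg : ¬ ∀ x ∈ F, g x = x) {τ : M ≃ₐ[K] M} (hτ : τ ∈ H) :
    τ ^ p = 1 := by
  obtain ⟨t, rfl⟩ := AlgEquiv.restrictNormalHom_surjective (F := K) (K₁ := M) Ω τ
  rw [restrict_mem_iff hFM hH] at hτ
  rw [← map_pow, restrict_eq_one_iff]
  exact (hd g hg).pow_p hτ

lemma mul_comm_of_mem {g : Ω ≃ₐ[K] Ω} (hg : ¬ ∀ x ∈ F, g x = x) {τ₁ τ₂ : M ≃ₐ[K] M}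
    (h₁ : τ₁ ∈ H) (h₂ : τ₂ ∈ H) : τ₁ * τ₂ = τ₂ * τ₁ := by
  obtain ⟨t₁, rfl⟩ := AlgEquiv.restrictNormalHom_surjective (F := K) (K₁ := M) Ω τ₁
  obtain ⟨t₂, rfl⟩ := AlgEquiv.restrictNormalHom_surjective (F := K) (K₁ := M) Ω τ₂
  rw [restrict_mem_iff hFM hH] at h₁ h₂
  rw [← map_mul, ← map_mul, restrict_eq_iff]
  exact (hd g hg).comm h₁ h₂

lemma card_eq {g : Ω ≃ₐ[K] Ω} (hg : ¬ ∀ x ∈ F, g x = x) {n : ℕ}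
    (hM : Module.finrank K M = p * n) : Nat.card H = n := by
  have hp := (Fact.out : p.Prime).pos
  have hfd := (hd g hg).fd
  have hgal : IsGalois K M := IsGalois.mk
  obtain ⟨C, hC, hCc⟩ := exists_isComplement hFM hH hF hd hg
  have := hC.card_mul_card
  rw [hCc, IsGalois.card_aut_eq_finrank, hM, mul_comm] at this
  exact Nat.eq_of_mul_eq_mul_left hp this

lemma iterate_eq_one {gl : M ≃ₐ[K] M} (hgl : gl ∉ H) {τ : M ≃ₐ[K] M} (hτ : τ ∈ H) :
    (fun h => gl * h * gl⁻¹ * h⁻¹)^[ℓ + 1] τ = 1 := by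
  obtain ⟨t, rfl⟩ := AlgEquiv.restrictNormalHom_surjective (F := K) (K₁ := M) Ω τ
  obtain ⟨g, hg⟩ := AlgEquiv.restrictNormalHom_surjective (F := K) (K₁ := M) Ω gl⁻¹
  obtain rfl : gl = (AlgEquiv.restrictNormalHom M g)⁻¹ := by rw [hg, inv_inv]
  rw [inv_mem_iff, restrict_mem_iff hFM hH] at hgl
  rw [restrict_mem_iff hFM hH] at hτ
  rw [inv_inv, ← restrict_iterate, restrict_eq_one_iff]
  exact (hd g hgl).iterate_succ hτ

lemma iterate_eq_one' {gl : M ≃ₐ[K] M} (hgl : gl ∉ H)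
    (hu : ∀ g : Ω ≃ₐ[K] Ω, (¬ ∀ x ∈ F, g x = x) →
      ∃ u : K, v.q (algebraMap K Ω u ^ p - algebraMap K Ω u) = v.q ((D g ^ ℓ) α))
    {τ : M ≃ₐ[K] M} (hτ : τ ∈ H) :
    (fun h => gl * h * gl⁻¹ * h⁻¹)^[ℓ] τ = 1 := by
  obtain ⟨t, rfl⟩ := AlgEquiv.restrictNormalHom_surjective (F := K) (K₁ := M) Ω τ
  obtain ⟨g, hg⟩ := AlgEquiv.restrictNormalHom_surjective (F := K) (K₁ := M) Ω gl⁻¹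
  obtain rfl : gl = (AlgEquiv.restrictNormalHom M g)⁻¹ := by rw [hg, inv_inv]
  rw [inv_mem_iff, restrict_mem_iff hFM hH] at hgl
  rw [restrict_mem_iff hFM hH] at hτ
  rw [inv_inv, ← restrict_iterate, restrict_eq_one_iff]
  exact (hd g hgl).iterate hτ (hu g hgl)

lemma exists_iterate_pred_ne_one {gl : M ≃ₐ[K] M} (hgl : gl ∉ H) :
    ∃ τ ∈ H, (fun h => gl * h * gl⁻¹ * h⁻¹)^[ℓ - 1] τ ≠ 1 := by
  obtain ⟨g, hg⟩ := AlgEquiv.restrictNormalHom_surjective (F := K) (K₁ := M) Ω gl⁻¹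
  obtain rfl : gl = (AlgEquiv.restrictNormalHom M g)⁻¹ := by rw [hg, inv_inv]
  rw [inv_mem_iff, restrict_mem_iff hFM hH] at hgl
  obtain ⟨h, hhF, y, hy, hne⟩ := (hd g hgl).exists_iterate_pred_ne
  refine ⟨AlgEquiv.restrictNormalHom M h, (restrict_mem_iff hFM hH).2 hhF, fun h1 => hne ?_⟩
  rw [inv_inv, ← restrict_iterate, restrict_eq_one_iff] at h1
  exact h1 y hy

lemma exists_iterate_ne_one {gl : M ≃ₐ[K] M} (hgl : gl ∉ H)
    (hu : ∀ g : Ω ≃ₐ[K] Ω, (¬ ∀ x ∈ F, g x = x) →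
      ¬ ∃ u : K, v.q (algebraMap K Ω u ^ p - algebraMap K Ω u) = v.q ((D g ^ ℓ) α)) :
    ∃ τ ∈ H, (fun h => gl * h * gl⁻¹ * h⁻¹)^[ℓ] τ ≠ 1 := by
  obtain ⟨g, hg⟩ := AlgEquiv.restrictNormalHom_surjective (F := K) (K₁ := M) Ω gl⁻¹
  obtain rfl : gl = (AlgEquiv.restrictNormalHom M g)⁻¹ := by rw [hg, inv_inv]
  rw [inv_mem_iff, restrict_mem_iff hFM hH] at hgl
  obtain ⟨h, hhF, y, hy, hne⟩ := (hd g hgl).exists_iterate_top_ne (hu g hgl)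
  refine ⟨AlgEquiv.restrictNormalHom M h, (restrict_mem_iff hFM hH).2 hhF, fun h1 => hne ?_⟩
  rw [inv_inv, ← restrict_iterate, restrict_eq_one_iff] at h1
  exact h1 y hy

end Restrict

end LocalAbs

section PadicBridge

variable {p : ℕ} [Fact p.Prime] {Ω : Type} [Field Ω] [Algebra ℚ_[p] Ω]
  [Algebra.IsAlgebraic ℚ_[p] Ω]

lemma spectralNorm_le_one_iff_isIntegral (x : Ω) :
    spectralNorm ℚ_[p] Ω x ≤ 1 ↔ IsIntegral ℤ_[p] x := by
  have hst : IsScalarTower ℤ_[p] ℚ_[p] Ω := IsScalarTower.of_algebraMap_eq fun _ => rfl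
  have hx : IsIntegral ℚ_[p] x := Algebra.IsIntegral.isIntegral x
  rw [spectralNorm, spectralValue_le_one_iff (minpoly.monic hx)]
  constructor
  · intro h
    have hl : minpoly ℚ_[p] x ∈ Polynomial.lifts (algebraMap ℤ_[p] ℚ_[p]) := by
      rw [Polynomial.lifts_iff_coeff_lifts]
      exact fun n => ⟨⟨_, h n⟩, rfl⟩
    obtain ⟨P, hP, -, hPm⟩ := Polynomial.lifts_and_degree_eq_and_monic hl (minpoly.monic hx)
    refine ⟨P, hPm, ?_⟩
    rw [IsScalarTower.algebraMap_eq ℤ_[p] ℚ_[p] Ω, ← Polynomial.eval₂_map, hP]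
    exact minpoly.aeval _ _
  · intro h n
    rw [minpoly.isIntegrallyClosed_eq_field_fractions' ℚ_[p] h, coeff_map]
    exact ((minpoly ℤ_[p] x).coeff n).2

lemma spectralNorm_map_le_one_iff {E : Type} [Field E] [Algebra ℚ_[p] E] (φ : E →ₐ[ℚ_[p]] Ω)
    (x : E) : spectralNorm ℚ_[p] Ω (φ x) ≤ 1 ↔ IsIntegral ℤ_[p] x := by
  rw [spectralNorm_le_one_iff_isIntegral]
  have hcomm : ∀ r : ℤ_[p], φ (algebraMap ℤ_[p] E r) = algebraMap ℤ_[p] Ω r :=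
    fun r => φ.commutes _
  exact isIntegral_algHom_iff (⟨φ.toRingHom, hcomm⟩ : E →ₐ[ℤ_[p]] Ω) φ.injective

/-- The absolute value of an algebraic extension of `ℚ_[p]`. -/
noncomputable def padicAbsoluteValue (p : ℕ) [Fact p.Prime] (Ω : Type) [Field Ω]
    [Algebra ℚ_[p] Ω] [Algebra.IsAlgebraic ℚ_[p] Ω] : AbsoluteValue Ω ℝ where
  toFun := spectralNorm ℚ_[p] Ω
  map_mul' x y := map_mul (spectralMulAlgNorm ℚ_[p] Ω) x y
  nonneg' := spectralNorm_nonneg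
  eq_zero' x := ⟨fun h => eq_zero_of_map_spectralNorm_eq_zero h (Algebra.IsAlgebraic.isAlgebraic x),
    fun h => by rw [h, spectralNorm_zero]⟩
  add_le' x y := map_add_le_add (spectralMulAlgNorm ℚ_[p] Ω) x y

lemma padicAbsoluteValue_prime : padicAbsoluteValue p Ω (p : Ω) = (p : ℝ)⁻¹ := by
  change spectralNorm ℚ_[p] Ω (p : Ω) = _
  rw [← map_natCast (algebraMap ℚ_[p] Ω), spectralNorm_extends, Padic.norm_p]

lemma padicAbsoluteValue_map_le_one_iff {E : Type} [Field E] [Algebra ℚ_[p] E]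
    (φ : E →ₐ[ℚ_[p]] Ω) (x : E) : padicAbsoluteValue p Ω (φ x) ≤ 1 ↔ IsIntegral ℤ_[p] x :=
  spectralNorm_map_le_one_iff φ x

lemma padicAbsoluteValue_prime_pos : 0 < padicAbsoluteValue p Ω (p : Ω) := by
  rw [padicAbsoluteValue_prime]
  have := (Fact.out : p.Prime).pos
  positivity

lemma padicAbsoluteValue_prime_lt_one : padicAbsoluteValue p Ω (p : Ω) < 1 := by
  rw [padicAbsoluteValue_prime]
  exact inv_lt_one_of_one_lt₀ (by exact_mod_cast (Fact.out : p.Prime).one_lt)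

section Integers

variable {E : Type} [Field E] [Algebra ℚ_[p] E] (φ : E →ₐ[ℚ_[p]] Ω)

lemma padicAbsoluteValue_integer_le (x : integralClosure ℤ_[p] E) :
    padicAbsoluteValue p Ω (φ (x : E)) ≤ 1 :=
  (padicAbsoluteValue_map_le_one_iff φ _).2 x.2

lemma isUnit_iff_padicAbsoluteValue {x : integralClosure ℤ_[p] E} :
    IsUnit x ↔ padicAbsoluteValue p Ω (φ (x : E)) = 1 := by
  have hx := padicAbsoluteValue_integer_le φ x
  constructor
  · rintro ⟨u, rfl⟩
    have hy := padicAbsoluteValue_integer_le φ (↑u⁻¹ : integralClosure ℤ_[p] E)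
    have h1 : padicAbsoluteValue p Ω (φ ((u : integralClosure ℤ_[p] E) : E)) *
        padicAbsoluteValue p Ω (φ ((↑u⁻¹ : integralClosure ℤ_[p] E) : E)) = 1 := by
      rw [← map_mul, ← map_mul, ← Subalgebra.coe_mul, Units.mul_inv]
      simp
    nlinarith [(padicAbsoluteValue p Ω).nonneg (φ ((u : integralClosure ℤ_[p] E) : E))]
  · intro h
    have hx0 : (x : E) ≠ 0 := by
      intro h0
      simp [h0] at h
    have hinv : IsIntegral ℤ_[p] ((x : E)⁻¹) := by
      rw [← padicAbsoluteValue_map_le_one_iff φ, map_inv₀, map_inv₀, h, inv_one]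
    exact IsUnit.of_mul_eq_one (⟨(x : E)⁻¹, hinv⟩ : integralClosure ℤ_[p] E)
      (Subtype.ext (mul_inv_cancel₀ hx0))

lemma dvd_iff_padicAbsoluteValue {x y : integralClosure ℤ_[p] E} (hy : y ≠ 0) :
    y ∣ x ↔ padicAbsoluteValue p Ω (φ (x : E)) ≤ padicAbsoluteValue p Ω (φ (y : E)) := by
  have hy0 : (y : E) ≠ 0 := fun h => hy (Subtype.ext h)
  have hyp : 0 < padicAbsoluteValue p Ω (φ (y : E)) :=
    (padicAbsoluteValue p Ω).pos ((map_ne_zero φ).2 hy0)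
  constructor
  · rintro ⟨z, rfl⟩
    rw [Subalgebra.coe_mul, map_mul, map_mul]
    exact mul_le_of_le_one_right hyp.le (padicAbsoluteValue_integer_le φ z)
  · intro h
    have hz : IsIntegral ℤ_[p] ((x : E) / y) := by
      rw [← padicAbsoluteValue_map_le_one_iff φ, map_div₀, map_div₀]
      exact div_le_one_of_le₀ h hyp.le
    exact ⟨⟨_, hz⟩, Subtype.ext (mul_div_cancel₀ _ hy0).symm⟩

lemma coe_natCast_integer (n : ℕ) : ((n : integralClosure ℤ_[p] E) : E) = n := by simp

lemma prime_pow_dvd_iff {x : integralClosure ℤ_[p] E} (k : ℕ) :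
    (p : integralClosure ℤ_[p] E) ^ k ∣ x ↔
      padicAbsoluteValue p Ω (φ (x : E)) ≤ padicAbsoluteValue p Ω (p : Ω) ^ k := by
  have h0 : (p : integralClosure ℤ_[p] E) ≠ 0 := by
    intro h
    have h1 := congrArg (fun z : integralClosure ℤ_[p] E => φ (z : E)) h
    simp only [coe_natCast_integer, map_natCast, ZeroMemClass.coe_zero, map_zero] at h1
    have := padicAbsoluteValue_prime_pos (p := p) (Ω := Ω)
    rw [h1] at this
    simp at this
  rw [dvd_iff_padicAbsoluteValue φ (pow_ne_zero k h0)]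
  simp

end Integers

section Unramified

variable {K : Type} [Field K] [Algebra ℚ_[p] K] (φ : K →ₐ[ℚ_[p]] Ω)
  (hKloc : ∀ x : integralClosure ℤ_[p] K, ¬IsUnit x → (p : integralClosure ℤ_[p] K) ∣ x)

include hKloc

lemma padicAbsoluteValue_lt_one_iff {x : integralClosure ℤ_[p] K} :
    padicAbsoluteValue p Ω (φ (x : K)) < 1 ↔ (p : integralClosure ℤ_[p] K) ∣ x := by
  constructor
  · intro h
    exact hKloc x fun hu => h.ne ((isUnit_iff_padicAbsoluteValue φ).1 hu)
  · intro h
    rw [← pow_one (p : integralClosure ℤ_[p] K), prime_pow_dvd_iff φ, pow_one] at h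
    exact h.trans_lt padicAbsoluteValue_prime_lt_one

lemma padicAbsoluteValue_eq_pow {x : integralClosure ℤ_[p] K} {k : ℕ}
    (h : (p : integralClosure ℤ_[p] K) ^ k ∣ x)
    (h' : ¬ (p : integralClosure ℤ_[p] K) ^ (k + 1) ∣ x) :
    padicAbsoluteValue p Ω (φ (x : K)) = padicAbsoluteValue p Ω (p : Ω) ^ k := by
  obtain ⟨y, rfl⟩ := h
  have hy : ¬ (p : integralClosure ℤ_[p] K) ∣ y := fun hy => h' (by
    rw [pow_succ]; exact mul_dvd_mul_left _ hy)
  have hy1 : padicAbsoluteValue p Ω (φ (y : K)) = 1 := by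
    rw [← padicAbsoluteValue_lt_one_iff φ hKloc, not_lt] at hy
    exact le_antisymm (padicAbsoluteValue_integer_le φ y) hy
  simp [hy1]

lemma exists_padicAbsoluteValue_eq_zpow {x : K} (hx : x ≠ 0) :
    ∃ m : ℤ, padicAbsoluteValue p Ω (φ x) = padicAbsoluteValue p Ω (p : Ω) ^ m := by
  have hp0 := padicAbsoluteValue_prime_pos (p := p) (Ω := Ω)
  have hp1 := padicAbsoluteValue_prime_lt_one (p := p) (Ω := Ω)
  have hx0 : 0 < padicAbsoluteValue p Ω (φ x) :=
    (padicAbsoluteValue p Ω).pos ((map_ne_zero φ).2 hx)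
  obtain ⟨n, hn1, hn2⟩ := exists_mem_Ioc_zpow hx0 ((one_lt_inv₀ hp0).2 hp1)
  have hN : padicAbsoluteValue p Ω (φ (x * (p : K) ^ (n + 1))) =
      padicAbsoluteValue p Ω (φ x) * padicAbsoluteValue p Ω (p : Ω) ^ (n + 1) := by
    simp
  have hle : padicAbsoluteValue p Ω (φ (x * (p : K) ^ (n + 1))) ≤ 1 := by
    rw [hN]
    rw [inv_zpow, le_inv_comm₀ hx0 (by positivity)] at hn2
    calc _ ≤ _ := mul_le_mul_of_nonneg_left hn2 hx0.le
      _ = 1 := mul_inv_cancel₀ hx0.ne'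
  have hlt : padicAbsoluteValue p Ω (p : Ω) <
      padicAbsoluteValue p Ω (φ (x * (p : K) ^ (n + 1))) := by
    rw [hN, zpow_add_one₀ hp0.ne', ← mul_assoc]
    refine lt_mul_of_one_lt_left hp0 ?_
    rw [inv_zpow, inv_lt_iff_one_lt_mul₀ (by positivity)] at hn1
    linarith
  rw [padicAbsoluteValue_map_le_one_iff] at hle
  have h1 := padicAbsoluteValue_eq_pow φ hKloc (x := ⟨_, hle⟩) (k := 0) (by simp) (by
    rw [prime_pow_dvd_iff φ]
    simpa using hlt)
  refine ⟨-(n + 1), ?_⟩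
  rw [pow_zero] at h1
  change padicAbsoluteValue p Ω (φ (x * (p : K) ^ (n + 1))) = 1 at h1
  rw [hN] at h1
  rw [zpow_neg]
  exact eq_inv_of_mul_eq_one_left h1

variable {κ : Type} [Field κ] {ρ : integralClosure ℤ_[p] K →+* κ}
  (hker : RingHom.ker ρ = Ideal.span {(p : integralClosure ℤ_[p] K)})

include hker

lemma residue_eq_zero_iff {x : integralClosure ℤ_[p] K} :
    ρ x = 0 ↔ padicAbsoluteValue p Ω (φ (x : K)) < 1 := by
  rw [padicAbsoluteValue_lt_one_iff φ hKloc, ← Ideal.mem_span_singleton, ← hker, RingHom.mem_ker]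

lemma exists_frobenius_lift [Finite κ] [CharP κ p] (hρ : Function.Surjective ρ) {x : K}
    (hx : padicAbsoluteValue p Ω (φ x) ≤ 1) :
    ∃ y : K, padicAbsoluteValue p Ω (φ y ^ p - φ x) < 1 := by
  rw [padicAbsoluteValue_map_le_one_iff] at hx
  have : ExpChar κ p := ExpChar.prime Fact.out
  have : PerfectRing κ p := inferInstance
  obtain ⟨z, hz⟩ := surjective_frobenius κ p (ρ ⟨x, hx⟩)
  obtain ⟨y, rfl⟩ := hρ z
  refine ⟨y, ?_⟩
  rw [← map_pow, ← map_sub]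
  have : ρ (y ^ p - ⟨x, hx⟩) = 0 := by rw [map_sub, map_pow, ← hz, frobenius_def, sub_self]
  rw [residue_eq_zero_iff φ hKloc hker] at this
  simpa using this

end Unramified

/-- The data on an algebraic extension `Ω` of an unramified extension `K` of `ℚ_[p]`. -/
noncomputable def padicLocalAbs {K : Type} [Field K] [Algebra ℚ_[p] K] [Algebra K Ω]
    [IsScalarTower ℚ_[p] K Ω]
    (hKloc : ∀ x : integralClosure ℤ_[p] K, ¬IsUnit x → (p : integralClosure ℤ_[p] K) ∣ x)
    {κ : Type} [Field κ] [Finite κ] [CharP κ p] {ρ : integralClosure ℤ_[p] K →+* κ}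
    (hρ : Function.Surjective ρ)
    (hker : RingHom.ker ρ = Ideal.span {(p : integralClosure ℤ_[p] K)}) : LocalAbs p K Ω where
  N := padicAbsoluteValue p Ω
  nonarch x y := isNonarchimedean_spectralNorm x y
  inv τ x := (spectralNorm_eq_of_equiv (τ.restrictScalars ℚ_[p]) x).symm
  p_pos := padicAbsoluteValue_prime_pos
  p_lt := padicAbsoluteValue_prime_lt_one
  discrete _ hx := exists_padicAbsoluteValue_eq_zpow (IsScalarTower.toAlgHom ℚ_[p] K Ω) hKloc hx
  frob _ hx := exists_frobenius_lift (IsScalarTower.toAlgHom ℚ_[p] K Ω) hKloc hker hρ hx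

end PadicBridge

/-- Rescaling the additive polynomial of the statement to Artin-Schreier form. -/
lemma exists_root_iff_exists_artinSchreier {κ : Type*} [Field κ] {p : ℕ} [Fact p.Prime]
    {γ β e : κ} (hγ : γ ≠ 0) (hβ : β ≠ 0) (he : e ≠ 0) (hep : e ^ p = e) (ℓ : ℕ) :
    (∃ x : κ, (γ ^ (p - 1)) ^ ℓ * x ^ p - (β⁻¹) ^ (p - 1) * x - 1 = 0) ↔
      ∃ w : κ, w ^ p - w = β ^ p * γ ^ ℓ * e := by
  have hp := (Fact.out : p.Prime).one_lt
  obtain ⟨n, rfl⟩ : ∃ n, p = n + 1 := ⟨p - 1, by omega⟩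
  rw [Nat.add_sub_cancel]
  have hc : e * γ ^ ℓ * β ≠ 0 := by positivity
  have key : ∀ x : κ, (e * γ ^ ℓ * β * x) ^ (n + 1) - e * γ ^ ℓ * β * x - β ^ (n + 1) * γ ^ ℓ * e =
      β ^ (n + 1) * γ ^ ℓ * e * ((γ ^ n) ^ ℓ * x ^ (n + 1) - (β⁻¹) ^ n * x - 1) := by
    intro x
    have h1 : β ^ (n + 1) * (β⁻¹) ^ n = β := by
      rw [pow_succ, inv_pow]; field_simp
    have h2 : (e * γ ^ ℓ * β * x) ^ (n + 1)
        = e * ((γ ^ ℓ) ^ n * γ ^ ℓ) * β ^ (n + 1) * x ^ (n + 1) := by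
      rw [mul_pow, mul_pow, mul_pow, hep, pow_succ (γ ^ ℓ)]
    rw [h2, ← pow_mul, mul_comm ℓ n, pow_mul]
    linear_combination (γ ^ ℓ * e * x) * h1
  have hc2 : β ^ (n + 1) * γ ^ ℓ * e ≠ 0 := by positivity
  constructor
  · rintro ⟨x, hx⟩
    exact ⟨e * γ ^ ℓ * β * x, by rw [← sub_eq_zero, key, hx, mul_zero]⟩
  · rintro ⟨w, hw⟩
    refine ⟨w / (e * γ ^ ℓ * β), ?_⟩
    have := key (w / (e * γ ^ ℓ * β))
    rw [mul_div_cancel₀ _ hc, hw, sub_self] at this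
    exact (mul_eq_zero.1 this.symm).resolve_left hc2

section PadicBridge

variable {p : ℕ} [Fact p.Prime] {Ω : Type} [Field Ω] [Algebra ℚ_[p] Ω]
  [Algebra.IsAlgebraic ℚ_[p] Ω]
  {K : Type} [Field K] [Algebra ℚ_[p] K] [Algebra K Ω] [IsScalarTower ℚ_[p] K Ω]
  (hKloc : ∀ x : integralClosure ℤ_[p] K, ¬IsUnit x → (p : integralClosure ℤ_[p] K) ∣ x)
  {κ : Type} [Field κ] [Finite κ] [CharP κ p] {ρ : integralClosure ℤ_[p] K →+* κ}
  (hρ : Function.Surjective ρ)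
  (hker : RingHom.ker ρ = Ideal.span {(p : integralClosure ℤ_[p] K)})

lemma padicLocalAbs_N : (padicLocalAbs (Ω := Ω) hKloc hρ hker).N = padicAbsoluteValue p Ω := rfl

include hker in
lemma residue_eq_iff {x y : integralClosure ℤ_[p] K} :
    ρ x = ρ y ↔ (padicLocalAbs (Ω := Ω) hKloc hρ hker).N
      (algebraMap K Ω (x : K) - algebraMap K Ω (y : K)) < 1 := by
  rw [← sub_eq_zero, ← map_sub, residue_eq_zero_iff (IsScalarTower.toAlgHom ℚ_[p] K Ω) hKloc hker,
    padicLocalAbs_N]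
  simp

lemma exists_root_iff_exists_q {ℓ : ℕ} {β A : κ} (hβ : β ≠ 0) (hA : A ≠ 0)
    {B a : integralClosure ℤ_[p] K} (hB : ρ B = β)
    {γ s : Ω} {e : ℤ} (hγ : γ ∈ (⊥ : IntermediateField K Ω)) (he : IsCoprime e (p : ℤ))
    (hγ1 : (padicLocalAbs (Ω := Ω) hKloc hρ hker).N γ = 1) (ha : ρ a = -A)
    (hγA : (padicLocalAbs (Ω := Ω) hKloc hρ hker).N (γ ^ (p - 1) + algebraMap K Ω (a : K)) < 1)
    (hs : (padicLocalAbs (Ω := Ω) hKloc hρ hker).N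
      (s - algebraMap K Ω (B : K) ^ p * γ ^ ℓ * e) < 1) :
    (∃ x : κ, A ^ ℓ * x ^ p - (β⁻¹) ^ (p - 1) * x - 1 = 0) ↔
      ∃ u : K, (padicLocalAbs (Ω := Ω) hKloc hρ hker).q
        (algebraMap K Ω u ^ p - algebraMap K Ω u) =
          (padicLocalAbs (Ω := Ω) hKloc hρ hker).q s := by
  set v := padicLocalAbs (Ω := Ω) hKloc hρ hker with hv
  have hp := (Fact.out : p.Prime)
  have hiff : ∀ x : K, v.N (algebraMap K Ω x) ≤ 1 ↔ IsIntegral ℤ_[p] x :=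
    padicAbsoluteValue_map_le_one_iff (IsScalarTower.toAlgHom ℚ_[p] K Ω)
  obtain ⟨γ', rfl⟩ := IntermediateField.mem_bot.1 hγ
  obtain ⟨γ₀, rfl⟩ : ∃ y : integralClosure ℤ_[p] K, (y : K) = γ' := ⟨⟨γ', (hiff _).1 hγ1.le⟩, rfl⟩
  have hγA' : ρ γ₀ ^ (p - 1) = A := by
    have : ρ (γ₀ ^ (p - 1)) = ρ (-a) := by
      rw [residue_eq_iff (Ω := Ω) hKloc hρ hker]
      simpa using hγA
    rw [map_pow, map_neg, ha, neg_neg] at this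
    exact this
  have hγ0 : ρ γ₀ ≠ 0 := by
    intro h
    rw [h, zero_pow (by have := hp.one_lt; omega)] at hγA'
    exact hA hγA'.symm
  have hee : ((e : κ)) ^ p = e := by
    have := map_intCast (frobenius κ p) e
    rwa [frobenius_def] at this
  have he0 : (e : κ) ≠ 0 := by
    rw [Ne, CharP.intCast_eq_zero_iff κ p]
    intro h
    have := Int.isUnit_iff.1 (he.isUnit_of_dvd' h dvd_rfl)
    have := hp.one_lt
    omega
  rw [← hγA', exists_root_iff_exists_artinSchreier hγ0 hβ he0 hee]
  have hS : v.N (algebraMap K Ω ((B ^ p * γ₀ ^ ℓ * (e : integralClosure ℤ_[p] K) :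
      integralClosure ℤ_[p] K) : K) - s) < 1 := by
    rw [v.N.map_sub]
    simpa using hs
  have hqS := (v.q_eq_iff).2 hS
  rw [← hqS]
  constructor
  · rintro ⟨w, hw⟩
    obtain ⟨u, rfl⟩ := hρ w
    refine ⟨u, ?_⟩
    have h1 : ρ (u ^ p - u) = ρ (B ^ p * γ₀ ^ ℓ * (e : integralClosure ℤ_[p] K)) := by
      simp only [map_sub, map_mul, map_pow, map_intCast, hB, hw]
    rw [residue_eq_iff (Ω := Ω) hKloc hρ hker] at h1
    rw [LocalAbs.q_eq_iff]
    simpa using h1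
  · rintro ⟨u, hu⟩
    rw [LocalAbs.q_eq_iff] at hu
    have h1 : v.N (algebraMap K Ω u ^ p - algebraMap K Ω u) ≤ 1 := by
      have h2 := v.N_add_le hu.le ((hiff _).2
        (B ^ p * γ₀ ^ ℓ * (e : integralClosure ℤ_[p] K)).2)
      rwa [sub_add_cancel] at h2
    have h2 := (hiff u).1 (LocalAbs.N_le_one_of_wp h1)
    refine ⟨ρ ⟨u, h2⟩, ?_⟩
    have h3 : ρ (⟨u, h2⟩ ^ p - ⟨u, h2⟩) = ρ (B ^ p * γ₀ ^ ℓ * (e : integralClosure ℤ_[p] K)) := by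
      rw [residue_eq_iff (Ω := Ω) hKloc hρ hker]
      simpa using hu
    simpa [hB] using h3

/-- A uniformizer in the ring of integers from a generator of the value group. -/
lemma exists_uniformizer {E : Type} [Field E] [Algebra ℚ_[p] E] (φ : E →ₐ[ℚ_[p]] Ω) {n : ℕ}
    {θ : E} (hn : 0 < n) (hθ : padicAbsoluteValue p Ω (φ θ) ^ n = padicAbsoluteValue p Ω (p : Ω))
    (hval : ∀ x : E, x ≠ 0 → ∃ m : ℤ,
      padicAbsoluteValue p Ω (φ x) = padicAbsoluteValue p Ω (φ θ) ^ m) :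
    ∃ πt : integralClosure ℤ_[p] E,
      (¬IsUnit πt ∧ ∀ x : integralClosure ℤ_[p] E, ¬IsUnit x → πt ∣ x) ∧
      ∃ u : integralClosure ℤ_[p] E, IsUnit u ∧ (p : integralClosure ℤ_[p] E) = u * πt ^ n := by
  have hp0 := padicAbsoluteValue_prime_pos (p := p) (Ω := Ω)
  have hp1 := padicAbsoluteValue_prime_lt_one (p := p) (Ω := Ω)
  have h1 : padicAbsoluteValue p Ω (φ θ) < 1 := by
    by_contra! h
    exact (hθ.symm ▸ hp1).not_ge (one_le_pow₀ h)
  have h0 : 0 < padicAbsoluteValue p Ω (φ θ) := by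
    refine ((padicAbsoluteValue p Ω).nonneg _).lt_of_ne fun h => ?_
    rw [← h, zero_pow hn.ne'] at hθ
    exact hp0.ne hθ
  have hθ0 : θ ≠ 0 := by rintro rfl; simp at h0
  obtain ⟨πt, rfl⟩ : ∃ πt : integralClosure ℤ_[p] E, (πt : E) = θ :=
    ⟨⟨θ, (padicAbsoluteValue_map_le_one_iff φ θ).1 h1.le⟩, rfl⟩
  have hπ0 : πt ≠ 0 := fun h => hθ0 (congrArg Subtype.val h)
  refine ⟨πt, ⟨fun h => h1.ne ((isUnit_iff_padicAbsoluteValue φ).1 h), fun x hx => ?_⟩, ?_⟩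
  · rw [dvd_iff_padicAbsoluteValue φ hπ0]
    rcases eq_or_ne (x : E) 0 with hx0 | hx0
    · rw [hx0]; simp
    have hx1 : padicAbsoluteValue p Ω (φ (x : E)) < 1 :=
      lt_of_le_of_ne (padicAbsoluteValue_integer_le φ x)
        fun h => hx ((isUnit_iff_padicAbsoluteValue φ).2 h)
    obtain ⟨m, hm⟩ := hval x hx0
    rw [hm] at hx1 ⊢
    have hm0 : 0 < m := by
      by_contra! h
      exact hx1.not_ge (one_le_zpow_of_nonpos₀ h0 h1.le h)
    calc padicAbsoluteValue p Ω (φ (πt : E)) ^ m ≤ padicAbsoluteValue p Ω (φ (πt : E)) ^ (1 : ℤ) :=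
          zpow_le_zpow_right_of_le_one₀ h0 h1.le (by omega)
      _ = _ := zpow_one _
  · obtain ⟨u, hu⟩ := (dvd_iff_padicAbsoluteValue φ (pow_ne_zero n hπ0)
      (x := (p : integralClosure ℤ_[p] E))).2 (by
        rw [coe_natCast_integer, map_natCast, Subalgebra.coe_pow, map_pow, map_pow, hθ])
    refine ⟨u, ?_, by rw [hu, mul_comm]⟩
    rw [isUnit_iff_padicAbsoluteValue φ]
    have h2 := congrArg (fun z : integralClosure ℤ_[p] E => padicAbsoluteValue p Ω (φ (z : E))) hu
    simp only [Subalgebra.coe_mul, Subalgebra.coe_pow, map_mul, map_pow, coe_natCast_integer,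
      map_natCast, hθ] at h2
    exact (mul_eq_left₀ hp0.ne').1 h2.symm

end PadicBridge

section PadicBridge

variable {p : ℕ} [Fact p.Prime] {Ω : Type} [Field Ω] [Algebra ℚ_[p] Ω]
  [Algebra.IsAlgebraic ℚ_[p] Ω]
  {K : Type} [Field K] [Algebra ℚ_[p] K] [Algebra K Ω] [IsScalarTower ℚ_[p] K Ω]
  (hKloc : ∀ x : integralClosure ℤ_[p] K, ¬IsUnit x → (p : integralClosure ℤ_[p] K) ∣ x)
  {κ : Type} [Field κ] [Finite κ] [CharP κ p] {ρ : integralClosure ℤ_[p] K →+* κ}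
  (hρ : Function.Surjective ρ)
  (hker : RingHom.ker ρ = Ideal.span {(p : integralClosure ℤ_[p] K)})

include hKloc hρ hker in
lemma padicLocalAbs_eis (hodd : Odd p) {ℓ r : ℕ} (hℓ2 : 2 ≤ ℓ) (hℓp : ℓ ≤ p - 1)
    (hr : r = p ^ 2 - (p - 1) * ℓ + p) {f : ℕ → integralClosure ℤ_[p] K}
    (hfE : ∀ i, 1 ≤ i → i ≤ p ^ 2 → (p : integralClosure ℤ_[p] K) ∣ f i)
    (hfE' : ¬(p : integralClosure ℤ_[p] K) ^ 2 ∣ f (p ^ 2))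
    (hR1a : ¬(p : integralClosure ℤ_[p] K) ^ 2 ∣ f p)
    (hR1b : ∀ i, 2 ≤ i → i ≤ p - 1 → Nat.Coprime i p →
      (p : integralClosure ℤ_[p] K) ^ 2 ∣ f (p * i))
    (hR2a : ∀ i, 1 ≤ i → i ≤ r - 1 → Nat.Coprime i p →
      (p : integralClosure ℤ_[p] K) ^ 2 ∣ f i)
    (hR2b : (p : integralClosure ℤ_[p] K) ^ 2 ∣ f r ∧
      ¬(p : integralClosure ℤ_[p] K) ^ 3 ∣ f r)
    (hR2c : ∀ i, r + 1 ≤ i → i ≤ p ^ 2 - 1 → Nat.Coprime i p →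
      (p : integralClosure ℤ_[p] K) ^ 3 ∣ f i) {π : Ω}
    (hπ : π ^ p ^ 2 + ∑ i ∈ Finset.range (p ^ 2),
        algebraMap K Ω (f (i + 1)) * π ^ (p ^ 2 - (i + 1)) = 0) :
    (padicLocalAbs (Ω := Ω) hKloc hρ hker).Eis ℓ r (fun i => algebraMap K Ω (f i)) π := by
  have hp := (Fact.out : p.Prime)
  have hp1 := hp.one_lt
  let φ := IsScalarTower.toAlgHom ℚ_[p] K Ω
  have hsq : p * ℓ ≤ p * p := Nat.mul_le_mul_left p (by omega)
  have hle : (p - 1) * ℓ ≤ p ^ 2 := by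
    rw [sq]; exact Nat.mul_le_mul (Nat.sub_le _ _) (by omega)
  have hdvd := fun x k => (prime_pow_dvd_iff (Ω := Ω) φ (x := x) k).1
  have heq := fun x k => padicAbsoluteValue_eq_pow (Ω := Ω) φ hKloc (x := x) (k := k)
  have hdvd' : ∀ x : integralClosure ℤ_[p] K, (p : integralClosure ℤ_[p] K) ∣ x →
      padicAbsoluteValue p Ω (φ (x : K)) ≤ padicAbsoluteValue p Ω (p : Ω) := fun x h => by
    have := hdvd x 1 (by rwa [pow_one])
    rwa [pow_one] at this
  have heq' : ∀ x : integralClosure ℤ_[p] K, (p : integralClosure ℤ_[p] K) ∣ x →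
      ¬ (p : integralClosure ℤ_[p] K) ^ 2 ∣ x →
      padicAbsoluteValue p Ω (φ (x : K)) = padicAbsoluteValue p Ω (p : Ω) := fun x h h' => by
    have := heq x 1 (by rwa [pow_one]) h'
    rwa [pow_one] at this
  have hpp : p ≤ p ^ 2 := Nat.le_self_pow two_ne_zero p
  refine ⟨hodd, hℓ2, by omega, by omega, fun i => IntermediateField.algebraMap_mem _ _,
    fun i h1 h2 => ?_, ?_, ?_, fun i h1 h2 => ?_, fun i h1 h2 h3 => ?_, ?_,
    fun i h1 h2 h3 => ?_, hπ⟩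
  · exact hdvd' (f i) (hfE i h1 h2)
  · exact heq' (f (p ^ 2)) (hfE (p ^ 2) (Nat.one_le_pow _ _ hp.pos) le_rfl) hfE'
  · exact heq' (f p) (hfE p hp1.le hpp) hR1a
  · exact hdvd _ 2 (hR1b i h1 (by omega) (by
      rw [Nat.coprime_comm]
      exact Nat.coprime_of_lt_prime (by omega) h2 hp))
  · exact hdvd _ 2 (hR2a i h1 (by omega) h3)
  · exact heq (f r) 2 hR2b.1 hR2b.2
  · exact hdvd _ 3 (hR2c i h1 (by omega) h3)

end PadicBridge

namespace LocalAbs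

lemma Eis.tr_adjoin {p : ℕ} [Fact p.Prime] {K Ω : Type*} [Field K] [Field Ω] [Algebra K Ω]
    {v : LocalAbs p K Ω} {ℓ r : ℕ} {c : ℕ → Ω} {π : Ω} (d : v.Eis ℓ r c π) :
    v.TR ⊥ (adjoin K {π}) (p ^ 2) π := by
  have hpos : 0 < p ^ 2 := pow_pos d.prime.pos 2
  choose k hk using fun i => IntermediateField.mem_bot.1 (d.mem i)
  have h := finrank_sup_adjoin_le (K := K) (Ω := Ω) ⊥ (x := π)
    (subPoly (p ^ 2) (fun i => (algebraMap K (⊥ : IntermediateField K Ω) (k (i / p ^ 2)))))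
    (subPoly_monic _) (by
      simp only [subPoly, map_add, map_pow, aeval_X, map_sum, map_mul, aeval_C,
          ← IsScalarTower.algebraMap_apply, hk, Nat.mul_div_cancel_left _ hpos]
      exact d.root)
  rw [natDegree_subPoly, bot_sup_eq] at h
  exact ⟨bot_le, h.1, inferInstance, unram_bot, mem_adjoin_simple_self K π, hpos, d.N_pow, h.2⟩

end LocalAbs

section Transport

variable {K L Ω : Type} [Field K] [Field L] [Field Ω] [Algebra K L]
    [Algebra K Ω] [Algebra L Ω] [IsScalarTower K L Ω] {F : IntermediateField K L}

lemma mem_galFix_iff {E : IntermediateField K Ω} {τ : E ≃ₐ[K] E} :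
    τ ∈ galFix F E ↔
      ∀ y : E, (y : Ω) ∈ F.map (IsScalarTower.toAlgHom K L Ω) → τ y = y := by
  constructor
  · rintro h y ⟨x, hx, hxy⟩
    exact h ⟨x, hx⟩ y hxy.symm
  · intro h x y hxy
    exact h y ⟨x, x.2, hxy.symm⟩

lemma IsLiftOf.not_mem_galFix {E : IntermediateField K Ω}
    (hE : (IsScalarTower.toAlgHom K L Ω).fieldRange ≤ E) {σ : F ≃ₐ[K] F} (hσ : σ ≠ 1)
    {g : E ≃ₐ[K] E} (hg : IsLiftOf F E σ g) : g ∉ galFix F E := by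
  intro h
  apply hσ
  ext x
  have hx : algebraMap L Ω (x : L) ∈ E := hE ⟨x, rfl⟩
  have h1 := hg x ⟨_, hx⟩ rfl
  rw [h x ⟨_, hx⟩ rfl] at h1
  exact ((algebraMap L Ω).injective h1).symm

lemma finrank_map (F : IntermediateField K L) (j : L →ₐ[K] Ω) :
    Module.finrank K (F.map j) = Module.finrank K F :=
  ((F.equivMap j).toLinearEquiv.finrank_eq).symm

lemma eq_map_of_unique {p : ℕ} (j : L →ₐ[K] Ω)
    (h : ∀ F' : IntermediateField K L, Module.finrank K F' = p → F' = F)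
    {E : IntermediateField K Ω} (hE : E ≤ j.fieldRange) (hEp : Module.finrank K E = p) :
    E = F.map j := by
  have h1 : (E.comap j).map j = E := by rw [IntermediateField.map_comap_eq_self hE]
  rw [← h (E.comap j) (by rw [← finrank_map _ j, h1, hEp]), h1]

lemma ne_one_of_generator {p : ℕ} [Fact p.Prime] (hF : Module.finrank K F = p) [IsGalois K F]
    {σ : F ≃ₐ[K] F} (hσ : ∀ τ : F ≃ₐ[K] F, τ ∈ Subgroup.zpowers σ) : σ ≠ 1 := by
  rintro rfl
  have hp := (Fact.out : p.Prime)
  have hfd : FiniteDimensional K F := FiniteDimensional.of_finrank_pos (by rw [hF]; exact hp.pos)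
  have hcard : Nat.card (F ≃ₐ[K] F) = p := by rw [IsGalois.card_aut_eq_finrank, hF]
  have hs : Subsingleton (F ≃ₐ[K] F) := ⟨fun a b => by
    have ha := hσ a
    have hb := hσ b
    rw [Subgroup.zpowers_one_eq_bot, Subgroup.mem_bot] at ha hb
    rw [ha, hb]⟩
  rw [Nat.card_of_subsingleton (1 : F ≃ₐ[K] F)] at hcard
  exact hp.one_lt.ne hcard

lemma exists_not_fix {p : ℕ} [Fact p.Prime] [IsGalois K Ω] {E : IntermediateField K Ω}
    (hE : Module.finrank K E = p) : ∃ g : Ω ≃ₐ[K] Ω, ¬ ∀ x ∈ E, g x = x := by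
  by_contra! h
  have hb : E = ⊥ := le_bot_iff.1 fun x hx =>
    LocalAbs.mem_of_fixed ⊥ x fun g _ => h g x hx
  rw [hb, IntermediateField.finrank_bot] at hE
  exact (Fact.out : p.Prime).one_lt.ne hE

lemma normalClosure_le_of_forall [Normal K Ω] {E : IntermediateField K Ω}
    (h : ∀ τ : Ω ≃ₐ[K] Ω, ∀ x ∈ (IsScalarTower.toAlgHom K L Ω).fieldRange, τ x ∈ E) :
    normalClosure K L Ω ≤ E := by
  rw [normalClosure_le_iff]
  rintro f _ ⟨x, rfl⟩
  have h1 := h (AlgEquiv.ofBijective (f.liftNormal Ω) (AlgHom.normal_bijective K Ω Ω _))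
    (algebraMap L Ω x) ⟨x, rfl⟩
  rw [AlgEquiv.ofBijective_apply, AlgHom.liftNormal_commutes] at h1
  exact h1

lemma map_mem_of_normal {E : IntermediateField K Ω} [Normal K E] (τ : Ω ≃ₐ[K] Ω) {x : Ω}
    (hx : x ∈ E) : τ x ∈ E := by
  rw [← AlgEquiv.restrictNormalHom_apply E τ ⟨x, hx⟩]
  exact Subtype.mem _

end Transport

section PadicBridge

variable {p : ℕ} [Fact p.Prime] {Ω : Type} [Field Ω] [Algebra ℚ_[p] Ω]
  [Algebra.IsAlgebraic ℚ_[p] Ω]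
  {K : Type} [Field K] [Algebra ℚ_[p] K] [Algebra K Ω] [IsScalarTower ℚ_[p] K Ω]
  (hKloc : ∀ x : integralClosure ℤ_[p] K, ¬IsUnit x → (p : integralClosure ℤ_[p] K) ∣ x)
  {κ : Type} [Field κ] [Finite κ] [CharP κ p] {ρ : integralClosure ℤ_[p] K →+* κ}
  (hρ : Function.Surjective ρ)
  (hker : RingHom.ker ρ = Ideal.span {(p : integralClosure ℤ_[p] K)})

include hker in
lemma padicLocalAbs_N_eq_one {x : integralClosure ℤ_[p] K} (hx : ρ x ≠ 0) :
    (padicLocalAbs (Ω := Ω) hKloc hρ hker).N (algebraMap K Ω (x : K)) = 1 := by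
  refine (isUnit_iff_padicAbsoluteValue (IsScalarTower.toAlgHom ℚ_[p] K Ω)).1 ?_
  by_contra h
  obtain ⟨y, rfl⟩ := hKloc x h
  apply hx
  rw [← RingHom.mem_ker, hker]
  exact Ideal.mul_mem_right _ _ (Ideal.mem_span_singleton_self _)

lemma padicLocalAbs_ratio {a b a' : integralClosure ℤ_[p] K} (hb : ρ b ≠ 0)
    (ha' : ρ a' = ρ a / ρ b) : (padicLocalAbs (Ω := Ω) hKloc hρ hker).N
      (algebraMap K Ω (a' : K) - algebraMap K Ω (a : K) / algebraMap K Ω (b : K)) < 1 := by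
  have hb1 := padicLocalAbs_N_eq_one (Ω := Ω) hKloc hρ hker hb
  have hb0 : algebraMap K Ω (b : K) ≠ 0 := by
    intro h; rw [h, map_zero] at hb1; exact zero_ne_one hb1
  have h : ρ (a' * b) = ρ a := by rw [map_mul, ha', div_mul_cancel₀ _ hb]
  rw [residue_eq_iff (Ω := Ω) hKloc hρ hker] at h
  have h2 : algebraMap K Ω (a' : K) - algebraMap K Ω (a : K) / algebraMap K Ω (b : K) =
      (algebraMap K Ω ((a' * b : integralClosure ℤ_[p] K) : K) - algebraMap K Ω (a : K)) /
        algebraMap K Ω (b : K) := by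
    rw [MulMemClass.coe_mul, map_mul]; field_simp
  rw [h2, map_div₀, hb1, div_one]
  exact h

lemma padicLocalAbs_sim {ℓ n : ℕ} {a b g B : integralClosure ℤ_[p] K} (ha : ρ a ≠ 0) (hb : ρ b ≠ 0)
    (hB : ρ B ^ n * ℓ * ρ g = ρ a * ρ b) :
    (padicLocalAbs (Ω := Ω) hKloc hρ hker).Sim
      (algebraMap K Ω (B : K) ^ n * ℓ *
        algebraMap K Ω ((p ^ 2 * g : integralClosure ℤ_[p] K) : K))
      (algebraMap K Ω ((p * a : integralClosure ℤ_[p] K) : K) *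
        algebraMap K Ω ((p * b : integralClosure ℤ_[p] K) : K)) := by
  have h : ρ (B ^ n * ℓ * g) = ρ (a * b) := by simpa using hB
  rw [residue_eq_iff (Ω := Ω) hKloc hρ hker] at h
  have ha1 := padicLocalAbs_N_eq_one (Ω := Ω) hKloc hρ hker ha
  have hb1 := padicLocalAbs_N_eq_one (Ω := Ω) hKloc hρ hker hb
  have hp0 := (padicLocalAbs (Ω := Ω) hKloc hρ hker).p_pos
  rw [LocalAbs.Sim]
  have e1 : algebraMap K Ω (B : K) ^ n * ℓ *
        algebraMap K Ω ((p ^ 2 * g : integralClosure ℤ_[p] K) : K) -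
      algebraMap K Ω ((p * a : integralClosure ℤ_[p] K) : K) *
        algebraMap K Ω ((p * b : integralClosure ℤ_[p] K) : K) =
      (p : Ω) ^ 2 * (algebraMap K Ω ((B ^ n * ℓ * g : integralClosure ℤ_[p] K) : K) -
        algebraMap K Ω ((a * b : integralClosure ℤ_[p] K) : K)) := by
    simp only [MulMemClass.coe_mul, SubmonoidClass.coe_pow, coe_natCast_integer, map_mul, map_pow,
      map_natCast]
    ring
  have e2 : algebraMap K Ω ((p * a : integralClosure ℤ_[p] K) : K) *
        algebraMap K Ω ((p * b : integralClosure ℤ_[p] K) : K) =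
      (p : Ω) ^ 2 * (algebraMap K Ω (a : K) * algebraMap K Ω (b : K)) := by
    simp only [MulMemClass.coe_mul, coe_natCast_integer, map_mul, map_natCast]
    ring
  rw [e1, e2, map_mul, map_mul, map_mul, ha1, hb1, mul_one]
  exact mul_lt_mul_of_pos_left h (by rw [map_pow]; positivity)

lemma LocalAbs.TR.exists_uniformizer [IsAlgClosed Ω] {W M : IntermediateField K Ω} {n : ℕ} {θ : Ω}
    (h : (padicLocalAbs (Ω := Ω) hKloc hρ hker).TR W M n θ) :
    ∃ πt : integralClosure ℤ_[p] M,
      (¬IsUnit πt ∧ ∀ x : integralClosure ℤ_[p] M, ¬IsUnit x → πt ∣ x) ∧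
      ∃ u : integralClosure ℤ_[p] M, IsUnit u ∧ (p : integralClosure ℤ_[p] M) = u * πt ^ n := by
  let φ : M →ₐ[ℚ_[p]] Ω := { M.val with
    commutes' := fun x => (IsScalarTower.algebraMap_apply ℚ_[p] K Ω x).symm }
  exact _root_.exists_uniformizer φ (θ := ⟨θ, h.mem⟩) h.pos h.val fun x hx =>
    h.value x.2 fun h0 => hx (Subtype.ext h0)

end PadicBridge

/-- Let `2 ≤ ℓ ≤ p−1`, `r = p² − (p−1)ℓ + p`, and `f` Eisenstein of degree
`p²` over a finite unramified `K/ℚ_p` (`p` odd) satisfying conditions (1)–(4) (in particular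
`ℓ·G_r/(F_pF_{p²}) ∈ (κ^×)^{p−1}`), `L = K(π)`, `F` the unique degree-`p` subextension, `L̃` the
normal closure of `L/K`, `σ` a generator of `G = Gal(F/K)`, and
`U(X) = (−F_p/F_{p²})^ℓ·X^p − (ℓ·G_r/(F_pF_{p²}))·X − 1`.  Then `1 → Gal(L̃/F) → Gal(L̃/K) → G → 1`
splits, `M = Gal(L̃/F)` is an indecomposable `𝔽_p[G]`-module under conjugation, of length `ℓ+1`
with an unramified part of degree `p` in `L̃/K` if `U` has no root in `κ`, and of length `ℓ` with
`L̃/K` totally ramified if `U` has a root in `κ`. -/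
theorem stmt17 (p : ℕ) [Fact (Nat.Prime p)] (hodd : Odd p)
    (K : Type) [Field K] [Algebra ℚ_[p] K] [FiniteDimensional ℚ_[p] K]
    (hKloc : ∀ x : integralClosure ℤ_[p] K, ¬IsUnit x → (p : integralClosure ℤ_[p] K) ∣ x)
    (hKp : ¬IsUnit (p : integralClosure ℤ_[p] K))
    -- the residue field
    (κ : Type) [Field κ] [Finite κ] [CharP κ p]
    (ρ : integralClosure ℤ_[p] K →+* κ) (hρ : Function.Surjective ρ)
    (hker : RingHom.ker ρ = Ideal.span {(p : integralClosure ℤ_[p] K)})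
    -- the indices
    (ℓ r : ℕ) (hℓ2 : 2 ≤ ℓ) (hℓp : ℓ ≤ p - 1) (hr : r = p ^ 2 - (p - 1) * ℓ + p)
    -- an Eisenstein polynomial of degree `p²`
    (f : ℕ → integralClosure ℤ_[p] K)
    (hfE : ∀ i, 1 ≤ i → i ≤ p ^ 2 → (p : integralClosure ℤ_[p] K) ∣ f i)
    (hfE' : ¬(p : integralClosure ℤ_[p] K) ^ 2 ∣ f (p ^ 2))
    -- witnesses for `F_p = ρ a`, `F_{p²} = ρ b`, `G_i = ρ (g i)`
    (a b : integralClosure ℤ_[p] K) (g : ℕ → integralClosure ℤ_[p] K)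
    (ha : f p = p * a) (hb : f (p ^ 2) = p * b)
    (hg : ∀ i, 1 ≤ i → i < p ^ 2 → i ≠ p → f i = p ^ 2 * g i)
    -- (1)  `v_p(f_p) = 1` and `v_p(f_{pi}) ≥ 2` for `i ∈ 𝕀(2,p−1)`
    (hR1a : ¬(p : integralClosure ℤ_[p] K) ^ 2 ∣ f p)
    (hR1b : ∀ i, 2 ≤ i → i ≤ p - 1 → Nat.Coprime i p →
      (p : integralClosure ℤ_[p] K) ^ 2 ∣ f (p * i))
    -- (2)  `v_p(f_i) ≥ 2` for `i ∈ 𝕀(1,r−1)`, `v_p(f_r) = 2`, `v_p(f_i) ≥ 3` for `i ∈ 𝕀(r+1,p²−1)`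
    (hR2a : ∀ i, 1 ≤ i → i ≤ r - 1 → Nat.Coprime i p →
      (p : integralClosure ℤ_[p] K) ^ 2 ∣ f i)
    (hR2b : (p : integralClosure ℤ_[p] K) ^ 2 ∣ f r ∧
      ¬(p : integralClosure ℤ_[p] K) ^ 3 ∣ f r)
    (hR2c : ∀ i, r + 1 ≤ i → i ≤ p ^ 2 - 1 → Nat.Coprime i p →
      (p : integralClosure ℤ_[p] K) ^ 3 ∣ f i)
    -- (3)  `−F_p/F_{p²} ∈ (κ^×)^{p−1}`;  (4)  `ℓ·G_r/(F_p·F_{p²}) ∈ (κ^×)^{p−1}`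
    (h3 : ∃ c : κ, c ≠ 0 ∧ c ^ (p - 1) = -ρ a / ρ b)
    (h4 : ∃ c : κ, c ≠ 0 ∧ c ^ (p - 1) = (ℓ : κ) * ρ (g r) / (ρ a * ρ b))
    -- the extension `L = K(π)` generated by a root of `f`
    (L : Type) [Field L] [Algebra K L] (π : L)
    (hπ : aeval π (X ^ p ^ 2 + ∑ i ∈ Finset.range (p ^ 2),
        C ((f (i + 1) : K)) * X ^ (p ^ 2 - (i + 1))) = 0)
    (hgen : adjoin K {π} = ⊤)
    -- `F` is the unique degree-`p` subextension, `σ` a generator of `Gal(F/K)`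
    (F : IntermediateField K L) (hFdeg : Module.finrank K F = p)
    (hFuniq : ∀ F' : IntermediateField K L, Module.finrank K F' = p → F' = F)
    (hFgal : IsGalois K F)
    (σ : F ≃ₐ[K] F) (hσ : ∀ τ : F ≃ₐ[K] F, τ ∈ Subgroup.zpowers σ)
    -- an algebraic closure of `K` containing `L`, and the normal closure `L̃` of `L/K` in it
    (Ω : Type) [Field Ω] [Algebra K Ω] [Algebra L Ω] [IsScalarTower K L Ω] [IsAlgClosure K Ω] :
    -- the extension `1 → Gal(L̃/F) → Gal(L̃/K) → G → 1` splits
    (∃ C : Subgroup (normalClosure K L Ω ≃ₐ[K] normalClosure K L Ω),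
      Subgroup.IsComplement' (galFix F (normalClosure K L Ω)) C) ∧
    -- `M = Gal(L̃/F)` is elementary abelian
    (∀ τ ∈ galFix F (normalClosure K L Ω), τ ^ p = 1) ∧
    (∀ τ₁ ∈ galFix F (normalClosure K L Ω), ∀ τ₂ ∈ galFix F (normalClosure K L Ω),
      τ₁ * τ₂ = τ₂ * τ₁) ∧
    -- case (i): `U(X) = (−F_p/F_{p²})^ℓ·X^p − (ℓ·G_r/(F_pF_{p²}))·X − 1` has no root in `κ`
    ((¬∃ x : κ,
        (-ρ a / ρ b) ^ ℓ * x ^ p - (ℓ : κ) * ρ (g r) / (ρ a * ρ b) * x - 1 = 0) →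
      -- `M` is the indecomposable module of length `ℓ+1`
      Nat.card (galFix F (normalClosure K L Ω)) = p ^ (ℓ + 1) ∧
      (∀ gl : normalClosure K L Ω ≃ₐ[K] normalClosure K L Ω,
        IsLiftOf F (normalClosure K L Ω) σ gl →
          (∀ τ ∈ galFix F (normalClosure K L Ω),
            (fun h => gl * h * gl⁻¹ * h⁻¹)^[ℓ + 1] τ = 1) ∧
          (∃ τ ∈ galFix F (normalClosure K L Ω),
            (fun h => gl * h * gl⁻¹ * h⁻¹)^[ℓ] τ ≠ 1)) ∧
      -- `L̃/K` has an unramified part of degree `p`:  `v_{L̃}(p) = [L̃:K]/p`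
      (∃ πt : integralClosure ℤ_[p] (normalClosure K L Ω),
        (¬IsUnit πt ∧
          ∀ x : integralClosure ℤ_[p] (normalClosure K L Ω), ¬IsUnit x → πt ∣ x) ∧
        ∃ u : integralClosure ℤ_[p] (normalClosure K L Ω), IsUnit u ∧
          (p : integralClosure ℤ_[p] (normalClosure K L Ω)) =
            u * πt ^ (Module.finrank K (normalClosure K L Ω) / p))) ∧
    -- case (ii): `U(X)` has a root in `κ`
    ((∃ x : κ,
        (-ρ a / ρ b) ^ ℓ * x ^ p - (ℓ : κ) * ρ (g r) / (ρ a * ρ b) * x - 1 = 0) →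
      -- `M` is the indecomposable module of length `ℓ`
      Nat.card (galFix F (normalClosure K L Ω)) = p ^ ℓ ∧
      (∀ gl : normalClosure K L Ω ≃ₐ[K] normalClosure K L Ω,
        IsLiftOf F (normalClosure K L Ω) σ gl →
          (∀ τ ∈ galFix F (normalClosure K L Ω),
            (fun h => gl * h * gl⁻¹ * h⁻¹)^[ℓ] τ = 1) ∧
          (∃ τ ∈ galFix F (normalClosure K L Ω),
            (fun h => gl * h * gl⁻¹ * h⁻¹)^[ℓ - 1] τ ≠ 1)) ∧
      -- `L̃/K` is totally ramified:  `v_{L̃}(p) = [L̃:K]`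
      (∃ πt : integralClosure ℤ_[p] (normalClosure K L Ω),
        (¬IsUnit πt ∧
          ∀ x : integralClosure ℤ_[p] (normalClosure K L Ω), ¬IsUnit x → πt ∣ x) ∧
        ∃ u : integralClosure ℤ_[p] (normalClosure K L Ω), IsUnit u ∧
          (p : integralClosure ℤ_[p] (normalClosure K L Ω)) =
            u * πt ^ Module.finrank K (normalClosure K L Ω))) := by
  have hp := (Fact.out : p.Prime)
  let _ : Algebra ℚ_[p] Ω := ((algebraMap K Ω).comp (algebraMap ℚ_[p] K)).toAlgebra
  have hst : IsScalarTower ℚ_[p] K Ω := .of_algebraMap_eq fun _ => rfl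
  have hclosed : IsAlgClosed Ω := IsAlgClosure.isAlgClosed K
  have halgK : Algebra.IsAlgebraic K Ω := IsAlgClosure.isAlgebraic
  have halg : Algebra.IsAlgebraic ℚ_[p] Ω := Algebra.IsAlgebraic.trans ℚ_[p] K Ω
  have hchar : CharZero K := charZero_of_injective_algebraMap (algebraMap ℚ_[p] K).injective
  have hnormal : Normal K Ω := normal_iff.2 fun x =>
    ⟨halgK.isAlgebraic x |>.isIntegral, IsAlgClosed.splits _⟩
  have hgalΩ : IsGalois K Ω := IsGalois.mk
  let v := padicLocalAbs (Ω := Ω) hKloc hρ hker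
  let j := IsScalarTower.toAlgHom K L Ω
  have hroot : algebraMap L Ω π ^ p ^ 2 + ∑ i ∈ Finset.range (p ^ 2),
      algebraMap K Ω (f (i + 1)) * algebraMap L Ω π ^ (p ^ 2 - (i + 1)) = 0 := by
    have h := congrArg (algebraMap L Ω) hπ
    simpa [← IsScalarTower.algebraMap_apply] using h
  have d := padicLocalAbs_eis (Ω := Ω) hKloc hρ hker hodd hℓ2 hℓp hr hfE hfE' hR1a hR1b hR2a hR2b
    hR2c hroot
  have hj : j.fieldRange = adjoin K {algebraMap L Ω π} := by
    rw [AlgHom.fieldRange_eq_map, ← hgen, adjoin_map, Set.image_singleton]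
    rfl
  have hL := d.tr_adjoin
  rw [← hj] at hL
  have hfdL : FiniteDimensional K L :=
    have : FiniteDimensional K j.range := hL.fd
    Module.Finite.equiv (AlgEquiv.ofInjectiveField j).symm.toLinearEquiv
  have hMn : Normal K (normalClosure K L Ω) := inferInstance
  have hMfd : FiniteDimensional K (normalClosure K L Ω) := inferInstance
  have hLM : j.fieldRange ≤ normalClosure K L Ω := j.fieldRange_le_normalClosure
  have hFj : F.map j ≤ j.fieldRange := by
    rw [AlgHom.fieldRange_eq_map]; exact IntermediateField.map_mono _ le_top
  have hFdim : Module.finrank K (F.map j) = p := by rw [finrank_map, hFdeg]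
  have hFg : IsGalois K (F.map j) := IsGalois.of_algEquiv (F.equivMap j)
  obtain ⟨c3, hc30, hc3⟩ := h3
  obtain ⟨c4, hc40, hc4⟩ := h4
  have hra : ρ a ≠ 0 := by
    intro h; rw [h, neg_zero, zero_div] at hc3; exact pow_ne_zero _ hc30 hc3
  have hrb : ρ b ≠ 0 := by
    intro h; rw [h, div_zero] at hc3; exact pow_ne_zero _ hc30 hc3
  obtain ⟨B, hB⟩ := hρ c4⁻¹
  obtain ⟨a', ha'⟩ := hρ (ρ a / ρ b)
  have hB0 : ρ B ≠ 0 := by rw [hB]; exact inv_ne_zero hc40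
  have hBs : ρ B ^ (p - 1) * ℓ * ρ (g r) = ρ a * ρ b := by
    have hne := pow_ne_zero (p - 1) hc40
    have := hc4
    rw [eq_div_iff (mul_ne_zero hra hrb)] at this
    rw [hB, inv_pow, mul_assoc, ← this, inv_mul_cancel_left₀ hne]
  obtain ⟨hr1, hr2, hr3, -, -⟩ := d.r_facts
  have hsim : v.Sim (algebraMap K Ω (B : K) ^ (p - 1) * ℓ * algebraMap K Ω (f r))
      (algebraMap K Ω (f p) * algebraMap K Ω (f (p ^ 2))) := by
    rw [ha, hb, hg r hr1 hr2 (by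
      rintro rfl
      exact hp.ne_one (by simpa using hr3))]
    exact padicLocalAbs_sim hKloc hρ hker hra hrb hBs
  obtain ⟨η, α, lam, -, hdat⟩ := d.exists_datum (F := F.map j) (M := normalClosure K L Ω)
    hL (IntermediateField.algebraMap_mem _ _)
    (padicLocalAbs_N_eq_one hKloc hρ hker hB0) hsim
    (fun E hE hEp => eq_map_of_unique j hFuniq hE hEp)
    (fun τ x hx => map_mem_of_normal τ hx) (fun τ x hx => map_mem_of_normal τ hx)
    hMfd hLM (fun E hE => normalClosure_le_of_forall hE)
  have hd : ∀ s : Ω ≃ₐ[K] Ω, (¬ ∀ x ∈ F.map j, s x = x) →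
      LocalAbs.Datum v ℓ (F.map j) (normalClosure K L Ω) η α lam s := fun s hs =>
    (hdat s hs fun τ => LocalAbs.exists_pow_eq_of_prime hFdim hs τ).1
  have hU : ∀ s : Ω ≃ₐ[K] Ω, (¬ ∀ x ∈ F.map j, s x = x) →
      ((∃ x : κ, (-ρ a / ρ b) ^ ℓ * x ^ p - (ℓ : κ) * ρ (g r) / (ρ a * ρ b) * x - 1 = 0) ↔
        ∃ u : K, v.q (algebraMap K Ω u ^ p - algebraMap K Ω u) =
          v.q ((LocalAbs.D s ^ ℓ) α)) := by
    intro s hs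
    obtain ⟨-, γ, hγ, e, he, hγ1, hγc, hγs⟩ :=
      hdat s hs fun τ => LocalAbs.exists_pow_eq_of_prime hFdim hs τ
    have hA : -ρ a / ρ b ≠ 0 := div_ne_zero (neg_ne_zero.2 hra) hrb
    rw [← hc4]
    have h := exists_root_iff_exists_q (Ω := Ω) hKloc hρ hker (ℓ := ℓ) (inv_ne_zero hc40) hA hB hγ
      he hγ1 (a := a') (by rw [ha', neg_div, neg_neg]) (by
        have h1 := padicLocalAbs_ratio (Ω := Ω) hKloc hρ hker hrb ha'
        have h2 := v.N_add_lt hγc h1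
        have h3 : (p : Ω) ≠ 0 := fun h => v.p_pos.ne' (by rw [h, map_zero])
        rw [ha, hb] at h2
        simp only [MulMemClass.coe_mul, coe_natCast_integer, map_mul, map_natCast] at h2
        rw [mul_div_mul_left _ _ h3] at h2
        convert h2 using 2
        ring) hγs
    rwa [inv_inv] at h
  have hH := fun τ => mem_galFix_iff (F := F) (E := normalClosure K L Ω) (τ := τ)
  have hFM := hFj.trans hLM
  obtain ⟨s, hs⟩ := exists_not_fix hFdim
  have hgl : ∀ gl : normalClosure K L Ω ≃ₐ[K] normalClosure K L Ω,
      IsLiftOf F (normalClosure K L Ω) σ gl → gl ∉ galFix F (normalClosure K L Ω) :=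
    fun gl h => h.not_mem_galFix hLM (ne_one_of_generator hFdeg hσ)
  refine ⟨?_, fun τ hτ => LocalAbs.pow_eq_one hFM hH hFdim hd hs hτ,
    fun τ₁ h₁ τ₂ h₂ => LocalAbs.mul_comm_of_mem hFM hH hFdim hd hs h₁ h₂, fun hno => ?_,
    fun hyes => ?_⟩
  · obtain ⟨C, hC, -⟩ := LocalAbs.exists_isComplement hFM hH hFdim hd hs
    exact ⟨C, hC⟩
  · have hu := fun s hs => (hU s hs).not.1 hno
    obtain ⟨W, θ, hθ, hW⟩ := (hd s hs).exists_tr_unram (hu s hs)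
    have hdim := hθ.finrank_eq
    rw [hW] at hdim
    refine ⟨LocalAbs.card_eq hFM hH hFdim hd hs (by rw [hdim, mul_comm]), fun gl h =>
      ⟨fun τ hτ => LocalAbs.iterate_eq_one hFM hH hFdim hd (hgl gl h) hτ,
        LocalAbs.exists_iterate_ne_one hFM hH hFdim hd (hgl gl h) hu⟩, ?_⟩
    rw [hdim, Nat.mul_div_cancel _ hp.pos]
    exact hθ.exists_uniformizer
  · have hu := fun s hs => (hU s hs).1 hyes
    obtain ⟨θ, hθ⟩ := (hd s hs).exists_tr_bot (hu s hs)
    have hdim := hθ.finrank_eq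
    rw [IntermediateField.finrank_bot, mul_one] at hdim
    refine ⟨LocalAbs.card_eq hFM hH hFdim hd hs (by rw [hdim, pow_succ']), fun gl h =>
      ⟨fun τ hτ => LocalAbs.iterate_eq_one' hFM hH hFdim hd (hgl gl h) hu hτ,
        LocalAbs.exists_iterate_pred_ne_one hFM hH hFdim hd (hgl gl h)⟩, ?_⟩
    rw [hdim]
    exact hθ.exists_uniformizer
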